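/- (Ingham's theorem for the Strichartz Fourier transform.) Let Θ : [0,∞) → [0,∞) be decreasing with Θ(t) → 0 as t → ∞. Then the following are equivalent: (i) ∫_1^∞ Θ(t) t^{−1} dt < ∞; (ii) there exist a compactly supported f ∈ L¹(ℍⁿ) with f ≠ 0 (as an element of L¹) and a constant C > 0 such that |λ|^n ∫_{ℂⁿ} |f̂((λ,(2k+n)|λ|), z)|² dz ≤ C ((k+n−1)!/(k!(n−1)!)) e^{−√((2k+n)|λ|) · Θ(√((2k+n)|λ|))} for all λ ≠ 0 and all k ∈ ℕ. -/

import Mathlib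

open MeasureTheory Complex Real Filter

noncomputable section

/-- ℂⁿ with its Euclidean (Hilbert space) structure. -/
abbrev Cn (n : ℕ) := EuclideanSpace ℂ (Fin n)

instance (n : ℕ) : MeasurableSpace (Cn n) := borel _
instance (n : ℕ) : BorelSpace (Cn n) := ⟨rfl⟩
instance (n : ℕ) : InnerProductSpace ℝ (Cn n) := InnerProductSpace.rclikeToReal ℂ (Cn n)

/-- The Heisenberg group ℍⁿ = ℂⁿ × ℝ (as a measure space with Lebesgue/Haar measure). -/
abbrev Hn (n : ℕ) := Cn n × ℝ

/-- Im (z · w̄) = Im (∑ⱼ zⱼ conj wⱼ). -/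
def imZW {n : ℕ} (z w : Cn n) : ℝ := (∑ j, z j * (starRingEnd ℂ) (w j)).im

/-- The λ-twisted convolution F ∗_λ G (z) = ∫ F(z−w) G(w) e^{(i/2)λ Im(z·w̄)} dw. -/
def twConv (n : ℕ) (lam : ℝ) (F G : Cn n → ℂ) (z : Cn n) : ℂ :=
  ∫ w : Cn n, F (z - w) * G w * Complex.exp
    (Complex.I / 2 * (lam : ℂ) * ((imZW z w : ℝ) : ℂ))

/-- The inverse Fourier transform in the central variable, f^λ(z) = ∫ e^{iλt} f(z,t) dt. -/
def fLam (n : ℕ) (f : Hn n → ℂ) (lam : ℝ) (z : Cn n) : ℂ :=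
  ∫ t : ℝ, Complex.exp (Complex.I * (lam : ℂ) * (t : ℂ)) * f (z, t)

/-- The Laguerre polynomial of type m−1:
L_k^{m−1}(t) = ∑_{j=0}^k binom(k+m−1, k−j) (−t)^j / j!. -/
def lagPoly (m k : ℕ) (t : ℝ) : ℝ :=
  ∑ j ∈ Finset.range (k + 1), ((k + m - 1).choose (k - j) : ℝ) * (-t) ^ j / (Nat.factorial j)

/-- The Laguerre function φ_{k,λ}^{m−1}(z) = L_k^{m−1}(|λ||z|²/2) e^{−|λ||z|²/4} on ℂ^m. -/
def lagFun (m k : ℕ) (lam : ℝ) (z : Cn m) : ℝ :=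
  lagPoly m k (|lam| * ‖z‖ ^ 2 / 2) * Real.exp (-(|lam| * ‖z‖ ^ 2 / 4))

/-- The Strichartz Fourier transform f̂(a,z) = f^{−λ} ∗_{−λ} φ_{k,λ}(z)
at the point a = (λ, (2k+n)|λ|) of the ray R_k. -/
def stri (n : ℕ) (f : Hn n → ℂ) (k : ℕ) (lam : ℝ) (z : Cn n) : ℂ :=
  twConv n (-lam) (fLam n f (-lam)) (fun w => ((lagFun n k lam w : ℝ) : ℂ)) z

/-- The normalizing constant k!(n−1)!/(k+n−1)!. -/
def normC (n k : ℕ) : ℝ :=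
  (Nat.factorial k * Nat.factorial (n - 1) : ℝ) / (Nat.factorial (k + n - 1))

/-- The Bessel kernel J_{n−1}(s)/s^{n−1}, extended by its limiting value
1/(2^{n−1}(n−1)!) at s = 0, given by its power series. -/
def besselKer (n : ℕ) (s : ℝ) : ℝ :=
  ∑' m : ℕ, (-1 : ℝ) ^ m / (Nat.factorial m * Nat.factorial (m + n - 1)) *
    s ^ (2 * m) / 2 ^ (2 * m + n - 1)

/-- The Strichartz Fourier transform f̂((0,τ),z) on the limiting ray R_∞. -/
def striLim (n : ℕ) (f : Hn n → ℂ) (z : Cn n) (τ : ℝ) : ℂ :=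
  ((Nat.factorial (n - 1) * 2 ^ (n - 1) : ℝ) : ℂ) *
    ∫ w : Cn n, fLam n f 0 (z - w) * ((besselKer n (Real.sqrt τ * ‖w‖) : ℝ) : ℂ)

/-- The Heisenberg fan Ω ⊆ ℝ²: union of the rays R_k, k ∈ ℕ, and the limiting ray R_∞. -/
def fan (n : ℕ) : Set (ℝ × ℝ) :=
  {a | (∃ k : ℕ, a.1 ≠ 0 ∧ a.2 = (2 * k + n) * |a.1|) ∨ (a.1 = 0 ∧ 0 ≤ a.2)}

open scoped Classical in
/-- The index k of the ray R_k through a point of the fan (junk value otherwise). -/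
def fanK (n : ℕ) (a : ℝ × ℝ) : ℕ :=
  if h : ∃ k : ℕ, a.2 = (2 * k + n) * |a.1| then h.choose else 0

/-- The normalized Strichartz Fourier transform f̃(a,z), as a function of a ∈ Ω. -/
def striNorm (n : ℕ) (f : Hn n → ℂ) (z : Cn n) (a : ℝ × ℝ) : ℂ :=
  if a.1 = 0 then striLim n f z a.2
  else ((normC n (fanK n a) : ℝ) : ℂ) * stri n f (fanK n a) a.1 z

/-- The Plancherel measure ν on the Heisenberg fan:
∫ φ dν = (2π)^{−2n−1} ∫_ℝ (∑_k φ(λ,(2k+n)|λ|)) |λ|^{2n} dλ. -/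
def fanMeasure (n : ℕ) : Measure (ℝ × ℝ) :=
  (ENNReal.ofReal ((2 * π) ^ (2 * n + 1)))⁻¹ •
    Measure.sum (fun k : ℕ =>
      Measure.map (fun lam : ℝ => (lam, (2 * k + n) * |lam|))
        (volume.withDensity fun lam => ENNReal.ofReal (|lam| ^ (2 * n))))

/-- A function on ℍⁿ is radial if it is invariant under the action of the unitary group U(n). -/
def IsRadial (n : ℕ) (g : Hn n → ℂ) : Prop :=
  ∀ (U : Cn n ≃ₗᵢ[ℂ] Cn n) (x : Hn n), g (U x.1, x.2) = g x

/-- The k-th Laguerre coefficient R_k(λ, f) = (k!(n−1)!/(k+n−1)!) ∫ f^λ(w) φ_{k,λ}(w) dw. -/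
def lagCoef (n : ℕ) (k : ℕ) (lam : ℝ) (f : Hn n → ℂ) : ℂ :=
  ((normC n k : ℝ) : ℂ) * ∫ w : Cn n, fLam n f lam w * ((lagFun n k lam w : ℝ) : ℂ)

/-- The Gelfand (spherical Fourier) transform of a radial function on ℍ^m, evaluated at
(λ, (2j+m)|λ|). -/
def gelfand (m : ℕ) (h : Hn m → ℂ) (lam : ℝ) (j : ℕ) : ℂ :=
  ((normC m j : ℝ) : ℂ) *
    ∫ x : Hn m, h x * Complex.exp (Complex.I * (lam : ℂ) * (x.2 : ℂ)) *
      ((lagFun m j lam x.1 : ℝ) : ℂ)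

/-- The group convolution on ℍⁿ: f∗g(x) = ∫ f(x·y⁻¹) g(y) dy. -/
def hConv (n : ℕ) (f g : Hn n → ℂ) (x : Hn n) : ℂ :=
  ∫ y : Hn n, f (x.1 - y.1, x.2 - y.2 - imZW x.1 y.1 / 2) * g y

/-- P is a bigraded solid harmonic of degree (p,q) on ℂⁿ: P(z) = ∑_{|α|=p,|β|=q} c_{αβ} z^α z̄^β,
harmonic as a function on ℝ^{2n} (the harmonicity Δ P = 0 is expressed by the equivalent
algebraic condition on the coefficients). -/
def IsBigradedSolidHarmonic (n p q : ℕ) (P : Cn n → ℂ) : Prop :=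
  ∃ c : (Fin n → ℕ) → (Fin n → ℕ) → ℂ,
    (∀ z : Cn n, P z =
      ∑ α ∈ Finset.Nat.antidiagonalTuple n p, ∑ β ∈ Finset.Nat.antidiagonalTuple n q,
        c α β * (∏ j, z j ^ α j) * ∏ j, (starRingEnd ℂ) (z j) ^ β j) ∧
    (∀ γ δ : Fin n → ℕ,
      ∑ j : Fin n, (((γ j + 1) * (δ j + 1) : ℕ) : ℂ) *
        c (Function.update γ j (γ j + 1)) (Function.update δ j (δ j + 1)) = 0)

/-- The physicists' Hermite polynomial H_m(x) = (−1)^m e^{x²} (d/dx)^m e^{−x²}. -/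
def physHermite (m : ℕ) (x : ℝ) : ℝ :=
  (-1 : ℝ) ^ m * Real.exp (x ^ 2) * iteratedDeriv m (fun y => Real.exp (-(y ^ 2))) x

/-- The normalized Hermite function h_m(x) = (2^m m! √π)^{−1/2} H_m(x) e^{−x²/2}. -/
def hermiteFun (m : ℕ) (x : ℝ) : ℝ :=
  (Real.sqrt (2 ^ m * (Nat.factorial m) * Real.sqrt π))⁻¹ * physHermite m x *
    Real.exp (-(x ^ 2) / 2)

/-- The scaled Hermite function Φ_α^λ(x) = |λ|^{n/4} ∏ⱼ h_{αⱼ}(√|λ| xⱼ). -/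
def scaledHermite (n : ℕ) (lam : ℝ) (α : Fin n → ℕ) (x : Fin n → ℝ) : ℝ :=
  |lam| ^ ((n : ℝ) / 4) * ∏ j, hermiteFun (α j) (Real.sqrt |lam| * x j)

/-- The Schrödinger representation: π_λ(z,t)φ(ξ) = e^{iλt} e^{iλ(x·ξ+(1/2)x·y)} φ(ξ+y),
z = x+iy. -/
def schrodinger (n : ℕ) (lam : ℝ) (zt : Hn n) (φ : (Fin n → ℝ) → ℂ) (ξ : Fin n → ℝ) : ℂ :=
  Complex.exp (Complex.I * (lam : ℂ) * (zt.2 : ℂ)) *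
    Complex.exp (Complex.I * (lam : ℂ) *
      (((∑ j, (zt.1 j).re * ξ j) + (∑ j, (zt.1 j).re * (zt.1 j).im) / 2 : ℝ) : ℂ)) *
    φ (fun j => ξ j + (zt.1 j).im)

/-- The group Fourier transform f̂(λ)φ = ∫ f(z,t) π_λ(z,t)φ dz dt. -/
def groupFT (n : ℕ) (f : Hn n → ℂ) (lam : ℝ) (φ : (Fin n → ℝ) → ℂ) (ξ : Fin n → ℝ) : ℂ :=
  ∫ x : Hn n, f x * schrodinger n lam x φ ξ

lemma HasSum.of_eq {ι E : Type*} [AddCommMonoid E] [TopologicalSpace E] {f g : ι → E} {a b : E}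
    (h : HasSum f a) (hf : ∀ i, g i = f i) (hab : b = a) : HasSum g b := by
  rw [hab, funext hf]
  exact h

/-- The double series behind the generating function of the Laguerre polynomials. -/
def lagTerm (n : ℕ) (x s : ℝ) (p : ℕ × ℕ) : ℝ :=
  ((p.2 + (p.1 + n - 1)).choose (p.1 + n - 1) : ℝ) * (-x) ^ p.1 / (p.1.factorial) * s ^ (p.1 + p.2)

lemma hasSum_lagTerm_snd {n : ℕ} (hn : 1 ≤ n) (x : ℝ) {s : ℝ} (hs : |s| < 1) (j : ℕ) :
    HasSum (fun m => lagTerm n x s (j, m))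
      ((1 - s)⁻¹ ^ n * ((-(x * s / (1 - s))) ^ j / j.factorial)) := by
  have h1 : (1 - s) ≠ 0 := by
    have := (abs_lt.1 hs).2
    linarith
  have h := (hasSum_choose_mul_geometric_of_norm_lt_one (𝕜 := ℝ) (j + n - 1) (r := s)
    (by simpa using hs)).mul_left ((-x) ^ j / j.factorial * s ^ j)
  refine h.of_eq (fun m => ?_) ?_
  · simp only [lagTerm, pow_add]
    ring
  · have : j + n - 1 + 1 = j + n := by omega
    have e : -(x * s / (1 - s)) = -x * s * (1 - s)⁻¹ := by ring
    rw [this, pow_add, e, mul_pow, mul_pow, inv_pow, inv_pow]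
    field_simp

lemma summable_lagTerm {n : ℕ} (hn : 1 ≤ n) (x : ℝ) {s : ℝ} (hs : |s| < 1) :
    Summable (lagTerm n x s) := by
  apply Summable.of_norm
  have hs' : |(|s|)| < 1 := by simpa using hs
  have key : (fun p => ‖lagTerm n x s p‖) = lagTerm n (-|x|) |s| := by
    ext p
    simp [lagTerm]
  rw [key, summable_prod_of_nonneg]
  · refine ⟨fun j => (hasSum_lagTerm_snd hn _ hs' j).summable, ?_⟩
    simp_rw [(hasSum_lagTerm_snd hn _ hs' _).tsum_eq]
    exact (Real.summable_pow_div_factorial _).mul_left _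
  · intro p
    simp only [lagTerm, Pi.zero_apply, neg_neg]
    positivity

lemma lagPoly_mul_pow {n : ℕ} (hn : 1 ≤ n) (k : ℕ) (x s : ℝ) :
    lagPoly n k x * s ^ k = ∑ p ∈ Finset.HasAntidiagonal.antidiagonal k, lagTerm n x s p := by
  rw [Finset.Nat.sum_antidiagonal_eq_sum_range_succ_mk, lagPoly, Finset.sum_mul]
  refine Finset.sum_congr rfl fun j hj => ?_
  have hj' : j ≤ k := by simpa [Nat.lt_succ_iff] using hj
  have e1 : k - j + (j + n - 1) = k + n - 1 := by omega
  have e2 : j + (k - j) = k := by omega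
  simp only [lagTerm, e1, e2]
  congr 4
  rw [← Nat.choose_symm (by omega : k - j ≤ k + n - 1)]
  congr 1
  omega

/-- The generating function of the Laguerre polynomials. -/
lemma hasSum_lagPoly {n : ℕ} (hn : 1 ≤ n) (x : ℝ) {s : ℝ} (hs : |s| < 1) :
    HasSum (fun k => lagPoly n k x * s ^ k) ((1 - s)⁻¹ ^ n * Real.exp (-(x * s / (1 - s)))) := by
  have hsum := summable_lagTerm hn x hs
  have h1 := hsum.hasSum.prod_fiberwise (hasSum_lagTerm_snd hn x hs)
  have h2 : HasSum (fun j : ℕ => (1 - s)⁻¹ ^ n * ((-(x * s / (1 - s))) ^ j / j.factorial))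
      ((1 - s)⁻¹ ^ n * Real.exp (-(x * s / (1 - s)))) := by
    have := NormedSpace.expSeries_div_hasSum_exp (𝔸 := ℝ) (-(x * s / (1 - s)))
    rw [← Real.exp_eq_exp_ℝ] at this
    exact this.mul_left _
  have h3 : HasSum (lagTerm n x s) ((1 - s)⁻¹ ^ n * Real.exp (-(x * s / (1 - s)))) := by
    rw [← h1.unique h2]
    exact hsum.hasSum
  have h4 := ((Finset.HasAntidiagonal.sigmaAntidiagonalEquivProd (A := ℕ)).hasSum_iff.2 h3).sigma
    (g := fun k => lagPoly n k x * s ^ k) fun k => by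
    rw [lagPoly_mul_pow hn]
    have := hasSum_fintype (fun p : Finset.HasAntidiagonal.antidiagonal k => lagTerm n x s p)
    rw [Finset.sum_coe_sort (Finset.HasAntidiagonal.antidiagonal k) (lagTerm n x s)] at this
    exact this
  exact h4

lemma abs_lagPoly_le (n k : ℕ) {x : ℝ} (hx : 0 ≤ x) : |lagPoly n k x| ≤ lagPoly n k (-x) := by
  unfold lagPoly
  refine (Finset.abs_sum_le_sum_abs _ _).trans (le_of_eq ?_)
  refine Finset.sum_congr rfl fun j _ => ?_
  simp [abs_mul, abs_div, abs_pow, abs_of_nonneg hx]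

lemma lagPoly_neg_nonneg (n k : ℕ) {x : ℝ} (hx : 0 ≤ x) : 0 ≤ lagPoly n k (-x) :=
  (abs_nonneg _).trans (abs_lagPoly_le n k hx)

lemma lagPoly_neg_mul_pow_le {n : ℕ} (hn : 1 ≤ n) (k : ℕ) {x s : ℝ} (hx : 0 ≤ x) (hs : 0 ≤ s)
    (hs1 : s < 1) :
    lagPoly n k (-x) * s ^ k ≤ (1 - s)⁻¹ ^ n * Real.exp (x * s / (1 - s)) := by
  have h := hasSum_lagPoly hn (-x) (s := s) (by rwa [abs_of_nonneg hs])
  have h2 := le_hasSum h k fun j _ => mul_nonneg (lagPoly_neg_nonneg n j hx) (pow_nonneg hs j)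
  refine h2.trans (le_of_eq ?_)
  congr 2
  ring

lemma lagPoly_zero (n k : ℕ) : lagPoly n k 0 = ((k + n - 1).choose k : ℝ) := by
  unfold lagPoly
  rw [Finset.sum_eq_single 0]
  · simp
  · intro j _ hj
    simp [hj]
  · simp

/-- The Laguerre function in the variable `x = |z|²`. -/
def lagR (n k : ℕ) (b x : ℝ) : ℝ := lagPoly n k (b * x / 2) * Real.exp (-(b * x / 4))

lemma lagFun_eq_lagR (n k : ℕ) (lam : ℝ) (z : Cn n) : lagFun n k lam z = lagR n k |lam| (‖z‖ ^ 2) :=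
  rfl

lemma hasSum_lagR {n : ℕ} (hn : 1 ≤ n) (b x : ℝ) {s : ℝ} (hs : |s| < 1) :
    HasSum (fun k => lagR n k b x * s ^ k)
      ((1 - s)⁻¹ ^ n * Real.exp (-(b / 4 * ((1 + s) / (1 - s)) * x))) := by
  have h1 : (1 - s) ≠ 0 := by
    have := (abs_lt.1 hs).2
    linarith
  have h := (hasSum_lagPoly hn (b * x / 2) hs).mul_right (Real.exp (-(b * x / 4)))
  refine h.of_eq (fun k => ?_) ?_
  · simp only [lagR]
    ring
  · rw [mul_assoc _ (Real.exp _) (Real.exp _), ← Real.exp_add]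
    congr 2
    field_simp
    ring

/-- The majorant of a Laguerre function with all coefficients positive. -/
def lagMaj (n k : ℕ) (b x : ℝ) : ℝ := lagPoly n k (-(b * x / 2)) * Real.exp (-(b * x / 4))

lemma abs_lagR_le_lagMaj (n k : ℕ) {b x : ℝ} (hb : 0 ≤ b) (hx : 0 ≤ x) :
    |lagR n k b x| ≤ lagMaj n k b x := by
  rw [lagR, lagMaj, abs_mul, abs_of_pos (Real.exp_pos _)]
  gcongr
  exact abs_lagPoly_le n k (by positivity)

lemma hasSum_lagMaj {n : ℕ} (hn : 1 ≤ n) (b x : ℝ) {s : ℝ} (hs : |s| < 1) :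
    HasSum (fun k => lagMaj n k b x * s ^ k)
      ((1 - s)⁻¹ ^ n * Real.exp (b * x / 2 * (s / (1 - s)) - b * x / 4)) := by
  have h := (hasSum_lagPoly hn (-(b * x / 2)) hs).mul_right (Real.exp (-(b * x / 4)))
  refine h.of_eq (fun k => ?_) ?_
  · simp only [lagMaj]
    ring
  · rw [mul_assoc _ (Real.exp _) (Real.exp _), ← Real.exp_add]
    congr 2
    ring

lemma abs_lagR_le_gauss {n : ℕ} (hn : 1 ≤ n) (k : ℕ) {b x : ℝ} (hb : 0 ≤ b) (hx : 0 ≤ x) :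
    |lagR n k b x| ≤ 4 ^ k * 2 ^ n * Real.exp (-(b / 12 * x)) := by
  have h := lagPoly_neg_mul_pow_le hn k (x := b * x / 2) (s := 1 / 4) (by positivity) (by norm_num)
    (by norm_num)
  have h4 : lagPoly n k (-(b * x / 2)) ≤ 4 ^ k * (2 ^ n * Real.exp (b * x / 6)) := by
    have e : lagPoly n k (-(b * x / 2)) = 4 ^ k * (lagPoly n k (-(b * x / 2)) * (1 / 4) ^ k) := by
      rw [mul_comm (lagPoly n k _), ← mul_assoc, ← mul_pow]
      norm_num
    rw [e]
    refine mul_le_mul_of_nonneg_left (h.trans ?_) (by positivity)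
    have : ((1 : ℝ) - 1 / 4)⁻¹ ^ n ≤ 2 ^ n := by
      gcongr
      norm_num
    have e2 : b * x / 2 * (1 / 4) / (1 - 1 / 4) = b * x / 6 := by ring
    rw [e2]
    gcongr
  refine (abs_lagR_le_lagMaj n k hb hx).trans ?_
  have e3 : Real.exp (-(b / 12 * x)) = Real.exp (b * x / 6) * Real.exp (-(b * x / 4)) := by
    rw [← Real.exp_add]
    congr 1
    ring
  rw [e3, lagMaj]
  calc _ ≤ 4 ^ k * (2 ^ n * Real.exp (b * x / 6)) * Real.exp (-(b * x / 4)) := by gcongr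
    _ = _ := by ring

lemma lagR_zero (n k : ℕ) (b : ℝ) : lagR n k b 0 = ((k + n - 1).choose k : ℝ) := by
  simp [lagR, lagPoly_zero]

lemma lagR_zero_pos {n : ℕ} (hn : 1 ≤ n) (k : ℕ) (b : ℝ) : 0 < lagR n k b 0 := by
  rw [lagR_zero]
  exact_mod_cast Nat.choose_pos (by omega)

lemma continuous_lagR (n k : ℕ) (b : ℝ) : Continuous (lagR n k b) := by
  unfold lagR lagPoly
  fun_prop

/-- Coefficients of power series convergent near zero are determined by the values. -/
lemma eq_of_hasSum_pow_eq {a c : ℕ → ℂ} {r : ℝ} (hr : 0 < r) {f : ℝ → ℂ}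
    (ha : ∀ s : ℝ, 0 < s → s < r → HasSum (fun k => a k * (s : ℂ) ^ k) (f s))
    (hc : ∀ s : ℝ, 0 < s → s < r → HasSum (fun k => c k * (s : ℂ) ^ k) (f s)) : a = c := by
  suffices h : ∀ d : ℕ → ℂ, (∀ s : ℝ, 0 < s → s < r → HasSum (fun k => d k * (s : ℂ) ^ k) 0) →
      ∀ k, d k = 0 by
    ext k
    have := h (fun k => a k - c k) (fun s h0 h1 => by
      simpa [sub_mul] using (ha s h0 h1).sub (hc s h0 h1)) k
    exact sub_eq_zero.1 this
  intro d hd k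
  induction k using Nat.strong_induction_on with
  | _ k ih =>
    have hr2 : 0 < r / 2 := by linarith
    have hS : Summable fun j => ‖d j‖ * (r / 2) ^ j := by
      have := (hd (r / 2) hr2 (by linarith)).summable.norm
      simpa [abs_of_pos hr] using this
    have hS2 : Summable fun j => ‖d (j + (k + 1))‖ * (r / 2) ^ j := by
      have := ((summable_nat_add_iff (k + 1)).2 hS).mul_right (((r / 2) ^ (k + 1))⁻¹)
      refine this.congr fun j => ?_
      rw [pow_add]
      field_simp
    set C := ∑' j, ‖d (j + (k + 1))‖ * (r / 2) ^ j with hC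
    have hb : ∀ s : ℝ, 0 < s → s < r / 2 → ‖d k‖ ≤ C * s := by
      intro s h0 h1
      have h := hd s h0 (by linarith)
      have h2 := h.tsum_eq
      rw [← h.summable.sum_add_tsum_nat_add (k + 1), Finset.sum_range_succ,
        Finset.sum_eq_zero (fun j hj => by rw [ih j (Finset.mem_range.1 hj), zero_mul]),
        zero_add] at h2
      have h3 : d k * (s : ℂ) ^ k = -∑' j, d (j + (k + 1)) * (s : ℂ) ^ (j + (k + 1)) :=
        eq_neg_of_add_eq_zero_left h2
      have h4 : ‖∑' j, d (j + (k + 1)) * (s : ℂ) ^ (j + (k + 1))‖ ≤ C * s ^ (k + 1) := by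
        rw [hC, ← tsum_mul_right]
        refine tsum_of_norm_bounded (hS2.mul_right _).hasSum fun j => ?_
        simp only [norm_mul, norm_pow, Complex.norm_real, Real.norm_eq_abs, abs_of_pos h0]
        rw [pow_add, mul_assoc]
        gcongr
      have h5 : ‖d k‖ * s ^ k ≤ C * s * s ^ k := by
        calc ‖d k‖ * s ^ k = ‖d k * (s : ℂ) ^ k‖ := by simp [abs_of_pos h0]
          _ ≤ C * s ^ (k + 1) := by rw [h3, norm_neg]; exact h4
          _ = _ := by ring
      exact le_of_mul_le_mul_right h5 (by positivity)
    have hlim : Tendsto (fun s : ℝ => C * s) (nhdsWithin 0 (Set.Ioi 0)) (nhds (C * 0)) :=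
      ((continuous_const.mul continuous_id).tendsto 0).mono_left nhdsWithin_le_nhds
    have hle : ‖d k‖ ≤ C * 0 := by
      refine ge_of_tendsto hlim ?_
      filter_upwards [Ioo_mem_nhdsGT hr2] with s hs using hb s hs.1 hs.2
    simpa using hle

section TwistedGaussians

variable {n : ℕ}

lemma imZW_eq_inner (z w : Cn n) : imZW z w = inner ℝ ((-Complex.I) • z) w := by
  have h : inner ℝ ((-Complex.I) • z) w = (inner ℂ ((-Complex.I) • z) w).re := rfl
  rw [h, inner_smul_left, PiLp.inner_apply, imZW, Finset.mul_sum, Complex.re_sum, Complex.im_sum]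
  refine Finset.sum_congr rfl fun j _ => ?_
  simp [Complex.mul_re, Complex.mul_im]
  ring

lemma imZW_self (z : Cn n) : imZW z z = 0 := by
  simp only [imZW, Complex.im_sum]
  refine Finset.sum_eq_zero fun j _ => ?_
  simp [Complex.mul_im, mul_comm]

lemma imZW_add_right (z w v : Cn n) : imZW z (w + v) = imZW z w + imZW z v := by
  simp only [imZW_eq_inner, inner_add_right]

lemma imZW_add_left (z w v : Cn n) : imZW (z + w) v = imZW z v + imZW w v := by
  simp only [imZW_eq_inner, smul_add, inner_add_left]

lemma imZW_sub_right (z w v : Cn n) : imZW z (w - v) = imZW z w - imZW z v := by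
  simp only [imZW_eq_inner, inner_sub_right]

lemma imZW_sub_left (z w v : Cn n) : imZW (z - w) v = imZW z v - imZW w v := by
  simp only [imZW_eq_inner, smul_sub, inner_sub_left]

lemma imZW_smul_right (z w : Cn n) (r : ℝ) : imZW z (r • w) = r * imZW z w := by
  simp only [imZW_eq_inner, real_inner_smul_right]

lemma imZW_smul_left (z w : Cn n) (r : ℝ) : imZW (r • z) w = r * imZW z w := by
  rw [imZW_eq_inner, imZW_eq_inner, smul_comm, real_inner_smul_left]

lemma imZW_comm (z w : Cn n) : imZW z w = -imZW w z := by
  have h := imZW_self (z + w)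
  rw [imZW_add_right, imZW_add_left, imZW_add_left, imZW_self, imZW_self] at h
  linarith

lemma abs_imZW_le (z w : Cn n) : |imZW z w| ≤ ‖z‖ * ‖w‖ := by
  rw [imZW_eq_inner]
  refine (abs_real_inner_le_norm _ _).trans (le_of_eq ?_)
  simp [norm_smul]

@[fun_prop]
lemma continuous_imZW {X : Type*} [TopologicalSpace X] {f g : X → Cn n} (hf : Continuous f)
    (hg : Continuous g) : Continuous fun x => imZW (f x) (g x) := by
  simp only [imZW_eq_inner]
  fun_prop

/-- The phase of the twisted convolution. -/
def twE (mu : ℝ) (z w : Cn n) : ℂ :=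
  Complex.exp (Complex.I / 2 * (mu : ℂ) * ((imZW z w : ℝ) : ℂ))

lemma twE_eq (mu : ℝ) (z w : Cn n) :
    twE mu z w = Complex.exp (((mu / 2 * imZW z w : ℝ) : ℂ) * Complex.I) := by
  unfold twE
  congr 1
  push_cast
  ring

@[simp]
lemma norm_twE (mu : ℝ) (z w : Cn n) : ‖twE mu z w‖ = 1 := by
  rw [twE_eq, Complex.norm_exp_ofReal_mul_I]

@[fun_prop]
lemma continuous_twE {X : Type*} [TopologicalSpace X] (mu : ℝ) {f g : X → Cn n}
    (hf : Continuous f) (hg : Continuous g) : Continuous fun x => twE mu (f x) (g x) := by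
  unfold twE
  fun_prop

lemma twConv_eq (mu : ℝ) (F G : Cn n → ℂ) (z : Cn n) :
    twConv n mu F G z = ∫ w, F (z - w) * G w * twE mu z w := rfl

lemma twConv_comm (mu : ℝ) (F G : Cn n → ℂ) (z : Cn n) :
    twConv n mu F G z = twConv n (-mu) G F z := by
  rw [twConv_eq, twConv_eq, ← integral_sub_left_eq_self _ volume z]
  congr 1
  ext w
  rw [sub_sub_cancel, mul_comm (F w)]
  congr 1
  simp only [twE_eq, imZW_sub_right, imZW_self]
  congr 3
  ring

lemma finrank_Cn : Module.finrank ℝ (Cn n) = 2 * n := by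
  rw [finrank_real_of_complex]
  simp

lemma integral_gauss_mul_twE (mu : ℝ) {p : ℝ} (hp : 0 < p) (z : Cn n) :
    ∫ w : Cn n, (Real.exp (-(p * ‖w‖ ^ 2)) : ℂ) * twE mu z w =
      ((π / p) ^ n * Real.exp (-(mu ^ 2 / (16 * p) * ‖z‖ ^ 2)) : ℝ) := by
  have h := GaussianFourier.integral_cexp_neg_mul_sq_norm_add (V := Cn n) (b := p)
      (by simpa using hp)
    (Complex.I * (mu / 2)) ((-Complex.I) • z)
  rw [finrank_Cn] at h
  have e : ∀ w : Cn n, (Real.exp (-(p * ‖w‖ ^ 2)) : ℂ) * twE mu z w =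
      Complex.exp (-(p : ℂ) * (‖w‖ : ℂ) ^ 2 +
        Complex.I * (mu / 2) * ((inner ℝ ((-Complex.I) • z) w : ℝ) : ℂ)) := by
    intro w
    rw [twE, imZW_eq_inner, Complex.ofReal_exp, ← Complex.exp_add]
    congr 1
    push_cast
    ring
  simp_rw [e]
  refine h.trans ?_
  have e2 : ((2 * n : ℕ) / 2 : ℂ) = n := by
    push_cast
    ring
  rw [e2, Complex.cpow_natCast]
  push_cast
  congr 2
  rw [norm_smul]
  simp only [norm_neg, Complex.norm_I, one_mul]
  rw [mul_pow, Complex.I_sq]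
  have : (p : ℂ) ≠ 0 := by exact_mod_cast hp.ne'
  field_simp
  ring

lemma integrable_gauss {p : ℝ} (hp : 0 < p) :
    Integrable fun w : Cn n => Real.exp (-(p * ‖w‖ ^ 2)) := by
  have h := GaussianFourier.integrable_cexp_neg_mul_sq_norm_add (V := Cn n) (b := p)
    (by simpa using hp) 0 0
  refine h.norm.congr (Eventually.of_forall fun w => ?_)
  simp only [inner_zero_left, Complex.ofReal_zero, mul_zero, add_zero, Complex.norm_exp]
  congr 1
  norm_cast
  simp

lemma integrable_gauss_sub {p : ℝ} (hp : 0 < p) (z : Cn n) :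
    Integrable fun w : Cn n => Real.exp (-(p * ‖z - w‖ ^ 2)) :=
  (integrable_gauss hp).comp_sub_left z

/-- Twisted convolution of two Gaussians. -/
lemma twConv_gauss_gauss (mu : ℝ) {p q : ℝ} (hpq : 0 < p + q) (z : Cn n) :
    ∫ w : Cn n, (Real.exp (-(p * ‖z - w‖ ^ 2)) : ℂ) * (Real.exp (-(q * ‖w‖ ^ 2)) : ℂ) * twE mu z w =
      ((π / (p + q)) ^ n * Real.exp (-((p * q + mu ^ 2 / 16) / (p + q) * ‖z‖ ^ 2)) : ℝ) := by
  rw [← integral_add_right_eq_self _ ((p / (p + q)) • z)]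
  have e : ∀ w : Cn n,
      (Real.exp (-(p * ‖z - (w + (p / (p + q)) • z)‖ ^ 2)) : ℂ) *
        (Real.exp (-(q * ‖w + (p / (p + q)) • z‖ ^ 2)) : ℂ) * twE mu z (w + (p / (p + q)) • z) =
      (Real.exp (-(p * q / (p + q) * ‖z‖ ^ 2)) : ℂ) *
        ((Real.exp (-((p + q) * ‖w‖ ^ 2)) : ℂ) * twE mu z w) := by
    intro w
    have h1 : twE mu z (w + (p / (p + q)) • z) = twE mu z w := by
      simp only [twE_eq, imZW_add_right, imZW_smul_right, imZW_self, mul_zero, add_zero]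
    have h2 : z - (w + (p / (p + q)) • z) = (q / (p + q)) • z - w := by
      have : z = (p / (p + q)) • z + (q / (p + q)) • z := by
        rw [← add_smul, ← add_div, div_self hpq.ne', one_smul]
      nth_rewrite 1 [this]
      abel
    rw [h1, h2, ← mul_assoc]
    congr 1
    norm_cast
    rw [← Real.exp_add, ← Real.exp_add]
    congr 1
    rw [norm_sub_sq_real, norm_add_sq_real, real_inner_smul_left, real_inner_smul_right, norm_smul,
      norm_smul, mul_pow, mul_pow, Real.norm_eq_abs, Real.norm_eq_abs, sq_abs, sq_abs,
      real_inner_comm]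
    field_simp
    ring
  simp_rw [e]
  rw [integral_const_mul, integral_gauss_mul_twE mu hpq]
  norm_cast
  rw [mul_left_comm, ← Real.exp_add]
  congr 2
  field_simp
  ring

end TwistedGaussians

section LaguerreProjections

variable {n : ℕ}

@[fun_prop]
lemma continuous_lagFun (k : ℕ) (mu : ℝ) : Continuous (lagFun n k mu) := by
  unfold lagFun lagPoly
  fun_prop

lemma lagFun_neg (k : ℕ) (mu : ℝ) (z : Cn n) : lagFun n k mu (-z) = lagFun n k mu z := by
  simp [lagFun]

lemma lagFun_neg_param (k : ℕ) (mu : ℝ) : lagFun n k (-mu) = lagFun n k mu := by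
  ext z
  simp [lagFun]

lemma hasSum_lagFun (hn : 1 ≤ n) (mu : ℝ) (z : Cn n) {s : ℝ} (hs : |s| < 1) :
    HasSum (fun k => lagFun n k mu z * s ^ k)
      ((1 - s)⁻¹ ^ n * Real.exp (-(|mu| / 4 * ((1 + s) / (1 - s)) * ‖z‖ ^ 2))) :=
  hasSum_lagR hn |mu| (‖z‖ ^ 2) hs

lemma integrable_lagFun (hn : 1 ≤ n) (k : ℕ) {mu : ℝ} (hmu : mu ≠ 0) :
    Integrable (lagFun n k mu) := by
  have hb : 0 < |mu| := abs_pos.2 hmu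
  refine ((integrable_gauss (n := n) (p := |mu| / 12) (by positivity)).const_mul
    (4 ^ k * 2 ^ n)).mono' (by fun_prop) (Eventually.of_forall fun w => ?_)
  rw [lagFun_eq_lagR, Real.norm_eq_abs]
  exact abs_lagR_le_gauss hn k hb.le (by positivity)

lemma lagMaj_nonneg (k : ℕ) {b x : ℝ} (hb : 0 ≤ b) (hx : 0 ≤ x) : 0 ≤ lagMaj n k b x :=
  (abs_nonneg _).trans (abs_lagR_le_lagMaj n k hb hx)

lemma tsum_lagMaj_le (hn : 1 ≤ n) {b x s : ℝ} (hb : 0 ≤ b) (hx : 0 ≤ x) (hs : 0 < s)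
    (hs4 : s < 1 / 4) :
    Summable (fun k => lagMaj n k b x * s ^ k) ∧ 0 ≤ ∑' k, lagMaj n k b x * s ^ k ∧
      ∑' k, lagMaj n k b x * s ^ k ≤ 2 ^ n := by
  have h := hasSum_lagMaj hn b x (s := s) (by rw [abs_of_pos hs]; linarith)
  refine ⟨h.summable, tsum_nonneg fun k => mul_nonneg (lagMaj_nonneg k hb hx) (by positivity), ?_⟩
  rw [h.tsum_eq]
  have h1 : (1 - s)⁻¹ ≤ 2 := by
    rw [inv_le_comm₀ (by linarith) (by norm_num)]
    linarith
  have h2 : Real.exp (b * x / 2 * (s / (1 - s)) - b * x / 4) ≤ 1 := by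
    rw [Real.exp_le_one_iff]
    have : s / (1 - s) ≤ 1 / 2 := by
      rw [div_le_iff₀ (by linarith)]
      linarith
    have hbx : 0 ≤ b * x := by positivity
    nlinarith
  have h3 : 0 ≤ (1 - s)⁻¹ := inv_nonneg.2 (by linarith)
  calc _ ≤ (2 : ℝ) ^ n * 1 := by gcongr
    _ = _ := mul_one _

/-- Summation of twisted convolutions with Laguerre functions against `s ^ k`, `0 < s < 1/4`. -/
lemma hasSum_integral_lagFun (hn : 1 ≤ n) (mu : ℝ) {F : Cn n → ℂ} (hF : Integrable F)
    (u : Cn n → Cn n) (hu : Continuous u) {s : ℝ} (hs : 0 < s) (hs4 : s < 1 / 4) :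
    HasSum (fun k => (∫ w, F w * (lagFun n k mu (u w) : ℂ)) * (s : ℂ) ^ k)
      (∫ w, F w * (((1 - s)⁻¹ ^ n *
        Real.exp (-(|mu| / 4 * ((1 + s) / (1 - s)) * ‖u w‖ ^ 2)) : ℝ) : ℂ)) := by
  have hx : ∀ w, 0 ≤ ‖u w‖ ^ 2 := fun w => by positivity
  have key : HasSum (fun k => ∫ w, F w * (lagFun n k mu (u w) : ℂ) * (s : ℂ) ^ k)
      (∫ w, F w * (((1 - s)⁻¹ ^ n *
        Real.exp (-(|mu| / 4 * ((1 + s) / (1 - s)) * ‖u w‖ ^ 2)) : ℝ) : ℂ)) := by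
    refine hasSum_integral_of_dominated_convergence
      (fun k w => ‖F w‖ * (lagMaj n k |mu| (‖u w‖ ^ 2) * s ^ k)) (fun k => ?_)
      (fun k => ?_) ?_ ?_ ?_
    · refine (hF.aestronglyMeasurable.mul ?_).mul aestronglyMeasurable_const
      exact Continuous.aestronglyMeasurable (by fun_prop)
    · refine Eventually.of_forall fun w => ?_
      rw [norm_mul, norm_mul, Complex.norm_real, norm_pow, Complex.norm_real, Real.norm_eq_abs,
        Real.norm_eq_abs, abs_of_pos hs, mul_assoc, lagFun_eq_lagR]
      gcongr
      exact abs_lagR_le_lagMaj n k (abs_nonneg _) (hx w)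
    · exact Eventually.of_forall fun w =>
        (tsum_lagMaj_le hn (abs_nonneg mu) (hx w) hs hs4).1.mul_left _
    · simp_rw [tsum_mul_left]
      have hcont : Measurable fun w => ∑' k, lagMaj n k |mu| (‖u w‖ ^ 2) * s ^ k := by
        rw [funext fun w => (hasSum_lagMaj hn |mu| (‖u w‖ ^ 2)
          (s := s) (by rw [abs_of_pos hs]; linarith)).tsum_eq]
        exact Continuous.measurable (by fun_prop)
      refine (hF.norm.mul_const (2 ^ n)).mono' (hF.norm.aestronglyMeasurable.mul
        hcont.aestronglyMeasurable) (Eventually.of_forall fun w => ?_)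
      obtain ⟨-, h0, h1⟩ := tsum_lagMaj_le hn (abs_nonneg mu) (hx w) hs hs4
      rw [norm_mul, norm_norm, Real.norm_eq_abs, abs_of_nonneg h0]
      gcongr
    · refine Eventually.of_forall fun w => ?_
      have h := (hasSum_lagFun hn mu (u w) (s := s)
        (by rw [abs_of_pos hs]; linarith))
      have h' := (Complex.hasSum_ofReal.2 h).mul_left (F w)
      refine h'.of_eq (fun k => ?_) rfl
      push_cast
      ring
  refine key.of_eq (fun k => ?_) rfl
  rw [integral_mul_const]

/-- Laguerre functions are eigenfunctions of twisted convolution with suitable Gaussians. -/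
lemma twConv_gauss_lagFun (hn : 1 ≤ n) {mu : ℝ} (hmu : mu ≠ 0) (k : ℕ) {σ : ℝ} (hσ : |σ| < 1)
    (z : Cn n) :
    twConv n mu (fun w => (Real.exp (-(|mu| / 4 * ((1 + σ) / (1 - σ)) * ‖w‖ ^ 2)) : ℂ))
      (fun w => (lagFun n k mu w : ℂ)) z =
      ((2 * π * (1 - σ) / |mu|) ^ n * σ ^ k * lagFun n k mu z : ℝ) := by
  obtain ⟨hσ0, hσ1⟩ := abs_lt.1 hσ
  have hb : 0 < |mu| := abs_pos.2 hmu
  set p := |mu| / 4 * ((1 + σ) / (1 - σ)) with hp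
  have hp0 : 0 < p := by
    have : 0 < (1 + σ) / (1 - σ) := div_pos (by linarith) (by linarith)
    positivity
  have hF : Integrable fun w : Cn n => (Real.exp (-(p * ‖z - w‖ ^ 2)) : ℂ) * twE mu z w := by
    refine (integrable_gauss_sub hp0 z).mono' (Continuous.aestronglyMeasurable (by fun_prop))
      (Eventually.of_forall fun w => ?_)
    rw [norm_mul, norm_twE, mul_one, Complex.norm_real, Real.norm_eq_abs, Real.abs_exp]
  have main := eq_of_hasSum_pow_eq (r := 1 / 4) (by norm_num)
    (a := fun k => ∫ w, (Real.exp (-(p * ‖z - w‖ ^ 2)) : ℂ) * twE mu z w * (lagFun n k mu w : ℂ))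
    (c := fun k => ((2 * π * (1 - σ) / |mu|) ^ n * σ ^ k * lagFun n k mu z : ℝ))
    (f := fun s => ∫ w, (Real.exp (-(p * ‖z - w‖ ^ 2)) : ℂ) * twE mu z w * (((1 - s)⁻¹ ^ n *
        Real.exp (-(|mu| / 4 * ((1 + s) / (1 - s)) * ‖w‖ ^ 2)) : ℝ) : ℂ))
    (fun s h0 h1 => hasSum_integral_lagFun hn mu hF (fun w => w) continuous_id h0 h1)
    (fun s h0 h1 => ?_)
  · rw [← congrFun main k, twConv_eq]
    congr 1
    ext w
    ring
  · have hσs : |σ * s| < 1 := by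
      rw [abs_mul, abs_of_pos h0]
      nlinarith [abs_nonneg σ]
    have h := (Complex.hasSum_ofReal.2 ((hasSum_lagFun hn mu z hσs).mul_left
      ((2 * π * (1 - σ) / |mu|) ^ n)))
    refine h.of_eq (fun k => ?_) ?_
    · push_cast
      ring
    · set q := |mu| / 4 * ((1 + s) / (1 - s)) with hq
      have hq0 : 0 < q := by
        have : 0 < (1 + s) / (1 - s) := div_pos (by linarith) (by linarith)
        positivity
      have e : ∀ w : Cn n, (Real.exp (-(p * ‖z - w‖ ^ 2)) : ℂ) * twE mu z w * (((1 - s)⁻¹ ^ n *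
          Real.exp (-(q * ‖w‖ ^ 2)) : ℝ) : ℂ) = (((1 - s)⁻¹ ^ n : ℝ) : ℂ) *
          ((Real.exp (-(p * ‖z - w‖ ^ 2)) : ℂ) * (Real.exp (-(q * ‖w‖ ^ 2)) : ℂ) * twE mu z w) := by
        intro w
        push_cast
        ring
      simp_rw [e]
      rw [integral_const_mul, twConv_gauss_gauss mu (by linarith)]
      norm_cast
      clear_value p q
      rw [← mul_assoc, ← mul_assoc, ← mul_pow, ← mul_pow]
      have h1s : 1 - s ≠ 0 := by linarith
      have h1σ : 1 - σ ≠ 0 := by linarith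
      have h2 : 1 - σ * s ≠ 0 := by
        have := (abs_lt.1 hσs).2
        linarith
      have hm2 : mu ^ 2 = |mu| ^ 2 := (sq_abs mu).symm
      have epq : p + q = |mu| / 2 * (1 - σ * s) / ((1 - σ) * (1 - s)) := by
        rw [hp, hq]
        field_simp
        ring
      have epq2 : p * q + mu ^ 2 / 16 = |mu| ^ 2 / 8 * (1 + σ * s) / ((1 - σ) * (1 - s)) := by
        rw [hp, hq, hm2]
        field_simp
        ring
      rw [epq, epq2]
      congr 1
      · congr 1
        field_simp
      · congr 3
        field_simp
        ring

lemma twConv_lagFun_lagFun (hn : 1 ≤ n) {mu : ℝ} (hmu : mu ≠ 0) (l k : ℕ) (z : Cn n) :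
    twConv n mu (fun w => (lagFun n l mu w : ℂ)) (fun w => (lagFun n k mu w : ℂ)) z =
      if l = k then (((2 * π / |mu|) ^ n * lagFun n k mu z : ℝ) : ℂ) else 0 := by
  have hF : Integrable fun w : Cn n => (lagFun n k mu w : ℂ) * twE mu z w := by
    refine (integrable_lagFun hn k hmu).norm.mono' (Continuous.aestronglyMeasurable (by fun_prop))
      (Eventually.of_forall fun w => ?_)
    rw [norm_mul, norm_twE, mul_one, Complex.norm_real]
  have main := eq_of_hasSum_pow_eq (r := 1 / 4) (by norm_num)
    (fun s h0 h1 => hasSum_integral_lagFun hn mu hF (fun w => z - w) (by fun_prop) h0 h1)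
    (c := fun l => if l = k then ((2 * π / |mu|) ^ n * lagFun n k mu z : ℝ) else 0)
    (fun s h0 h1 => ?_)
  · rw [← congrFun main l, twConv_eq]
    congr 1
    ext w
    ring
  · have h := hasSum_ite_eq k ((((2 * π / |mu|) ^ n * lagFun n k mu z : ℝ) : ℂ) * (s : ℂ) ^ k)
    refine h.of_eq (fun l => ?_) ?_
    · by_cases hl : l = k
      · simp [hl]
      · simp [hl]
    · have e : ∀ w : Cn n, (lagFun n k mu w : ℂ) * twE mu z w * (((1 - s)⁻¹ ^ n *
          Real.exp (-(|mu| / 4 * ((1 + s) / (1 - s)) * ‖z - w‖ ^ 2)) : ℝ) : ℂ) =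
          (((1 - s)⁻¹ ^ n : ℝ) : ℂ) *
          ((Real.exp (-(|mu| / 4 * ((1 + s) / (1 - s)) * ‖z - w‖ ^ 2)) : ℂ) *
            (lagFun n k mu w : ℂ) * twE mu z w) := by
        intro w
        push_cast
        ring
      simp_rw [e]
      rw [integral_const_mul]
      have := twConv_gauss_lagFun hn hmu k (σ := s) (by rw [abs_of_pos h0]; linarith) z
      rw [twConv_eq] at this
      rw [this]
      norm_cast
      have h1s : 1 - s ≠ 0 := by linarith
      rw [mul_comm (2 * π), mul_div_assoc, mul_pow (1 - s), inv_pow]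
      field_simp

lemma integral_lagFun_sq (hn : 1 ≤ n) {mu : ℝ} (hmu : mu ≠ 0) (k : ℕ) :
    ∫ w : Cn n, lagFun n k mu w ^ 2 = (2 * π / |mu|) ^ n * ((k + n - 1).choose k : ℝ) := by
  have h := twConv_lagFun_lagFun hn hmu k k (0 : Cn n)
  rw [if_pos rfl, twConv_eq] at h
  have e : ∀ w : Cn n, (lagFun n k mu (0 - w) : ℂ) * (lagFun n k mu w : ℂ) * twE mu 0 w =
      ((lagFun n k mu w ^ 2 : ℝ) : ℂ) := by
    intro w
    have : imZW (0 : Cn n) w = 0 := by simp [imZW]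
    rw [zero_sub, lagFun_neg, twE, this]
    push_cast
    simp [sq]
  simp_rw [e] at h
  rw [integral_complex_ofReal] at h
  rw [Complex.ofReal_injective h, lagFun_eq_lagR, norm_zero, zero_pow two_ne_zero, lagR_zero]

lemma integrable_lagFun_sq (hn : 1 ≤ n) {mu : ℝ} (hmu : mu ≠ 0) (k : ℕ) :
    Integrable fun w : Cn n => lagFun n k mu w ^ 2 := by
  by_contra h
  have h2 := integral_lagFun_sq hn hmu k
  rw [integral_undef h] at h2
  have : 0 < |mu| := abs_pos.2 hmu
  have h3 : 0 < ((k + n - 1).choose k : ℝ) := by exact_mod_cast Nat.choose_pos (by omega)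
  have : 0 < (2 * π / |mu|) ^ n * ((k + n - 1).choose k : ℝ) := by positivity
  linarith

lemma abs_lagFun_le (hn : 1 ≤ n) {mu : ℝ} (hmu : mu ≠ 0) (k : ℕ) (z : Cn n) :
    |lagFun n k mu z| ≤ ((k + n - 1).choose k : ℝ) := by
  have hb : 0 < |mu| := abs_pos.2 hmu
  have h := twConv_lagFun_lagFun hn hmu k k z
  rw [if_pos rfl, twConv_eq] at h
  have hi := integrable_lagFun_sq hn hmu k
  have h2 : (2 * π / |mu|) ^ n * |lagFun n k mu z| ≤
      ∫ w : Cn n, (lagFun n k mu (z - w) ^ 2 + lagFun n k mu w ^ 2) / 2 := by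
    have e : (2 * π / |mu|) ^ n * |lagFun n k mu z| =
        ‖(((2 * π / |mu|) ^ n * lagFun n k mu z : ℝ) : ℂ)‖ := by
      rw [Complex.norm_real, Real.norm_eq_abs, abs_mul,
        abs_of_pos (by positivity : (0 : ℝ) < (2 * π / |mu|) ^ n)]
    rw [e, ← h]
    refine norm_integral_le_of_norm_le (((hi.comp_sub_left z).add hi).div_const 2)
      (Eventually.of_forall fun w => ?_)
    rw [norm_mul, norm_mul, norm_twE, Complex.norm_real, Complex.norm_real, Real.norm_eq_abs,
      Real.norm_eq_abs, mul_one]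
    rw [← sq_abs, ← sq_abs (lagFun n k mu w)]
    nlinarith [sq_nonneg (|lagFun n k mu (z - w)| - |lagFun n k mu w|)]
  rw [integral_div, integral_add (hi.comp_sub_left z) hi,
    integral_sub_left_eq_self (fun w => lagFun n k mu w ^ 2) volume z,
    integral_lagFun_sq hn hmu] at h2
  have h3 : (0 : ℝ) < (2 * π / |mu|) ^ n := by positivity
  refine le_of_mul_le_mul_left (h2.trans (le_of_eq ?_)) h3
  ring

end LaguerreProjections

section RadialEigenfunctions

variable {n : ℕ}

/-- The radial profile `G` is continuous, dominated by `exp (-x)`, and twisted convolution with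
`G (‖·‖ ^ 2)` has the `k`-th Laguerre function as an eigenfunction. -/
def IsLagEigen (n k : ℕ) (mu : ℝ) (G : ℝ → ℝ) : Prop :=
  Continuous G ∧ (∃ C, ∀ x, 0 ≤ x → |G x| ≤ C * Real.exp (-x)) ∧ ∀ z : Cn n,
    (lagFun n k mu (0 : Cn n) : ℂ) *
        twConv n mu (fun w => (G (‖w‖ ^ 2) : ℂ)) (fun w => (lagFun n k mu w : ℂ)) z =
      (∫ w : Cn n, (G (‖w‖ ^ 2) : ℂ) * (lagFun n k mu w : ℂ)) * (lagFun n k mu z : ℂ)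

lemma integrable_expDecay_mul_lagFun (hn : 1 ≤ n) {mu : ℝ} (hmu : mu ≠ 0) (k : ℕ) {G : ℝ → ℝ}
    (hG : Continuous G) {C : ℝ} (hC : ∀ x, 0 ≤ x → |G x| ≤ C * Real.exp (-x)) :
    Integrable (fun w : Cn n => (G (‖w‖ ^ 2) : ℂ) * (lagFun n k mu w : ℂ)) ∧
    ∫ w : Cn n, ‖(G (‖w‖ ^ 2) : ℂ) * (lagFun n k mu w : ℂ)‖ ≤
      C * (((k + n - 1).choose k : ℝ) * ∫ w : Cn n, Real.exp (-(1 * ‖w‖ ^ 2))) := by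
  have hi := ((integrable_gauss (n := n) one_pos).const_mul ((k + n - 1).choose k : ℝ)).const_mul C
  have hb : ∀ w : Cn n, ‖(G (‖w‖ ^ 2) : ℂ) * (lagFun n k mu w : ℂ)‖ ≤
      C * (((k + n - 1).choose k : ℝ) * Real.exp (-(1 * ‖w‖ ^ 2))) := by
    intro w
    rw [norm_mul, Complex.norm_real, Complex.norm_real, Real.norm_eq_abs, Real.norm_eq_abs]
    have h1 := hC (‖w‖ ^ 2) (by positivity)
    have h2 := abs_lagFun_le hn hmu k w
    calc _ ≤ (C * Real.exp (-‖w‖ ^ 2)) * ((k + n - 1).choose k : ℝ) := by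
          gcongr
          exact (abs_nonneg _).trans h1
      _ = _ := by rw [one_mul]; ring
  have h0 : Integrable (fun w : Cn n => (G (‖w‖ ^ 2) : ℂ) * (lagFun n k mu w : ℂ)) :=
    hi.mono' (Continuous.aestronglyMeasurable (by fun_prop)) (Eventually.of_forall hb)
  refine ⟨h0, (integral_mono h0.norm hi hb).trans (le_of_eq ?_)⟩
  rw [integral_const_mul, integral_const_mul]

lemma integrable_expDecay_twConv_lagFun (hn : 1 ≤ n) {mu : ℝ} (hmu : mu ≠ 0) (k : ℕ) {G : ℝ → ℝ}
    (hG : Continuous G) {C : ℝ} (hC : ∀ x, 0 ≤ x → |G x| ≤ C * Real.exp (-x)) (z : Cn n) :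
    Integrable (fun w : Cn n => (G (‖z - w‖ ^ 2) : ℂ) * (lagFun n k mu w : ℂ) * twE mu z w) ∧
    ∫ w : Cn n, ‖(G (‖z - w‖ ^ 2) : ℂ) * (lagFun n k mu w : ℂ) * twE mu z w‖ ≤
      C * (((k + n - 1).choose k : ℝ) * ∫ w : Cn n, Real.exp (-(1 * ‖w‖ ^ 2))) := by
  have hi := ((integrable_gauss_sub (n := n) one_pos z).const_mul
    ((k + n - 1).choose k : ℝ)).const_mul C
  have hb : ∀ w : Cn n, ‖(G (‖z - w‖ ^ 2) : ℂ) * (lagFun n k mu w : ℂ) * twE mu z w‖ ≤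
      C * (((k + n - 1).choose k : ℝ) * Real.exp (-(1 * ‖z - w‖ ^ 2))) := by
    intro w
    rw [norm_mul, norm_mul, norm_twE, mul_one, Complex.norm_real, Complex.norm_real,
      Real.norm_eq_abs, Real.norm_eq_abs]
    have h1 := hC (‖z - w‖ ^ 2) (by positivity)
    have h2 := abs_lagFun_le hn hmu k w
    calc _ ≤ (C * Real.exp (-‖z - w‖ ^ 2)) * ((k + n - 1).choose k : ℝ) := by
          gcongr
          exact (abs_nonneg _).trans h1
      _ = _ := by rw [one_mul]; ring
  have h0 : Integrable
      (fun w : Cn n => (G (‖z - w‖ ^ 2) : ℂ) * (lagFun n k mu w : ℂ) * twE mu z w) :=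
    hi.mono' (Continuous.aestronglyMeasurable (by fun_prop)) (Eventually.of_forall hb)
  refine ⟨h0, (integral_mono h0.norm hi hb).trans (le_of_eq ?_)⟩
  rw [integral_const_mul, integral_const_mul,
    integral_sub_left_eq_self (fun w => Real.exp (-(1 * ‖w‖ ^ 2))) volume z]

lemma IsLagEigen.add (hn : 1 ≤ n) {mu : ℝ} (hmu : mu ≠ 0) {k : ℕ} {G H : ℝ → ℝ}
    (hG : IsLagEigen n k mu G) (hH : IsLagEigen n k mu H) :
    IsLagEigen n k mu (fun x => G x + H x) := by
  obtain ⟨cG, ⟨C, hC⟩, eG⟩ := hG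
  obtain ⟨cH, ⟨D, hD⟩, eH⟩ := hH
  refine ⟨cG.add cH, ⟨C + D, fun x hx => ?_⟩, fun z => ?_⟩
  · rw [add_mul]
    exact (abs_add_le _ _).trans (add_le_add (hC x hx) (hD x hx))
  · have e1 := integral_add (integrable_expDecay_mul_lagFun (n := n) hn hmu k cG hC).1
      (integrable_expDecay_mul_lagFun hn hmu k cH hD).1
    have e2 := integral_add (integrable_expDecay_twConv_lagFun (n := n) hn hmu k cG hC z).1
      (integrable_expDecay_twConv_lagFun hn hmu k cH hD z).1
    have h1 := eG z
    have h2 := eH z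
    rw [twConv_eq] at h1 h2 ⊢
    simp only [Complex.ofReal_add, add_mul] at e1 e2 ⊢
    rw [e1, e2, add_mul, mul_add, h1, h2]

lemma isLagEigen_gauss (hn : 1 ≤ n) {mu : ℝ} (hmu : mu ≠ 0) (k m : ℕ) (c : ℝ) :
    IsLagEigen n k mu (fun x => Real.exp (-x) * (c * Real.exp (-x) ^ m)) := by
  refine ⟨by fun_prop, ⟨|c|, fun x hx => ?_⟩, fun z => ?_⟩
  · rw [abs_mul, Real.abs_exp, mul_comm, abs_mul, abs_pow, Real.abs_exp]
    have : Real.exp (-x) ^ m ≤ 1 :=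
      pow_le_one₀ (Real.exp_pos _).le (Real.exp_le_one_iff.2 (by linarith))
    gcongr
    exact mul_le_of_le_one_right (abs_nonneg _) this
  · have hb : 0 < |mu| := abs_pos.2 hmu
    set M : ℝ := m + 1 with hM
    have hM0 : 0 < M := by positivity
    set σ := (4 * M - |mu|) / (4 * M + |mu|) with hσ
    have hσ1 : |σ| < 1 := by
      rw [abs_lt, hσ, lt_div_iff₀ (by positivity), div_lt_iff₀ (by positivity)]
      constructor <;> linarith
    have e : |mu| / 4 * ((1 + σ) / (1 - σ)) = M := by
      have e1 : 1 + σ = 8 * M / (4 * M + |mu|) := by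
        rw [hσ]
        field_simp
        ring
      have e2 : 1 - σ = 2 * |mu| / (4 * M + |mu|) := by
        rw [hσ]
        field_simp
        ring
      rw [e1, e2]
      field_simp
      ring
    have h := twConv_gauss_lagFun hn hmu k hσ1
    simp only [e, twConv_eq] at h
    have e3 : ∀ x : ℝ, Real.exp (-x) * (c * Real.exp (-x) ^ m) = c * Real.exp (-(M * x)) := by
      intro x
      rw [← Real.exp_nat_mul, mul_left_comm, ← Real.exp_add, hM]
      congr 2
      ring
    have h0 := h 0
    have e4 : ∀ w : Cn n, (Real.exp (-(M * ‖0 - w‖ ^ 2)) : ℂ) * (lagFun n k mu w : ℂ) * twE mu 0 w =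
        (Real.exp (-(M * ‖w‖ ^ 2)) : ℂ) * (lagFun n k mu w : ℂ) := by
      intro w
      have : imZW (0 : Cn n) w = 0 := by simp [imZW]
      rw [zero_sub, norm_neg, twE, this]
      simp
    simp_rw [e4] at h0
    rw [twConv_eq]
    simp_rw [e3, Complex.ofReal_mul, mul_assoc] at h h0 ⊢
    rw [integral_const_mul, integral_const_mul, h0, h z]
    push_cast
    ring

lemma isLagEigen_polynomial (hn : 1 ≤ n) {mu : ℝ} (hmu : mu ≠ 0) (k : ℕ) (P : Polynomial ℝ) :
    IsLagEigen n k mu (fun x => Real.exp (-x) * P.eval (Real.exp (-x))) := by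
  induction P using Polynomial.induction_on' with
  | add p q hp hq =>
    have := hp.add hn hmu hq
    simpa only [Polynomial.eval_add, mul_add] using this
  | monomial m c =>
    simpa only [Polynomial.eval_monomial] using isLagEigen_gauss hn hmu k m c

/-- Twisted convolution with a continuous compactly supported radial function has the Laguerre
functions as eigenfunctions. -/
lemma isLagEigen_of_support (hn : 1 ≤ n) {mu : ℝ} (hmu : mu ≠ 0) (k : ℕ) {G : ℝ → ℝ}
    (hG : Continuous G) {M : ℝ} (hM : ∀ x, M ≤ x → G x = 0) : IsLagEigen n k mu G := by
  set q : ℝ → ℝ := fun v => G (-Real.log v) / v with hq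
  have hqc : ContinuousOn q (Set.Icc 0 1) := by
    intro v hv
    rcases hv.1.eq_or_lt with h | h
    · rw [← h]
      have h0 : q =ᶠ[nhdsWithin 0 (Set.Icc 0 1)] fun _ => 0 := by
        have : Set.Iio (Real.exp (-M)) ∈ nhdsWithin (0 : ℝ) (Set.Icc 0 1) :=
          mem_nhdsWithin_of_mem_nhds (Iio_mem_nhds (Real.exp_pos _))
        filter_upwards [this, self_mem_nhdsWithin] with v h1 h2
        rcases h2.1.eq_or_lt with h3 | h3
        · simp [hq, ← h3]
        · have : Real.log v < -M := (Real.log_lt_iff_lt_exp h3).2 h1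
          simp only [hq]
          rw [hM _ (by linarith), zero_div]
      refine (continuousWithinAt_const (b := (0 : ℝ))).congr_of_eventuallyEq h0 ?_
      simp [hq]
    · refine ContinuousAt.continuousWithinAt ?_
      exact (hG.continuousAt.comp (Real.continuousAt_log h.ne').neg).div continuousAt_id h.ne'
  have happ : ∀ ε > 0, ∃ P : Polynomial ℝ, ∀ x, 0 ≤ x →
      |G x - Real.exp (-x) * P.eval (Real.exp (-x))| ≤ ε * Real.exp (-x) := by
    intro ε hε
    obtain ⟨P, hP⟩ := exists_polynomial_near_of_continuousOn 0 1 q hqc ε hε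
    refine ⟨P, fun x hx => ?_⟩
    have h := hP (Real.exp (-x)) ⟨(Real.exp_pos _).le, Real.exp_le_one_iff.2 (by linarith)⟩
    have e : G x = Real.exp (-x) * q (Real.exp (-x)) := by
      simp only [hq, Real.log_exp, neg_neg]
      field_simp
    rw [e, ← mul_sub, abs_mul, Real.abs_exp, mul_comm, abs_sub_comm]
    gcongr
  have hdec : ∃ C, ∀ x, 0 ≤ x → |G x| ≤ C * Real.exp (-x) := by
    obtain ⟨P, hP⟩ := happ 1 one_pos
    obtain ⟨C, hC⟩ := (isLagEigen_polynomial (n := n) hn hmu k P).2.1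
    refine ⟨1 + C, fun x hx => ?_⟩
    have h1 := hP x hx
    have h2 := hC x hx
    rw [add_mul]
    calc |G x| = |(G x - Real.exp (-x) * P.eval (Real.exp (-x))) +
          Real.exp (-x) * P.eval (Real.exp (-x))| := by congr 1; ring
      _ ≤ _ := (abs_add_le _ _).trans (add_le_add h1 h2)
  obtain ⟨C, hC⟩ := hdec
  refine ⟨hG, ⟨C, hC⟩, fun z => ?_⟩
  rw [← sub_eq_zero, ← norm_le_zero_iff]
  set c : ℝ := ((k + n - 1).choose k : ℝ) with hc
  set J := c * ∫ w : Cn n, Real.exp (-(1 * ‖w‖ ^ 2)) with hJ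
  have hφ : ∀ w : Cn n, ‖(lagFun n k mu w : ℂ)‖ ≤ c := fun w => by
    rw [Complex.norm_real]
    exact abs_lagFun_le hn hmu k w
  have hc0 : 0 ≤ c := (norm_nonneg _).trans (hφ 0)
  have hJ0 : 0 ≤ J := mul_nonneg hc0 (integral_nonneg fun w => (Real.exp_pos _).le)
  refine le_of_forall_pos_le_add fun δ hδ => ?_
  set ε := δ / (2 * (c * J) + 1) with hε
  have hcJ : 0 ≤ c * J := mul_nonneg hc0 hJ0
  have hε0 : 0 < ε := by positivity
  obtain ⟨P, hP⟩ := happ ε hε0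
  obtain ⟨cP, ⟨D, hD⟩, eP⟩ := isLagEigen_polynomial (n := n) hn hmu k P
  have hGP : Continuous fun x => G x - Real.exp (-x) * P.eval (Real.exp (-x)) := hG.sub cP
  obtain ⟨i1, b1⟩ := integrable_expDecay_mul_lagFun (n := n) hn hmu k hGP hP
  obtain ⟨i2, b2⟩ := integrable_expDecay_twConv_lagFun (n := n) hn hmu k hGP hP z
  have e1 := integral_sub (integrable_expDecay_mul_lagFun (n := n) hn hmu k hG hC).1
    (integrable_expDecay_mul_lagFun hn hmu k cP hD).1
  have e2 := integral_sub (integrable_expDecay_twConv_lagFun (n := n) hn hmu k hG hC z).1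
    (integrable_expDecay_twConv_lagFun hn hmu k cP hD z).1
  simp only [← sub_mul, ← Complex.ofReal_sub] at e1 e2
  have h1 := (norm_integral_le_integral_norm _).trans b1
  have h2 := (norm_integral_le_integral_norm _).trans b2
  rw [e1] at h1
  rw [e2] at h2
  have h3 := eP z
  rw [twConv_eq] at h3 ⊢
  have h4 : ∀ a b a' b' u v : ℂ, u * a' = b' * v → ‖u‖ ≤ c → ‖v‖ ≤ c → ‖a - a'‖ ≤ ε * J →
      ‖b - b'‖ ≤ ε * J → ‖u * a - b * v‖ ≤ 0 + δ := by
    intro a b a' b' u v h hu hv ha hb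
    have : u * a - b * v = u * (a - a') - (b - b') * v := by
      linear_combination h
    rw [this]
    calc _ ≤ ‖u‖ * ‖a - a'‖ + ‖b - b'‖ * ‖v‖ := by
          refine (norm_sub_le _ _).trans ?_
          rw [norm_mul, norm_mul]
      _ ≤ c * (ε * J) + (ε * J) * c := by gcongr
      _ = ε * (2 * (c * J)) := by ring
      _ ≤ ε * (2 * (c * J) + 1) := by gcongr; linarith
      _ = 0 + δ := by rw [hε, div_mul_cancel₀ _ (by positivity), zero_add]
  exact h4 _ _ _ _ _ _ h3 (hφ 0) (hφ z) h2 h1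

end RadialEigenfunctions

section LaguerreDecay

/-- The coefficients of the Laguerre polynomial. -/
def lagCoeff (n k j : ℕ) : ℝ :=
  if j ≤ k then ((k + n - 1).choose (k - j) : ℝ) * (-1) ^ j / j.factorial else 0

/-- The Laguerre polynomial as a polynomial. -/
def lagP (n k : ℕ) : Polynomial ℝ :=
  ∑ j ∈ Finset.range (k + 1), Polynomial.C (lagCoeff n k j) * Polynomial.X ^ j

lemma lagP_eval (n k : ℕ) (x : ℝ) : (lagP n k).eval x = lagPoly n k x := by
  rw [lagP, lagPoly, Polynomial.eval_finsetSum]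
  refine Finset.sum_congr rfl fun j hj => ?_
  have hj' : j ≤ k := by simpa [Nat.lt_succ_iff] using hj
  simp only [Polynomial.eval_mul, Polynomial.eval_C, Polynomial.eval_pow, Polynomial.eval_X,
    lagCoeff, if_pos hj']
  rw [neg_pow x]
  ring

lemma lagP_coeff (n k j : ℕ) : (lagP n k).coeff j = lagCoeff n k j := by
  rw [lagP, Polynomial.finsetSum_coeff]
  simp only [Polynomial.coeff_C_mul, Polynomial.coeff_X_pow, mul_ite, mul_one, mul_zero]
  rw [Finset.sum_ite_eq]
  split_ifs with h
  · rfl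
  · rw [lagCoeff, if_neg]
    simpa [Nat.lt_succ_iff] using h

lemma lagCoeff_succ {n : ℕ} (hn : 1 ≤ n) (k j : ℕ) :
    ((j : ℝ) + 1) * (n + j) * lagCoeff n k (j + 1) = -((k - j) * lagCoeff n k j) := by
  unfold lagCoeff
  rcases lt_trichotomy j k with h | h | h
  · rw [if_pos (by omega), if_pos h.le]
    obtain ⟨i, rfl⟩ : ∃ i, k = j + 1 + i := ⟨k - (j + 1), by omega⟩
    have e1 : j + 1 + i - (j + 1) = i := by omega
    have e2 : j + 1 + i - j = i + 1 := by omega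
    rw [e1, e2]
    have h1 := Nat.choose_succ_right_eq (j + 1 + i + n - 1) i
    have e3 : j + 1 + i + n - 1 - i = n + j := by omega
    rw [e3] at h1
    have h2 : ((j + 1 + i + n - 1).choose (i + 1) : ℝ) * (i + 1) =
        ((j + 1 + i + n - 1).choose i : ℝ) * (n + j) := by exact_mod_cast h1
    rw [Nat.factorial_succ, pow_succ]
    push_cast
    have hf : (j.factorial : ℝ) ≠ 0 := by positivity
    have hj : (j : ℝ) + 1 ≠ 0 := by positivity
    field_simp
    linear_combination h2
  · subst h
    simp
  · rw [if_neg (by omega), if_neg (by omega)]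
    simp

lemma lagP_ode {n : ℕ} (hn : 1 ≤ n) (k : ℕ) (u : ℝ) :
    u * (lagP n k).derivative.derivative.eval u + (n - u) * (lagP n k).derivative.eval u +
      k * (lagP n k).eval u = 0 := by
  have h : Polynomial.X * (lagP n k).derivative.derivative +
      (Polynomial.C (n : ℝ) - Polynomial.X) * (lagP n k).derivative +
      Polynomial.C (k : ℝ) * lagP n k = 0 := by
    ext j
    rw [sub_mul]
    simp only [Polynomial.coeff_add, Polynomial.coeff_sub, Polynomial.coeff_C_mul,
      Polynomial.coeff_zero]
    have hj := lagCoeff_succ hn k j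
    cases j with
    | zero =>
      simp only [Polynomial.coeff_X_mul_zero, Polynomial.coeff_derivative, lagP_coeff]
      push_cast at hj ⊢
      linear_combination hj
    | succ i =>
      simp only [Polynomial.coeff_X_mul, Polynomial.coeff_derivative, lagP_coeff]
      push_cast at hj ⊢
      linear_combination hj
  have := congrArg (Polynomial.eval u) h
  simpa using this

/-- The derivative of `lagR` in its last variable. -/
def lagR' (n k : ℕ) (b x : ℝ) : ℝ :=
  b / 2 * ((lagP n k).derivative.eval (b / 2 * x) - (lagP n k).eval (b / 2 * x) / 2) *
    Real.exp (-(b * x / 4))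

/-- The second derivative of `lagR` in its last variable. -/
def lagR'' (n k : ℕ) (b x : ℝ) : ℝ :=
  (b / 2) ^ 2 * ((lagP n k).derivative.derivative.eval (b / 2 * x) -
    (lagP n k).derivative.eval (b / 2 * x) + (lagP n k).eval (b / 2 * x) / 4) *
    Real.exp (-(b * x / 4))

lemma hasDerivAt_lagR_aux (P : Polynomial ℝ) (b x : ℝ) :
    HasDerivAt (fun x => P.eval (b / 2 * x) * Real.exp (-(b * x / 4)))
      (b / 2 * (P.derivative.eval (b / 2 * x) - P.eval (b / 2 * x) / 2) *
        Real.exp (-(b * x / 4))) x := by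
  have h1 : HasDerivAt (fun x => P.eval (b / 2 * x))
        (P.derivative.eval (b / 2 * x) * (b / 2)) x := by
    have := (P.hasDerivAt (b / 2 * x)).comp x ((hasDerivAt_id x).const_mul (b / 2))
    simpa [Function.comp_def] using this
  have h2 : HasDerivAt (fun x => Real.exp (-(b * x / 4)))
      (Real.exp (-(b * x / 4)) * (-(b / 4))) x := by
    have h3 : HasDerivAt (fun x => -(b * x / 4)) (-(b / 4)) x := by
      exact (((hasDerivAt_id' x).const_mul b).div_const 4).neg.congr_deriv (by ring)
    exact h3.exp
  refine (h1.mul h2).congr_deriv ?_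
  ring

lemma lagR_eq (n k : ℕ) (b x : ℝ) :
    lagR n k b x = (lagP n k).eval (b / 2 * x) * Real.exp (-(b * x / 4)) := by
  rw [lagP_eval, lagR]
  congr 2
  ring

lemma hasDerivAt_lagR (n k : ℕ) (b x : ℝ) : HasDerivAt (lagR n k b) (lagR' n k b x) x := by
  rw [funext (lagR_eq n k b)]
  exact hasDerivAt_lagR_aux (lagP n k) b x

lemma hasDerivAt_lagR' (n k : ℕ) (b x : ℝ) : HasDerivAt (lagR' n k b) (lagR'' n k b x) x := by
  have h := (((hasDerivAt_lagR_aux (lagP n k).derivative b x).sub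
    ((hasDerivAt_lagR_aux (lagP n k) b x).div_const 2)).const_mul (b / 2))
  have e : lagR' n k b = fun x => b / 2 * ((lagP n k).derivative.eval (b / 2 * x) *
      Real.exp (-(b * x / 4)) - (lagP n k).eval (b / 2 * x) * Real.exp (-(b * x / 4)) / 2) := by
    ext x
    rw [lagR']
    ring
  rw [e]
  refine h.congr_deriv ?_
  rw [lagR'']
  ring

lemma lagR_ode {n : ℕ} (hn : 1 ≤ n) (k : ℕ) (b x : ℝ) :
    x * lagR'' n k b x + n * lagR' n k b x =
      (b ^ 2 / 16 * x - (2 * k + n) * b / 4) * lagR n k b x := by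
  have h := lagP_ode hn k (b / 2 * x)
  rw [lagR_eq, lagR', lagR'']
  linear_combination (b / 2 * Real.exp (-(b * x / 4))) * h

/-- The profile `(1 - x)²₊`. -/
def bump (x : ℝ) : ℝ := max 0 (1 - x) ^ 2

@[fun_prop]
lemma continuous_bump : Continuous bump := by
  unfold bump
  fun_prop

lemma bump_nonneg (x : ℝ) : 0 ≤ bump x := sq_nonneg _

lemma bump_of_le {x : ℝ} (hx : x ≤ 1) : bump x = (1 - x) ^ 2 := by
  rw [bump, max_eq_right (by linarith)]

lemma bump_of_ge {x : ℝ} (hx : 1 ≤ x) : bump x = 0 := by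
  rw [bump, max_eq_left (by linarith), zero_pow two_ne_zero]

lemma abs_integral_bump_lagR_le {m : ℕ} (k : ℕ) {b c : ℝ} (hb : 0 < b)
    (hc : ∀ x, 0 ≤ x → |lagR (m + 1) k b x| ≤ c) :
    |∫ r in (0 : ℝ)..1, r ^ (2 * m + 1) * ((1 - r ^ 2) ^ 2 * lagR (m + 1) k b (r ^ 2))| *
      ((2 * k + (m + 1)) * b) ≤ (b ^ 2 + 8 * (m + 2)) * c := by
  set L := lagR (m + 1) k b with hL
  set L' := lagR' (m + 1) k b with hL'
  set y2 := (2 * k + (m + 1)) * b with hy2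
  have hder : ∀ r : ℝ, HasDerivAt
      (fun r => (1 - r ^ 2) ^ 2 * (r ^ 2) ^ (m + 1) * L' (r ^ 2) +
        2 * (1 - r ^ 2) * (r ^ 2) ^ (m + 1) * L (r ^ 2))
      (2 * r * ((b ^ 2 / 16 * r ^ 2 * (1 - r ^ 2) ^ 2 - 2 * r ^ 2 + 2 * (m + 1) * (1 - r ^ 2)) *
        (r ^ 2) ^ m * L (r ^ 2)) -
        y2 / 2 * (r ^ (2 * m + 1) * ((1 - r ^ 2) ^ 2 * L (r ^ 2)))) r := by
    intro r
    have hx : HasDerivAt (fun r : ℝ => r ^ 2) (2 * r) r := by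
      simpa using hasDerivAt_pow 2 r
    have h1 : HasDerivAt (fun x => (1 - x) ^ 2 * x ^ (m + 1) * L' x +
        2 * (1 - x) * x ^ (m + 1) * L x)
        ((b ^ 2 / 16 * r ^ 2 * (1 - r ^ 2) ^ 2 - 2 * r ^ 2 + 2 * (m + 1) * (1 - r ^ 2)) *
        (r ^ 2) ^ m * L (r ^ 2) - y2 / 4 * ((r ^ 2) ^ m * ((1 - r ^ 2) ^ 2 * L (r ^ 2))))
        (r ^ 2) := by
      generalize r ^ 2 = x
      have ha : HasDerivAt (fun x : ℝ => 1 - x) (-1) x := by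
        simpa using (hasDerivAt_id x).const_sub 1
      have hp := hasDerivAt_pow (m + 1) x
      have hode := lagR_ode (n := m + 1) (by omega) k b x
      have h := (((ha.pow 2).mul hp).mul (hasDerivAt_lagR' (m + 1) k b x)).add
        (((ha.const_mul 2).mul hp).mul (hasDerivAt_lagR (m + 1) k b x))
      refine h.congr_deriv ?_
      simp only [Pi.mul_apply, Pi.pow_apply, Nat.add_sub_cancel]
      push_cast at hode ⊢
      rw [← hL, ← hL'] at *
      rw [hy2]
      simp only [pow_succ x m]
      linear_combination (1 - x) ^ 2 * x ^ m * hode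
    have h2 := HasDerivAt.comp (h := fun r : ℝ => r ^ 2) r h1 hx
    refine h2.congr_deriv ?_
    rw [show r ^ (2 * m + 1) = (r ^ 2) ^ m * r by rw [pow_succ, pow_mul]]
    ring
  have hLc : Continuous L := continuous_lagR _ _ _
  have hftc := intervalIntegral.integral_eq_sub_of_hasDerivAt (a := 0) (b := 1)
    (fun r _ => hder r) (Continuous.intervalIntegrable (by fun_prop) _ _)
  rw [intervalIntegral.integral_sub (Continuous.intervalIntegrable (by fun_prop) _ _)
    (Continuous.intervalIntegrable (by fun_prop) _ _), intervalIntegral.integral_const_mul] at hftc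
  have hz : ((1 : ℝ) - 1 ^ 2) = 0 := by norm_num
  have hz2 : ((0 : ℝ) ^ 2) ^ (m + 1) = 0 := by simp
  rw [hz, hz2] at hftc
  simp only [ne_eq, OfNat.ofNat_ne_zero, not_false_eq_true, zero_pow, mul_zero, zero_mul, add_zero,
    sub_zero] at hftc
  have hy0 : 0 ≤ y2 := by positivity
  have hbound : |∫ r in (0 : ℝ)..1, 2 * r * ((b ^ 2 / 16 * r ^ 2 * (1 - r ^ 2) ^ 2 - 2 * r ^ 2 +
      2 * (m + 1) * (1 - r ^ 2)) * (r ^ 2) ^ m * L (r ^ 2))| ≤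
      (2 * (b ^ 2 / 16 + 2 + 2 * (m + 1)) * c) * |(1 : ℝ) - 0| := by
    rw [← Real.norm_eq_abs]
    refine intervalIntegral.norm_integral_le_of_norm_le_const fun r hr => ?_
    rw [Set.uIoc_of_le zero_le_one] at hr
    have hr2 : r ^ 2 ≤ 1 := pow_le_one₀ hr.1.le hr.2
    have hr0 : 0 ≤ r ^ 2 := by positivity
    have hc0 : |L (r ^ 2)| ≤ c := hc _ hr0
    have hpm : |(r ^ 2) ^ m| ≤ 1 := by
      rw [abs_of_nonneg (by positivity)]
      exact pow_le_one₀ hr0 hr2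
    have hq : |b ^ 2 / 16 * r ^ 2 * (1 - r ^ 2) ^ 2 - 2 * r ^ 2 + 2 * (m + 1) * (1 - r ^ 2)| ≤
        b ^ 2 / 16 + 2 + 2 * (m + 1) := by
      have h1 : |b ^ 2 / 16 * r ^ 2 * (1 - r ^ 2) ^ 2| ≤ b ^ 2 / 16 := by
        rw [abs_of_nonneg (by positivity)]
        have : (1 - r ^ 2) ^ 2 ≤ 1 := pow_le_one₀ (by linarith) (by linarith)
        have h3 : r ^ 2 * (1 - r ^ 2) ^ 2 ≤ 1 := mul_le_one₀ hr2 (sq_nonneg _) this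
        rw [mul_assoc]
        exact mul_le_of_le_one_right (by positivity) h3
      have h2 : |2 * r ^ 2| ≤ 2 := by
        rw [abs_of_nonneg (by positivity)]
        linarith
      have h3 : |2 * ((m : ℝ) + 1) * (1 - r ^ 2)| ≤ 2 * ((m : ℝ) + 1) := by
        rw [abs_of_nonneg (mul_nonneg (by positivity) (by linarith))]
        exact mul_le_of_le_one_right (by positivity) (by linarith)
      exact (abs_add_le _ _).trans (add_le_add ((abs_sub _ _).trans (add_le_add h1 h2)) h3)
    rw [Real.norm_eq_abs, abs_mul, abs_mul _ (L (r ^ 2)), abs_mul _ ((r ^ 2) ^ m)]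
    have h2r : |2 * r| ≤ 2 := by
      rw [abs_of_nonneg (by linarith [hr.1])]
      linarith [hr.2]
    calc _ ≤ 2 * ((b ^ 2 / 16 + 2 + 2 * (m + 1)) * 1 * c) := by gcongr
      _ = _ := by ring
  rw [show (∫ r in (0 : ℝ)..1, 2 * r * ((b ^ 2 / 16 * r ^ 2 * (1 - r ^ 2) ^ 2 - 2 * r ^ 2 +
      2 * (m + 1) * (1 - r ^ 2)) * (r ^ 2) ^ m * L (r ^ 2))) = y2 / 2 *
      ∫ r in (0 : ℝ)..1, r ^ (2 * m + 1) * ((1 - r ^ 2) ^ 2 * L (r ^ 2)) by linarith, abs_mul,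
      abs_of_nonneg (by linarith)] at hbound
  norm_num at hbound
  have hc0 : 0 ≤ c := (abs_nonneg _).trans (hc 0 le_rfl)
  nlinarith [mul_nonneg (sq_nonneg b) hc0]

end LaguerreDecay

section BumpDecay

variable {n : ℕ}

lemma integrable_bump : Integrable fun w : Cn n => bump (‖w‖ ^ 2) := by
  refine Continuous.integrable_of_hasCompactSupport (by fun_prop) ?_
  refine HasCompactSupport.of_support_subset_isCompact (isCompact_closedBall (0 : Cn n) 1)
    fun w hw => ?_
  by_contra h
  rw [mem_closedBall_zero_iff, not_le] at h
  exact hw (bump_of_ge (by nlinarith))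

lemma integral_bump_pos (n : ℕ) : 0 < ∫ w : Cn n, bump (‖w‖ ^ 2) := by
  refine (Continuous.integral_pos_of_hasCompactSupport_nonneg_nonzero (x := 0) (by fun_prop) ?_
    (fun w => bump_nonneg _) ?_)
  · refine HasCompactSupport.of_support_subset_isCompact (isCompact_closedBall (0 : Cn n) 1)
      fun w hw => ?_
    by_contra h
    rw [mem_closedBall_zero_iff, not_le] at h
    exact hw (bump_of_ge (by nlinarith))
  · simp [bump]

lemma integral_bump_lagFun (hn : 1 ≤ n) (k : ℕ) (mu : ℝ) :
    ∫ w : Cn n, bump (‖w‖ ^ 2) * lagFun n k mu w =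
      (2 * n) * (volume : Measure (Cn n)).real (Metric.ball 0 1) *
        ∫ r in (0 : ℝ)..1, r ^ (2 * n - 1) * ((1 - r ^ 2) ^ 2 * lagR n k |mu| (r ^ 2)) := by
  have : Nonempty (Fin n) := ⟨⟨0, hn⟩⟩
  have h := integral_fun_norm_addHaar (volume : Measure (Cn n))
    (fun r => bump (r ^ 2) * lagR n k |mu| (r ^ 2))
  rw [finrank_Cn] at h
  refine h.trans ?_
  simp only [nsmul_eq_mul, smul_eq_mul]
  push_cast
  rw [mul_assoc (2 * (n : ℝ))]
  congr 2
  rw [intervalIntegral.integral_of_le zero_le_one]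
  refine (setIntegral_eq_of_subset_of_forall_sdiff_eq_zero (E := ℝ) measurableSet_Ioi
    (fun _ h => h.1 : Set.Ioc (0 : ℝ) 1 ⊆ Set.Ioi 0) fun r hr => ?_).trans
    (setIntegral_congr_fun measurableSet_Ioc fun r hr => ?_)
  · have h1 : 1 < r := by
      by_contra h
      exact hr.2 ⟨hr.1, not_lt.1 h⟩
    rw [bump_of_ge (by nlinarith), zero_mul, mul_zero]
  · rw [bump_of_le (pow_le_one₀ hr.1.le hr.2)]

lemma norm_integral_exp_le_one (mu : ℝ) :
    ‖∫ t in (0 : ℝ)..1, Complex.exp (Complex.I * mu * t)‖ ≤ 1 := by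
  have := intervalIntegral.norm_integral_le_of_norm_le_const (a := (0 : ℝ)) (b := 1) (C := 1)
    (f := fun t : ℝ => Complex.exp (Complex.I * mu * t)) fun t _ => by
      rw [show Complex.I * mu * t = ((mu * t : ℝ) : ℂ) * Complex.I by push_cast; ring,
        Complex.norm_exp_ofReal_mul_I]
  simpa using this

lemma norm_integral_exp_mul_le {mu : ℝ} (hmu : mu ≠ 0) :
    ‖∫ t in (0 : ℝ)..1, Complex.exp (Complex.I * mu * t)‖ * |mu| ≤ 2 := by
  have hc : Complex.I * mu ≠ 0 := mul_ne_zero Complex.I_ne_zero (by exact_mod_cast hmu)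
  rw [integral_exp_mul_complex hc, norm_div, norm_mul, Complex.norm_I, one_mul, Complex.norm_real,
    Real.norm_eq_abs, div_mul_cancel₀ _ (abs_pos.2 hmu).ne']
  refine (norm_sub_le _ _).trans ?_
  have e : ∀ t : ℝ, ‖Complex.exp (Complex.I * mu * t)‖ = 1 := fun t => by
    rw [show Complex.I * mu * t = ((mu * t : ℝ) : ℂ) * Complex.I by push_cast; ring,
      Complex.norm_exp_ofReal_mul_I]
  rw [e, e]
  norm_num

/-- The eigenvalue of the averaging operator at scale one. -/
def bumpEig (n k : ℕ) (mu : ℝ) : ℂ :=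
  (∫ t in (0 : ℝ)..1, Complex.exp (Complex.I * mu * t)) *
    (((∫ w : Cn n, bump (‖w‖ ^ 2))⁻¹ * (∫ w : Cn n, bump (‖w‖ ^ 2) * lagFun n k mu w) /
      ((k + n - 1).choose k : ℝ) : ℝ) : ℂ)

lemma abs_bumpAvg_le (hn : 1 ≤ n) (k : ℕ) {mu : ℝ} (hmu : mu ≠ 0) :
    |(∫ w : Cn n, bump (‖w‖ ^ 2))⁻¹ * (∫ w : Cn n, bump (‖w‖ ^ 2) * lagFun n k mu w) /
      ((k + n - 1).choose k : ℝ)| ≤ 1 := by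
  have hc : 0 < ((k + n - 1).choose k : ℝ) := by exact_mod_cast Nat.choose_pos (by omega)
  rw [abs_div, abs_of_pos hc, div_le_one hc, abs_mul, abs_of_pos (inv_pos.2 (integral_bump_pos n)),
    inv_mul_le_iff₀ (integral_bump_pos n), ← integral_mul_const, ← Real.norm_eq_abs]
  refine norm_integral_le_of_norm_le (integrable_bump.mul_const _)
    (Eventually.of_forall fun w => ?_)
  rw [Real.norm_eq_abs, abs_mul, abs_of_nonneg (bump_nonneg _)]
  exact mul_le_mul_of_nonneg_left (abs_lagFun_le hn hmu k w) (bump_nonneg _)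

lemma norm_bumpEig_le_one (hn : 1 ≤ n) (k : ℕ) {mu : ℝ} (hmu : mu ≠ 0) :
    ‖bumpEig n k mu‖ ≤ 1 := by
  rw [bumpEig, norm_mul, Complex.norm_real, Real.norm_eq_abs]
  exact mul_le_one₀ (norm_integral_exp_le_one mu) (abs_nonneg _) (abs_bumpAvg_le hn k hmu)

lemma exists_bumpEig_decay (hn : 1 ≤ n) : ∃ C : ℝ, 0 < C ∧ ∀ (k : ℕ) (mu : ℝ), mu ≠ 0 →
    ‖bumpEig n k mu‖ * Real.sqrt ((2 * k + n) * |mu|) ≤ C := by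
  obtain ⟨m, rfl⟩ : ∃ m, n = m + 1 := ⟨n - 1, by omega⟩
  set B := ∫ w : Cn (m + 1), bump (‖w‖ ^ 2) with hB
  have hB0 : 0 < B := integral_bump_pos _
  set V := (2 * ((m + 1 : ℕ) : ℝ)) * (volume : Measure (Cn (m + 1))).real (Metric.ball 0 1) with hV
  have hV0 : 0 ≤ V := by positivity
  set C1 := B⁻¹ * V * (8 * (m + 2)) with hC1
  have hC10 : 0 ≤ C1 := by positivity
  refine ⟨Real.sqrt (5 * C1) + 1, by positivity, fun k mu hmu => ?_⟩
  have hb : 0 < |mu| := abs_pos.2 hmu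
  set c : ℝ := ((k + (m + 1) - 1).choose k : ℝ) with hc
  have hc0 : 0 < c := by
    rw [hc]
    exact_mod_cast Nat.choose_pos (by omega)
  have h1 := norm_integral_exp_le_one mu
  have h2 := norm_integral_exp_mul_le hmu
  have h3 := abs_bumpAvg_le (n := m + 1) hn k hmu
  have h4 := abs_integral_bump_lagR_le (m := m) k hb (c := c) (fun x hx => by
    obtain ⟨w, hw⟩ : ∃ w : Cn (m + 1), ‖w‖ ^ 2 = x := by
      obtain ⟨w, hw⟩ := exists_norm_eq (Cn (m + 1)) (Real.sqrt_nonneg x)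
      exact ⟨w, by rw [hw, Real.sq_sqrt hx]⟩
    rw [← hw]
    exact abs_lagFun_le hn hmu k w)
  rw [bumpEig, norm_mul, Complex.norm_real, Real.norm_eq_abs]
  rw [integral_bump_lagFun hn, ← hV, show 2 * (m + 1) - 1 = 2 * m + 1 by omega, ← hc, ← hB] at *
  set τ := ‖∫ t in (0 : ℝ)..1, Complex.exp (Complex.I * mu * t)‖
  set J := ∫ r in (0 : ℝ)..1, r ^ (2 * m + 1) * ((1 - r ^ 2) ^ 2 * lagR (m + 1) k |mu| (r ^ 2))
  set y2 := (2 * (k : ℝ) + ((m + 1 : ℕ) : ℝ)) * |mu| with hy2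
  have hy20 : 0 ≤ y2 := by positivity
  have h5 : |B⁻¹ * (V * J) / c| * y2 ≤ C1 * (1 + |mu| ^ 2) := by
    rw [abs_div, abs_mul, abs_mul, abs_of_pos hc0, abs_of_pos (inv_pos.2 hB0), abs_of_nonneg hV0,
      div_mul_eq_mul_div, div_le_iff₀ hc0, hC1]
    have h6 : |J| * y2 ≤ (|mu| ^ 2 + 8 * (m + 2)) * c := by
      rw [hy2]
      push_cast
      exact h4
    calc B⁻¹ * (V * |J|) * y2 = (B⁻¹ * V) * (|J| * y2) := by ring
      _ ≤ (B⁻¹ * V) * ((|mu| ^ 2 + 8 * (m + 2)) * c) := by gcongr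
      _ ≤ (B⁻¹ * V) * ((8 * (m + 2) * (1 + |mu| ^ 2)) * c) := by
          gcongr
          have : (0 : ℝ) ≤ m := by positivity
          nlinarith [sq_nonneg |mu|, mul_nonneg this (sq_nonneg |mu|)]
      _ = _ := by ring
  set a := |B⁻¹ * (V * J) / c|
  have ha : 0 ≤ a := abs_nonneg _
  have hτ : 0 ≤ τ := norm_nonneg _
  have h7 : (τ * a * Real.sqrt y2) ^ 2 ≤ 5 * C1 := by
    rw [mul_pow, Real.sq_sqrt hy20]
    calc (τ * a) ^ 2 * y2 = τ ^ 2 * (a * (a * y2)) := by ring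
      _ ≤ τ ^ 2 * (1 * (C1 * (1 + |mu| ^ 2))) := by gcongr
      _ = C1 * (τ ^ 2 + (τ * |mu|) ^ 2) := by ring
      _ ≤ C1 * (1 ^ 2 + 2 ^ 2) := by gcongr
      _ = _ := by ring
  have := Real.le_sqrt_of_sq_le h7
  linarith

end BumpDecay

section Averaging

variable {n : ℕ}

/-- The probability measure used for averaging on the Heisenberg group. -/
def avgMeasure (n : ℕ) : Measure (Cn n × ℝ) :=
  ((volume : Measure (Cn n)).withDensity fun w =>
    ENNReal.ofReal ((∫ w : Cn n, bump (‖w‖ ^ 2))⁻¹ * bump (‖w‖ ^ 2))).prod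
      (volume.restrict (Set.Ioc (0 : ℝ) 1))

instance isProbabilityMeasure_bump (n : ℕ) :
    IsProbabilityMeasure ((volume : Measure (Cn n)).withDensity fun w =>
    ENNReal.ofReal ((∫ w : Cn n, bump (‖w‖ ^ 2))⁻¹ * bump (‖w‖ ^ 2))) := by
  refine ⟨?_⟩
  rw [withDensity_apply _ MeasurableSet.univ, Measure.restrict_univ,
    ← ofReal_integral_eq_lintegral_ofReal (integrable_bump.const_mul _)
    (Eventually.of_forall fun w => mul_nonneg (inv_nonneg.2 (integral_bump_pos n).le)
      (bump_nonneg _)), integral_const_mul, inv_mul_cancel₀ (integral_bump_pos n).ne',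
    ENNReal.ofReal_one]

instance isProbabilityMeasure_Ioc :
    IsProbabilityMeasure (volume.restrict (Set.Ioc (0 : ℝ) 1)) :=
  ⟨by simp⟩

instance isProbabilityMeasure_avgMeasure (n : ℕ) : IsProbabilityMeasure (avgMeasure n) := by
  unfold avgMeasure
  infer_instance

lemma ae_avgMeasure (n : ℕ) :
    ∀ᵐ q ∂(avgMeasure n), ‖q.1‖ ≤ 1 ∧ 0 ≤ q.2 ∧ q.2 ≤ 1 := by
  unfold avgMeasure
  have h1 : ∀ᵐ w ∂((volume : Measure (Cn n)).withDensity fun w =>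
      ENNReal.ofReal ((∫ w : Cn n, bump (‖w‖ ^ 2))⁻¹ * bump (‖w‖ ^ 2))), ‖w‖ ≤ 1 := by
    rw [ae_withDensity_iff (by fun_prop)]
    refine Eventually.of_forall fun w hw => ?_
    by_contra h
    rw [bump_of_ge (by nlinarith)] at hw
    simp at hw
  have h2 : ∀ᵐ t ∂(volume.restrict (Set.Ioc (0 : ℝ) 1)), 0 ≤ t ∧ t ≤ 1 :=
    (ae_restrict_mem measurableSet_Ioc).mono fun t ht => ⟨ht.1.le, ht.2⟩
  filter_upwards [Measure.quasiMeasurePreserving_fst.ae h1,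
    Measure.quasiMeasurePreserving_snd.ae h2] with q hq1 hq2 using ⟨hq1, hq2⟩

/-- Right translation of `x` by the inverse of the dilate of `q`. -/
def shiftH (ρ : ℝ) (x q : Cn n × ℝ) : Cn n × ℝ :=
  (x.1 - ρ • q.1, x.2 - (ρ ^ 2 * q.2 + ρ / 2 * imZW q.1 x.1))

@[fun_prop]
lemma continuous_shiftH {X : Type*} [TopologicalSpace X] (ρ : ℝ) {f g : X → Cn n × ℝ}
    (hf : Continuous f) (hg : Continuous g) : Continuous fun x => shiftH ρ (f x) (g x) := by
  unfold shiftH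
  fun_prop

/-- Averaging over the dilated bump. -/
def avgH (n : ℕ) (ρ : ℝ) (F : Cn n × ℝ → ℝ) (x : Cn n × ℝ) : ℝ :=
  ∫ q, F (shiftH ρ x q) ∂(avgMeasure n)

/-- Bounded continuous functions on the Heisenberg group. -/
def NiceH (F : Cn n × ℝ → ℝ) : Prop := Continuous F ∧ ∃ M, ∀ x, |F x| ≤ M

lemma NiceH.integrable_shift {F : Cn n × ℝ → ℝ} (hF : NiceH F) (ρ : ℝ) (x : Cn n × ℝ) :
    Integrable (fun q => F (shiftH ρ x q)) (avgMeasure n) := by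
  obtain ⟨hc, M, hM⟩ := hF
  exact (integrable_const M).mono' (Continuous.aestronglyMeasurable (by fun_prop))
    (Eventually.of_forall fun q => hM _)

lemma NiceH.avg {F : Cn n × ℝ → ℝ} (hF : NiceH F) (ρ : ℝ) : NiceH (avgH n ρ F) := by
  obtain ⟨hc, M, hM⟩ := hF
  refine ⟨?_, M, fun x => ?_⟩
  · refine continuous_of_dominated (bound := fun _ => M)
      (fun x => Continuous.aestronglyMeasurable (by fun_prop))
      (fun x => Eventually.of_forall fun q => hM _) (integrable_const M)
      (Eventually.of_forall fun q => by fun_prop)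
  · have := norm_integral_le_of_norm_le_const (μ := avgMeasure n)
      (f := fun q => F (shiftH ρ x q)) (C := M) (Eventually.of_forall fun q => hM _)
    simpa [avgH] using this

lemma avgH_nonneg {F : Cn n × ℝ → ℝ} (hF : ∀ x, 0 ≤ F x) (ρ : ℝ) (x : Cn n × ℝ) :
    0 ≤ avgH n ρ F x :=
  integral_nonneg fun _ => hF _

lemma abs_avgH_sub_le {F G : Cn n × ℝ → ℝ} (hF : NiceH F) (hG : NiceH G) {δ : ℝ}
    (h : ∀ x, |F x - G x| ≤ δ) (ρ : ℝ) (x : Cn n × ℝ) : |avgH n ρ F x - avgH n ρ G x| ≤ δ := by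
  rw [avgH, avgH, ← integral_sub (hF.integrable_shift ρ x) (hG.integrable_shift ρ x)]
  have := norm_integral_le_of_norm_le_const (μ := avgMeasure n)
    (f := fun q => F (shiftH ρ x q) - G (shiftH ρ x q)) (C := δ)
    (Eventually.of_forall fun q => h _)
  simpa using this

/-- Functions supported in the box of size `τ`. -/
def BoxSupp (τ : ℝ) (F : Cn n × ℝ → ℝ) : Prop := ∀ x, F x ≠ 0 → ‖x.1‖ ≤ τ ∧ |x.2| ≤ 2 * τ

lemma BoxSupp.avg {τ ρ : ℝ} {F : Cn n × ℝ → ℝ} (hF : BoxSupp τ F) (hρ : 0 ≤ ρ) (hτ : 0 ≤ τ)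
    (h1 : τ + ρ ≤ 1) : BoxSupp (τ + ρ) (avgH n ρ F) := by
  intro x hx
  by_contra hcon
  refine hx ?_
  rw [avgH, integral_eq_zero_of_ae]
  filter_upwards [ae_avgMeasure n] with q hq
  by_contra hne
  obtain ⟨h2, h3⟩ := hF _ hne
  simp only [shiftH] at h2 h3
  have hz : ‖x.1‖ ≤ τ + ρ := by
    have : x.1 = (x.1 - ρ • q.1) + ρ • q.1 := by abel
    rw [this]
    refine (norm_add_le _ _).trans (add_le_add h2 ?_)
    rw [norm_smul, Real.norm_eq_abs, abs_of_nonneg hρ]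
    exact mul_le_of_le_one_right hρ hq.1
  refine hcon ⟨hz, ?_⟩
  have h4 : |imZW q.1 x.1| ≤ 1 := (abs_imZW_le _ _).trans
    (mul_le_one₀ hq.1 (norm_nonneg _) (hz.trans h1))
  have h5 : |ρ ^ 2 * q.2| ≤ ρ := by
    rw [abs_of_nonneg (mul_nonneg (sq_nonneg _) hq.2.1)]
    nlinarith [mul_le_of_le_one_right (sq_nonneg ρ) hq.2.2]
  have h6 : |ρ / 2 * imZW q.1 x.1| ≤ ρ / 2 := by
    rw [abs_mul, abs_of_nonneg (by positivity)]
    exact mul_le_of_le_one_right (by positivity) h4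
  rw [abs_le] at *
  constructor <;> linarith [h3.1, h3.2, h5.1, h5.2, h6.1, h6.2]

end Averaging

section AveragingEigen

variable {n : ℕ}

lemma integrable_indicator_Icc_const (S M : ℝ) :
    Integrable ((Set.Icc (-S) S).indicator fun _ : ℝ => M) :=
  (integrable_indicator_iff measurableSet_Icc).2 (integrableOn_const (by simp) (by simp))

/-- Continuous real functions supported in a box, bounded by `M`. -/
structure BoxFun (τ M : ℝ) (F : Cn n × ℝ → ℝ) : Prop where
  cont : Continuous F
  bound : ∀ x, |F x| ≤ M
  supp : BoxSupp τ F

lemma BoxFun.niceH {τ M : ℝ} {F : Cn n × ℝ → ℝ} (hF : BoxFun τ M F) : NiceH F :=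
  ⟨hF.cont, M, hF.bound⟩

lemma BoxFun.nonneg {τ M : ℝ} {F : Cn n × ℝ → ℝ} (hF : BoxFun τ M F) : 0 ≤ M :=
  (abs_nonneg _).trans (hF.bound 0)

lemma BoxFun.abs_le_indicator {τ M S : ℝ} {F : Cn n × ℝ → ℝ} (hF : BoxFun τ M F) (z : Cn n)
    (t s : ℝ) (hs : |s| + 2 * τ ≤ S) :
    |F (z, t - s)| ≤ (Set.Icc (-S) S).indicator (fun _ : ℝ => M) t := by
  by_cases h : F (z, t - s) = 0
  · rw [h, abs_zero]
    exact Set.indicator_nonneg (fun _ _ => hF.nonneg) _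
  · have h2 := (hF.supp _ h).2
    rw [Set.indicator_of_mem]
    · exact hF.bound _
    · simp only at h2
      rw [abs_le] at h2
      have := abs_le.1 (le_refl |s|)
      constructor <;> linarith

lemma norm_exp_I_mul (mu t : ℝ) : ‖Complex.exp (Complex.I * (mu : ℂ) * (t : ℂ))‖ = 1 := by
  rw [show Complex.I * mu * t = ((mu * t : ℝ) : ℂ) * Complex.I by push_cast; ring,
    Complex.norm_exp_ofReal_mul_I]

lemma BoxFun.norm_fLam_le {τ M : ℝ} {F : Cn n × ℝ → ℝ} (hF : BoxFun τ M F) (mu : ℝ) (z : Cn n) :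
    ‖fLam n (fun x => (F x : ℂ)) mu z‖ ≤
      ∫ t, (Set.Icc (-(2 * τ)) (2 * τ)).indicator (fun _ : ℝ => M) t := by
  refine norm_integral_le_of_norm_le (integrable_indicator_Icc_const _ _)
    (Eventually.of_forall fun t => ?_)
  rw [norm_mul, norm_exp_I_mul, one_mul, Complex.norm_real, Real.norm_eq_abs]
  simpa using hF.abs_le_indicator z t 0 (S := 2 * τ) (by simp)

lemma BoxFun.continuous_fLam {τ M : ℝ} {F : Cn n × ℝ → ℝ} (hF : BoxFun τ M F) (mu : ℝ) :
    Continuous (fLam n (fun x => (F x : ℂ)) mu) := by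
  have hc := hF.cont
  unfold fLam
  refine continuous_of_dominated
    (bound := (Set.Icc (-(2 * τ)) (2 * τ)).indicator (fun _ : ℝ => M))
    (fun x => Continuous.aestronglyMeasurable (by fun_prop))
    (fun x => Eventually.of_forall fun t => ?_) (integrable_indicator_Icc_const _ _)
    (Eventually.of_forall fun t => by fun_prop)
  rw [norm_mul, norm_exp_I_mul, one_mul, Complex.norm_real, Real.norm_eq_abs]
  simpa using hF.abs_le_indicator x t 0 (S := 2 * τ) (by simp)

lemma BoxFun.avg {τ M ρ : ℝ} {F : Cn n × ℝ → ℝ} (hF : BoxFun τ M F) (hρ : 0 ≤ ρ) (hτ : 0 ≤ τ)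
    (h1 : τ + ρ ≤ 1) : BoxFun (τ + ρ) M (avgH n ρ F) := by
  refine ⟨(hF.niceH.avg ρ).1, fun x => ?_, hF.supp.avg hρ hτ h1⟩
  have := norm_integral_le_of_norm_le_const (μ := avgMeasure n)
    (f := fun q => F (shiftH ρ x q)) (C := M) (Eventually.of_forall fun q => hF.bound _)
  simpa [avgH] using this

lemma BoxFun.fLam_avg {τ M ρ : ℝ} {F : Cn n × ℝ → ℝ} (hF : BoxFun τ M F) (hρ : 0 ≤ ρ)
    (mu : ℝ) (w : Cn n) :
    fLam n (fun x => (avgH n ρ F x : ℂ)) mu w =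
      ∫ q, Complex.exp (Complex.I * mu * ((ρ ^ 2 * q.2 : ℝ) : ℂ)) * twE mu (ρ • q.1) w *
        fLam n (fun x => (F x : ℂ)) mu (w - ρ • q.1) ∂(avgMeasure n) := by
  have hc := hF.cont
  set S := ρ ^ 2 + ρ / 2 * ‖w‖ + 2 * τ with hS
  have hbd : ∀ q : Cn n × ℝ, ‖q.1‖ ≤ 1 ∧ 0 ≤ q.2 ∧ q.2 ≤ 1 → ∀ t : ℝ,
      ‖Complex.exp (Complex.I * (mu : ℂ) * (t : ℂ)) * (F (shiftH ρ (w, t) q) : ℂ)‖ ≤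
      (Set.Icc (-S) S).indicator (fun _ : ℝ => M) t := by
    intro q hq t
    rw [norm_mul, norm_exp_I_mul, one_mul, Complex.norm_real, Real.norm_eq_abs]
    refine hF.abs_le_indicator _ _ _ ?_
    rw [hS]
    gcongr
    refine (abs_add_le _ _).trans (add_le_add ?_ ?_)
    · rw [abs_of_nonneg (mul_nonneg (sq_nonneg _) hq.2.1)]
      exact mul_le_of_le_one_right (sq_nonneg _) hq.2.2
    · rw [abs_mul, abs_of_nonneg (by positivity)]
      gcongr
      exact (abs_imZW_le _ _).trans (mul_le_of_le_one_left (norm_nonneg _) hq.1)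
  have hinteg : Integrable (Function.uncurry fun (t : ℝ) (q : Cn n × ℝ) =>
      Complex.exp (Complex.I * (mu : ℂ) * (t : ℂ)) * (F (shiftH ρ (w, t) q) : ℂ))
      ((volume : Measure ℝ).prod (avgMeasure n)) := by
    refine ((integrable_indicator_Icc_const S M).comp_fst (avgMeasure n)).mono'
      (Continuous.aestronglyMeasurable ?_) ?_
    · unfold Function.uncurry
      fun_prop
    · filter_upwards [Measure.quasiMeasurePreserving_snd.ae (ae_avgMeasure n)] with x hx
      exact hbd _ hx _
  have h1 : fLam n (fun x => (avgH n ρ F x : ℂ)) mu w = ∫ t : ℝ, ∫ q,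
      Complex.exp (Complex.I * (mu : ℂ) * (t : ℂ)) *
        (F (shiftH ρ (w, t) q) : ℂ) ∂(avgMeasure n) := by
    unfold fLam avgH
    refine integral_congr_ae (Eventually.of_forall fun t => ?_)
    simp only
    rw [integral_const_mul, integral_complex_ofReal]
  rw [h1, integral_integral_swap hinteg]
  refine integral_congr_ae (Eventually.of_forall fun q => ?_)
  simp only
  rw [fLam, ← integral_const_mul,
    ← integral_add_right_eq_self _ (ρ ^ 2 * q.2 + ρ / 2 * imZW q.1 w)]
  refine integral_congr_ae (Eventually.of_forall fun t => ?_)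
  simp only [shiftH, add_sub_cancel_right]
  rw [twE_eq, ← Complex.exp_add, ← mul_assoc, ← Complex.exp_add, imZW_smul_left]
  congr 2
  push_cast
  ring

/-- `F` acts on the Laguerre function by the scalar `R`. -/
def IsEig (n k : ℕ) (mu : ℝ) (F : Cn n × ℝ → ℝ) (R : ℂ) : Prop :=
  ∀ z : Cn n, twConv n mu (fLam n (fun x => (F x : ℂ)) mu) (fun w => (lagFun n k mu w : ℂ)) z =
    R * (lagFun n k mu z : ℂ)

lemma integral_bump_smul {ρ : ℝ} (hρ : 0 < ρ) (H : Cn n → ℂ) :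
    ∫ Z : Cn n, (bump (‖Z‖ ^ 2) : ℂ) * H (ρ • Z) =
      |(ρ ^ Module.finrank ℝ (Cn n))⁻¹| • ∫ U : Cn n, (bump (‖U‖ ^ 2 / ρ ^ 2) : ℂ) * H U := by
  rw [← Measure.integral_comp_smul volume (fun U : Cn n => (bump (‖U‖ ^ 2 / ρ ^ 2) : ℂ) * H U) ρ]
  refine integral_congr_ae (Eventually.of_forall fun Z => ?_)
  simp only
  rw [norm_smul, Real.norm_eq_abs, mul_pow, sq_abs, mul_div_cancel_left₀ _ (by positivity)]

lemma integral_bump_twE_lagFun (hn : 1 ≤ n) {mu ρ : ℝ} (hmu : mu ≠ 0) (hρ : 0 < ρ) (k : ℕ)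
    (z : Cn n) :
    ((k + n - 1).choose k : ℂ) *
      ∫ Z : Cn n, (bump (‖Z‖ ^ 2) : ℂ) * (twE mu (ρ • Z) z * (lagFun n k mu (z - ρ • Z) : ℂ)) =
      ((∫ Z : Cn n, bump (‖Z‖ ^ 2) * lagFun n k (ρ ^ 2 * mu) Z : ℝ) : ℂ) *
        (lagFun n k mu z : ℂ) := by
  have hE := (isLagEigen_of_support (n := n) hn hmu k (G := fun x => bump (x / ρ ^ 2))
    (by fun_prop) (M := ρ ^ 2) (fun x hx => bump_of_ge (by
      rwa [le_div_iff₀ (by positivity), one_mul]))).2.2 z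
  have h0 : lagFun n k mu (0 : Cn n) = (k + n - 1).choose k := by
    rw [lagFun_eq_lagR, norm_zero, zero_pow two_ne_zero, lagR_zero]
  rw [h0] at hE
  have h1 : ∫ Z : Cn n, (bump (‖Z‖ ^ 2) : ℂ) * (lagFun n k mu (ρ • Z) : ℂ) =
      ((∫ Z : Cn n, bump (‖Z‖ ^ 2) * lagFun n k (ρ ^ 2 * mu) Z : ℝ) : ℂ) := by
    refine Eq.trans ?_ integral_complex_ofReal
    refine integral_congr_ae (Eventually.of_forall fun Z => ?_)
    simp only [lagFun, norm_smul, Real.norm_eq_abs, mul_pow, sq_abs, abs_mul, abs_pow]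
    push_cast
    ring_nf
  rw [← h1, integral_bump_smul hρ (fun U => (lagFun n k mu U : ℂ)),
    integral_bump_smul hρ (fun U => twE mu U z * (lagFun n k mu (z - U) : ℂ)), mul_smul_comm,
    smul_mul_assoc, ← hE, twConv_comm (n := n) mu, twConv_eq]
  congr 2
  refine integral_congr_ae (Eventually.of_forall fun U => ?_)
  simp only
  have e : twE mu U z = twE (-mu) z U := by
    rw [twE_eq, twE_eq, imZW_comm]
    congr 3
    ring
  rw [e]
  ring

lemma integral_avg_lagFun (hn : 1 ≤ n) {mu ρ : ℝ} (hmu : mu ≠ 0) (hρ : 0 < ρ) (k : ℕ) (z : Cn n) :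
    ∫ q, Complex.exp (Complex.I * mu * ((ρ ^ 2 * q.2 : ℝ) : ℂ)) * twE mu (ρ • q.1) z *
        (lagFun n k mu (z - ρ • q.1) : ℂ) ∂(avgMeasure n) =
      bumpEig n k (ρ ^ 2 * mu) * (lagFun n k mu z : ℂ) := by
  have hc : ((k + n - 1).choose k : ℂ) ≠ 0 := by exact_mod_cast (Nat.choose_pos (by omega)).ne'
  have h1 := integral_bump_twE_lagFun hn hmu hρ k z
  rw [mul_comm, ← eq_div_iff hc] at h1
  have h2 : ∀ q : Cn n × ℝ, Complex.exp (Complex.I * mu * ((ρ ^ 2 * q.2 : ℝ) : ℂ)) *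
      twE mu (ρ • q.1) z * (lagFun n k mu (z - ρ • q.1) : ℂ) =
      (twE mu (ρ • q.1) z * (lagFun n k mu (z - ρ • q.1) : ℂ)) *
        Complex.exp (Complex.I * ((ρ ^ 2 * mu : ℝ) : ℂ) * q.2) := by
    intro q
    rw [mul_assoc, mul_comm]
    congr 2
    push_cast
    ring
  simp only [h2]
  unfold avgMeasure
  rw [integral_prod_mul (fun Z : Cn n => twE mu (ρ • Z) z * (lagFun n k mu (z - ρ • Z) : ℂ))
    (fun t : ℝ => Complex.exp (Complex.I * ((ρ ^ 2 * mu : ℝ) : ℂ) * t)),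
    integral_withDensity_eq_integral_toReal_smul (by fun_prop)
      (Eventually.of_forall fun _ => ENNReal.ofReal_lt_top), bumpEig,
    intervalIntegral.integral_of_le zero_le_one]
  have h3 : ∀ Z : Cn n, (ENNReal.ofReal ((∫ w : Cn n, bump (‖w‖ ^ 2))⁻¹ * bump (‖Z‖ ^ 2))).toReal •
      (twE mu (ρ • Z) z * (lagFun n k mu (z - ρ • Z) : ℂ)) =
      (((∫ w : Cn n, bump (‖w‖ ^ 2))⁻¹ : ℝ) : ℂ) * ((bump (‖Z‖ ^ 2) : ℂ) *
        (twE mu (ρ • Z) z * (lagFun n k mu (z - ρ • Z) : ℂ))) := by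
    intro Z
    rw [ENNReal.toReal_ofReal (mul_nonneg (inv_nonneg.2 (integral_bump_pos n).le) (bump_nonneg _)),
      Complex.real_smul]
    push_cast
    ring
  simp only [h3]
  rw [integral_const_mul, h1]
  push_cast
  ring

lemma IsEig.avg (hn : 1 ≤ n) {τ M mu ρ : ℝ} {F : Cn n × ℝ → ℝ} (hF : BoxFun τ M F) (hmu : mu ≠ 0)
    (hρ : 0 < ρ) {k : ℕ} {R : ℂ} (h : IsEig n k mu F R) :
    IsEig n k mu (avgH n ρ F) (R * bumpEig n k (ρ ^ 2 * mu)) := by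
  intro z
  have hc := hF.continuous_fLam mu
  set S := ∫ t, (Set.Icc (-(2 * τ)) (2 * τ)).indicator (fun _ : ℝ => M) t with hS
  have hinteg : Integrable (Function.uncurry fun (w : Cn n) (q : Cn n × ℝ) =>
      Complex.exp (Complex.I * mu * ((ρ ^ 2 * q.2 : ℝ) : ℂ)) * twE mu (ρ • q.1) (z - w) *
        fLam n (fun x => (F x : ℂ)) mu (z - w - ρ • q.1) * (lagFun n k mu w : ℂ) * twE mu z w)
      ((volume : Measure (Cn n)).prod (avgMeasure n)) := by
    refine (((integrable_lagFun (n := n) hn k hmu).norm.const_mul S).comp_fst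
      (avgMeasure n)).mono' (Continuous.aestronglyMeasurable ?_) (Eventually.of_forall fun x => ?_)
    · unfold Function.uncurry
      fun_prop
    · simp only [Function.uncurry]
      rw [norm_mul, norm_mul, norm_mul, norm_mul, norm_exp_I_mul, norm_twE, norm_twE, one_mul,
        one_mul, mul_one, Complex.norm_real]
      exact mul_le_mul_of_nonneg_right (hF.norm_fLam_le mu _) (norm_nonneg _)
  calc _ = ∫ w : Cn n, ∫ q, Complex.exp (Complex.I * mu * ((ρ ^ 2 * q.2 : ℝ) : ℂ)) *
        twE mu (ρ • q.1) (z - w) * fLam n (fun x => (F x : ℂ)) mu (z - w - ρ • q.1) *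
        (lagFun n k mu w : ℂ) * twE mu z w ∂(avgMeasure n) := by
        rw [twConv_eq]
        refine integral_congr_ae (Eventually.of_forall fun w => ?_)
        simp only
        rw [hF.fLam_avg hρ.le, ← integral_mul_const, ← integral_mul_const]
    _ = ∫ q, R * (Complex.exp (Complex.I * mu * ((ρ ^ 2 * q.2 : ℝ) : ℂ)) * twE mu (ρ • q.1) z *
        (lagFun n k mu (z - ρ • q.1) : ℂ)) ∂(avgMeasure n) := by
        rw [integral_integral_swap hinteg]
        refine integral_congr_ae (Eventually.of_forall fun q => ?_)
        simp only
        rw [mul_left_comm, ← h, twConv_eq, ← integral_const_mul]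
        refine integral_congr_ae (Eventually.of_forall fun w => ?_)
        simp only
        have e : twE mu (ρ • q.1) (z - w) * twE mu z w =
            twE mu (ρ • q.1) z * twE mu (z - ρ • q.1) w := by
          simp only [twE_eq, ← Complex.exp_add, imZW_sub_left, imZW_sub_right]
          congr 1
          push_cast
          ring
        rw [sub_right_comm z w]
        linear_combination (Complex.exp (Complex.I * mu * ((ρ ^ 2 * q.2 : ℝ) : ℂ)) *
          fLam n (fun x => (F x : ℂ)) mu (z - ρ • q.1 - w) * (lagFun n k mu w : ℂ)) * e
    _ = _ := by rw [integral_const_mul, integral_avg_lagFun hn hmu hρ]; ring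

end AveragingEigen

section IteratedAveraging

variable {n : ℕ}

/-- Iterated averages of `F` over the dilates by `ρ 0, …, ρ (N - 1)`. -/
def iterAvg (n : ℕ) (ρ : ℕ → ℝ) : ℕ → (Cn n × ℝ → ℝ) → Cn n × ℝ → ℝ
  | 0, F => F
  | N + 1, F => iterAvg n ρ N (avgH n (ρ N) F)

lemma iterAvg_nonneg (ρ : ℕ → ℝ) (N : ℕ) {F : Cn n × ℝ → ℝ} (hF : ∀ x, 0 ≤ F x)
    (x : Cn n × ℝ) : 0 ≤ iterAvg n ρ N F x := by
  induction N generalizing F with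
  | zero => exact hF x
  | succ N ih => exact ih (avgH_nonneg hF _)

lemma abs_iterAvg_sub_le (ρ : ℕ → ℝ) (N : ℕ) {F G : Cn n × ℝ → ℝ} (hF : NiceH F) (hG : NiceH G)
    {δ : ℝ} (h : ∀ x, |F x - G x| ≤ δ) (x : Cn n × ℝ) :
    |iterAvg n ρ N F x - iterAvg n ρ N G x| ≤ δ := by
  induction N generalizing F G with
  | zero => exact h x
  | succ N ih => exact ih (hF.avg _) (hG.avg _) (abs_avgH_sub_le hF hG h _)

lemma iterAvg_boxFun {ρ : ℕ → ℝ} (hρ : ∀ i, 0 ≤ ρ i) (N : ℕ) {τ M : ℝ} {F : Cn n × ℝ → ℝ}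
    (hτ : 0 ≤ τ) (h1 : τ + ∑ i ∈ Finset.range N, ρ i ≤ 1) (hF : BoxFun τ M F) :
    BoxFun (τ + ∑ i ∈ Finset.range N, ρ i) M (iterAvg n ρ N F) := by
  induction N generalizing F τ with
  | zero => simpa [iterAvg] using hF
  | succ N ih =>
    rw [Finset.sum_range_succ, add_comm (∑ i ∈ Finset.range N, ρ i), ← add_assoc] at h1 ⊢
    have h0 : 0 ≤ ∑ i ∈ Finset.range N, ρ i := Finset.sum_nonneg fun i _ => hρ i
    exact ih (add_nonneg hτ (hρ N)) h1 (hF.avg (hρ N) hτ (by linarith))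

lemma IsEig.iterAvg (hn : 1 ≤ n) {ρ : ℕ → ℝ} (hρ : ∀ i, 0 < ρ i) {k : ℕ} {mu : ℝ} (hmu : mu ≠ 0)
    (N : ℕ) {τ M : ℝ} {F : Cn n × ℝ → ℝ} (hτ : 0 ≤ τ)
    (h1 : τ + ∑ i ∈ Finset.range N, ρ i ≤ 1) (hF : BoxFun τ M F) {R : ℂ}
    (h : IsEig n k mu F R) :
    IsEig n k mu (iterAvg n ρ N F)
      (R * ∏ i ∈ Finset.range N, bumpEig n k ((ρ i) ^ 2 * mu)) := by
  induction N generalizing F τ R with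
  | zero => simpa [_root_.iterAvg] using h
  | succ N ih =>
    rw [Finset.sum_range_succ, add_comm (∑ i ∈ Finset.range N, ρ i), ← add_assoc] at h1
    have h0 : 0 ≤ ∑ i ∈ Finset.range N, ρ i := Finset.sum_nonneg fun i _ => (hρ i).le
    have := ih (add_nonneg hτ (hρ N).le) h1 (hF.avg (hρ N).le hτ (by linarith))
      (h.avg hn hF hmu (hρ N))
    rw [Finset.prod_range_succ, mul_comm (∏ i ∈ Finset.range N, _), ← mul_assoc]
    exact this

/-- The tent function on the Heisenberg group. -/
def tentH (n : ℕ) (a : ℝ) (x : Cn n × ℝ) : ℝ :=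
  max 0 (1 - Real.sqrt (‖x.1‖ ^ 2) / a) * max 0 (1 - |x.2| / a)

lemma tent_le_one (u : ℝ) (hu : 0 ≤ u) : max 0 (1 - u) ≤ 1 :=
  max_le zero_le_one (by linarith)

lemma abs_tent_sub_le (u v : ℝ) : |max 0 (1 - u) - max 0 (1 - v)| ≤ |u - v| := by
  refine (abs_max_sub_max_le_max _ _ _ _).trans ?_
  rw [sub_self, abs_zero, max_eq_right (abs_nonneg _), show 1 - u - (1 - v) = -(u - v) by ring,
    abs_neg]

lemma tentH_nonneg (a : ℝ) (x : Cn n × ℝ) : 0 ≤ tentH n a x :=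
  mul_nonneg (le_max_left _ _) (le_max_left _ _)

lemma tentH_zero (a : ℝ) : tentH n a 0 = 1 := by simp [tentH]

lemma tentH_boxFun {a : ℝ} (ha : 0 < a) : BoxFun a 1 (tentH n a) := by
  refine ⟨by unfold tentH; fun_prop, fun x => ?_, fun x hx => ?_⟩
  · rw [abs_of_nonneg (tentH_nonneg a x)]
    exact mul_le_one₀ (tent_le_one _ (by positivity)) (le_max_left _ _)
      (tent_le_one _ (by positivity))
  · unfold tentH at hx
    obtain ⟨h1, h2⟩ := mul_ne_zero_iff.1 hx
    constructor
    · by_contra hc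
      push Not at hc
      refine h1 (max_eq_left ?_)
      rw [Real.sqrt_sq (norm_nonneg _), sub_nonpos, le_div_iff₀ ha]
      linarith
    · by_contra hc
      push Not at hc
      refine h2 (max_eq_left ?_)
      rw [sub_nonpos, le_div_iff₀ ha]
      linarith

lemma abs_avgH_tentH_sub_le {a ρ : ℝ} (ha : 0 < a) (ha1 : a ≤ 1) (hρ : 0 ≤ ρ) (hρ1 : ρ ≤ 1)
    (x : Cn n × ℝ) : |avgH n ρ (tentH n a) x - tentH n a x| ≤ 3 / a * ρ := by
  have hB := tentH_boxFun (n := n) ha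
  have h : ∀ᵐ q ∂(avgMeasure n), ‖tentH n a (shiftH ρ x q) - tentH n a x‖ ≤ 3 / a * ρ := by
    filter_upwards [ae_avgMeasure n] with q hq
    rw [Real.norm_eq_abs]
    have hq1 : ‖ρ • q.1‖ ≤ ρ := by
      rw [norm_smul, Real.norm_eq_abs, abs_of_nonneg hρ]
      exact mul_le_of_le_one_right hρ hq.1
    rcases le_or_gt ‖x.1‖ 2 with hx | hx
    · have e1 := abs_tent_sub_le (‖x.1 - ρ • q.1‖ / a) (‖x.1‖ / a)
      have e2 := abs_tent_sub_le (|x.2 - (ρ ^ 2 * q.2 + ρ / 2 * imZW q.1 x.1)| / a) (|x.2| / a)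
      rw [← sub_div, abs_div, abs_of_pos ha] at e1 e2
      have e3 : |‖x.1 - ρ • q.1‖ - ‖x.1‖| ≤ ρ := by
        refine (abs_norm_sub_norm_le _ _).trans ?_
        rwa [sub_sub_cancel_left, norm_neg]
      have e4 : |(|x.2 - (ρ ^ 2 * q.2 + ρ / 2 * imZW q.1 x.1)| - |x.2|)| ≤ 2 * ρ := by
        refine (abs_abs_sub_abs_le _ _).trans ?_
        rw [sub_sub_cancel_left, abs_neg]
        refine (abs_add_le _ _).trans ?_
        have h1 : |ρ ^ 2 * q.2| ≤ ρ := by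
          rw [abs_of_nonneg (mul_nonneg (sq_nonneg _) hq.2.1)]
          nlinarith [mul_le_of_le_one_right (sq_nonneg ρ) hq.2.2]
        have h2 : |ρ / 2 * imZW q.1 x.1| ≤ ρ / 2 * 2 := by
          rw [abs_mul, abs_of_nonneg (by positivity)]
          gcongr
          exact (abs_imZW_le _ _).trans ((mul_le_of_le_one_left (norm_nonneg _) hq.1).trans hx)
        linarith
      have key : ∀ p q r s : ℝ, |q| ≤ 1 → |r| ≤ 1 → |p * q - r * s| ≤ |p - r| + |q - s| := by
        intro p q r s hq hr
        rw [show p * q - r * s = (p - r) * q + r * (q - s) by ring]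
        refine (abs_add_le _ _).trans ?_
        rw [abs_mul, abs_mul]
        exact add_le_add (mul_le_of_le_one_right (abs_nonneg _) hq)
          (mul_le_of_le_one_left (abs_nonneg _) hr)
      have hab : ∀ u : ℝ, 0 ≤ u → |max 0 (1 - u)| ≤ 1 := fun u hu => by
        rw [abs_of_nonneg (le_max_left _ _)]
        exact tent_le_one u hu
      simp only [tentH, shiftH, Real.sqrt_sq (norm_nonneg _)]
      refine (key _ _ _ _ (hab _ (by positivity)) (hab _ (by positivity))).trans ?_
      calc _ ≤ ρ / a + 2 * ρ / a := add_le_add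
              (e1.trans (div_le_div_of_nonneg_right e3 ha.le))
              (e2.trans (div_le_div_of_nonneg_right e4 ha.le))
        _ = _ := by ring
    · have z1 : tentH n a x = 0 := by
        by_contra hc
        have := (hB.supp x hc).1
        linarith
      have z2 : tentH n a (shiftH ρ x q) = 0 := by
        by_contra hc
        have h3 := (hB.supp _ hc).1
        simp only [shiftH] at h3
        have := norm_sub_norm_le x.1 (ρ • q.1)
        linarith
      rw [z1, z2, sub_zero, abs_zero]
      positivity
  have := norm_integral_le_of_norm_le_const h
  rw [integral_sub (hB.niceH.integrable_shift ρ x) (integrable_const _)] at this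
  simpa [avgH] using this

lemma exists_isEig_tentH (hn : 1 ≤ n) {a : ℝ} (ha : 0 < a) : ∃ C : ℝ, 0 ≤ C ∧
    ∀ (k : ℕ) (mu : ℝ), mu ≠ 0 → ∃ R : ℂ, ‖R‖ ≤ C ∧ IsEig n k mu (tentH n a) R := by
  set G : ℝ → ℝ := fun x => max 0 (1 - Real.sqrt x / a) with hG
  have hGc : Continuous G := by fun_prop
  have hGs : ∀ x, a ^ 2 ≤ x → G x = 0 := fun x hx => by
    refine max_eq_left ?_
    rw [sub_nonpos, le_div_iff₀ ha, one_mul]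
    exact Real.le_sqrt_of_sq_le hx
  have hGi : Integrable fun w : Cn n => G (‖w‖ ^ 2) := by
    refine Continuous.integrable_of_hasCompactSupport (by fun_prop)
      (HasCompactSupport.intro (isCompact_closedBall (0 : Cn n) a) fun w hw => hGs _ ?_)
    rw [mem_closedBall_zero_iff, not_le] at hw
    gcongr
  refine ⟨‖∫ t : ℝ, |max 0 (1 - |t| / a)|‖ * ∫ w : Cn n, G (‖w‖ ^ 2),
    mul_nonneg (norm_nonneg _) (integral_nonneg fun _ => le_max_left _ _), fun k mu hmu => ?_⟩
  have hc : 0 < ((k + n - 1).choose k : ℝ) := by exact_mod_cast Nat.choose_pos (by omega)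
  have hcc : ((k + n - 1).choose k : ℂ) ≠ 0 := by exact_mod_cast hc.ne'
  have hE := (isLagEigen_of_support (n := n) hn hmu k hGc hGs).2.2
  have h0 : lagFun n k mu (0 : Cn n) = (k + n - 1).choose k := by
    rw [lagFun_eq_lagR, norm_zero, zero_pow two_ne_zero, lagR_zero]
  rw [h0] at hE
  set T : ℂ := ∫ t : ℝ, Complex.exp (Complex.I * mu * t) * (max 0 (1 - |t| / a) : ℝ) with hT
  refine ⟨T * ((∫ w : Cn n, (G (‖w‖ ^ 2) : ℂ) * (lagFun n k mu w : ℂ)) /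
    ((k + n - 1).choose k : ℂ)), ?_, fun z => ?_⟩
  · rw [norm_mul]
    refine mul_le_mul ?_ ?_ (norm_nonneg _) (norm_nonneg _)
    · refine (norm_integral_le_integral_norm _).trans ((le_of_eq ?_).trans (le_abs_self _))
      refine integral_congr_ae (Eventually.of_forall fun t => ?_)
      simp only
      rw [norm_mul, norm_exp_I_mul, one_mul, Complex.norm_real, Real.norm_eq_abs]
    · rw [norm_div, Complex.norm_natCast, div_le_iff₀ hc, ← integral_mul_const]
      refine norm_integral_le_of_norm_le (hGi.mul_const _) (Eventually.of_forall fun w => ?_)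
      rw [norm_mul, Complex.norm_real, Complex.norm_real, Real.norm_eq_abs,
        abs_of_nonneg (le_max_left _ _)]
      exact mul_le_mul_of_nonneg_left (abs_lagFun_le hn hmu k w) (le_max_left _ _)
  · have e : fLam n (fun x => (tentH n a x : ℂ)) mu = fun w => T * (G (‖w‖ ^ 2) : ℂ) := by
      ext w
      rw [hT, ← integral_mul_const, fLam]
      refine integral_congr_ae (Eventually.of_forall fun t => ?_)
      simp only [tentH, hG]
      push_cast
      ring
    have e2 : twConv n mu (fun w => T * (G (‖w‖ ^ 2) : ℂ)) (fun w => (lagFun n k mu w : ℂ)) z =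
        T * twConv n mu (fun w => (G (‖w‖ ^ 2) : ℂ)) (fun w => (lagFun n k mu w : ℂ)) z := by
      rw [twConv_eq, twConv_eq, ← integral_const_mul]
      simp only [mul_assoc]
    rw [e, e2, mul_assoc]
    congr 1
    rw [div_mul_eq_mul_div, eq_div_iff hcc, ← hE z, mul_comm]
    push_cast
    rfl

end IteratedAveraging

section LimitFunction

variable {n : ℕ}

lemma tendsto_twConv_fLam (hn : 1 ≤ n) {τ M mu : ℝ} (hmu : mu ≠ 0) (k : ℕ)
    {F : ℕ → Cn n × ℝ → ℝ} {f : Cn n × ℝ → ℝ} (hF : ∀ N, BoxFun τ M (F N))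
    (hl : ∀ x, Tendsto (fun N => F N x) atTop (nhds (f x))) (z : Cn n) :
    Tendsto (fun N => twConv n mu (fLam n (fun x => (F N x : ℂ)) mu)
      (fun w => (lagFun n k mu w : ℂ)) z) atTop
      (nhds (twConv n mu (fLam n (fun x => (f x : ℂ)) mu) (fun w => (lagFun n k mu w : ℂ)) z)) := by
  have h1 : ∀ w : Cn n, Tendsto (fun N => fLam n (fun x => (F N x : ℂ)) mu w) atTop
      (nhds (fLam n (fun x => (f x : ℂ)) mu w)) := by
    intro w
    unfold fLam
    refine tendsto_integral_of_dominated_convergence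
      ((Set.Icc (-(2 * τ)) (2 * τ)).indicator (fun _ : ℝ => M)) (fun N => ?_)
      (integrable_indicator_Icc_const _ _) (fun N => Eventually.of_forall fun t => ?_)
      (Eventually.of_forall fun t => ?_)
    · have := (hF N).cont
      exact Continuous.aestronglyMeasurable (by fun_prop)
    · rw [norm_mul, norm_exp_I_mul, one_mul, Complex.norm_real, Real.norm_eq_abs]
      simpa using (hF N).abs_le_indicator w t 0 (S := 2 * τ) (by simp)
    · exact ((Complex.continuous_ofReal.tendsto _).comp (hl (w, t))).const_mul _
  simp only [twConv_eq]
  refine tendsto_integral_of_dominated_convergence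
    (fun w => (∫ t, (Set.Icc (-(2 * τ)) (2 * τ)).indicator (fun _ : ℝ => M) t) * ‖lagFun n k mu w‖)
    (fun N => ?_) ((integrable_lagFun hn k hmu).norm.const_mul _)
    (fun N => Eventually.of_forall fun w => ?_) (Eventually.of_forall fun w => ?_)
  · have := (hF N).continuous_fLam mu
    exact Continuous.aestronglyMeasurable (by fun_prop)
  · rw [norm_mul, norm_mul, norm_twE, mul_one, Complex.norm_real]
    exact mul_le_mul_of_nonneg_right ((hF N).norm_fLam_le mu _) (norm_nonneg _)
  · exact ((h1 _).mul_const _).mul_const _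

lemma IsEig.of_tendsto (hn : 1 ≤ n) {τ M mu : ℝ} (hmu : mu ≠ 0) {k : ℕ}
    {F : ℕ → Cn n × ℝ → ℝ} {f : Cn n × ℝ → ℝ} (hF : ∀ N, BoxFun τ M (F N))
    (hl : ∀ x, Tendsto (fun N => F N x) atTop (nhds (f x))) {R : ℕ → ℂ}
    (hR : ∀ N, IsEig n k mu (F N) (R N)) :
    ∃ r : ℂ, IsEig n k mu f r ∧ Tendsto R atTop (nhds r) := by
  have h0 : (lagFun n k mu (0 : Cn n) : ℂ) ≠ 0 := by
    rw [lagFun_eq_lagR, norm_zero, zero_pow two_ne_zero]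
    exact_mod_cast (lagR_zero_pos hn k |mu|).ne'
  have h1 := tendsto_twConv_fLam hn hmu k hF hl
  have h2 : Tendsto R atTop (nhds (twConv n mu (fLam n (fun x => (f x : ℂ)) mu)
      (fun w => (lagFun n k mu w : ℂ)) 0 / (lagFun n k mu (0 : Cn n) : ℂ))) := by
    refine ((h1 0).div_const _).congr fun N => ?_
    rw [hR N 0, mul_div_cancel_right₀ _ h0]
  refine ⟨_, fun z => ?_, h2⟩
  exact tendsto_nhds_unique ((h1 z).congr fun N => hR N z) (h2.mul_const _)

lemma exists_limit_boxFun (hn : 1 ≤ n) {a : ℝ} (ha : 0 < a) {ρ : ℕ → ℝ} (hρ : ∀ i, 0 < ρ i)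
    (hs : Summable ρ) (h1 : a + ∑' i, ρ i ≤ 1) (h2 : 3 / a * ∑' i, ρ i < 1) :
    ∃ f : Cn n × ℝ → ℝ, BoxFun (a + ∑' i, ρ i) 1 f ∧ (∀ x, 0 ≤ f x) ∧ 0 < f 0 ∧
      ∃ C : ℝ, 0 ≤ C ∧ ∀ (k : ℕ) (mu : ℝ), mu ≠ 0 → ∃ R : ℂ, IsEig n k mu f R ∧
        ∀ N, ‖R‖ ≤ C * ∏ i ∈ Finset.range N, ‖bumpEig n k ((ρ i) ^ 2 * mu)‖ := by
  have hle : ∀ N, ∑ i ∈ Finset.range N, ρ i ≤ ∑' i, ρ i := fun N =>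
    hs.sum_le_tsum _ fun i _ => (hρ i).le
  have hT0 : 0 ≤ ∑' i, ρ i := tsum_nonneg fun i => (hρ i).le
  have hρ1 : ∀ i, ρ i ≤ 1 := fun i => (hs.le_tsum i fun j _ => (hρ j).le).trans (by linarith)
  have ha1 : a ≤ 1 := by linarith
  have hB := tentH_boxFun (n := n) ha
  set F : ℕ → Cn n × ℝ → ℝ := fun N => iterAvg n ρ N (tentH n a) with hFdef
  have hFB : ∀ N, BoxFun (a + ∑' i, ρ i) 1 (F N) := by
    intro N
    have h := iterAvg_boxFun (n := n) (fun i => (hρ i).le) N ha.le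
      ((add_le_add_right (hle N) _).trans h1) hB
    refine ⟨h.cont, h.bound, fun x hx => ?_⟩
    have := h.supp x hx
    have := hle N
    constructor <;> linarith
  have hd : ∀ N x, ‖F (N + 1) x - F N x‖ ≤ 3 / a * ρ N := fun N x =>
    abs_iterAvg_sub_le ρ N (hB.niceH.avg _) hB.niceH
      (abs_avgH_tentH_sub_le ha ha1 (hρ N).le (hρ1 N)) x
  have hsu : Summable fun N => 3 / a * ρ N := hs.mul_left _
  have hu := tendstoUniformly_tsum_nat hsu hd
  set f : Cn n × ℝ → ℝ := fun x => F 0 x + ∑' N, (F (N + 1) x - F N x) with hf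
  have hl : ∀ x, Tendsto (fun N => F N x) atTop (nhds (f x)) := by
    intro x
    refine ((hu.tendsto_at x).const_add (F 0 x)).congr fun N => ?_
    rw [Finset.sum_range_sub (fun i => F i x)]
    ring
  have hfB : BoxFun (a + ∑' i, ρ i) 1 f := by
    refine ⟨(hFB 0).cont.add (continuous_tsum (fun N => (hFB (N + 1)).cont.sub (hFB N).cont)
      hsu hd), fun x => ?_, fun x hx => ?_⟩
    · exact le_of_tendsto (hl x).abs (Eventually.of_forall fun N => (hFB N).bound x)
    · by_contra hc
      refine hx (tendsto_nhds_unique (hl x) ?_)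
      refine tendsto_const_nhds.congr fun N => ?_
      by_contra hne
      exact hc ((hFB N).supp x (Ne.symm hne))
  have hf0 : 0 < f 0 := by
    have h3 : ‖∑' N, (F (N + 1) 0 - F N 0)‖ ≤ 3 / a * ∑' i, ρ i := by
      rw [← tsum_mul_left]
      exact tsum_of_norm_bounded hsu.hasSum fun N => hd N 0
    have h4 := (abs_le.1 h3).1
    have h5 : F 0 0 = 1 := tentH_zero a
    simp only [hf, h5]
    linarith
  refine ⟨f, hfB, fun x => ge_of_tendsto (hl x) (Eventually.of_forall fun N =>
    iterAvg_nonneg ρ N (tentH_nonneg a) x), hf0, ?_⟩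
  obtain ⟨C, hC0, hC⟩ := exists_isEig_tentH (n := n) hn ha
  refine ⟨C, hC0, fun k mu hmu => ?_⟩
  obtain ⟨R0, hR0, hE⟩ := hC k mu hmu
  have hEN : ∀ N, IsEig n k mu (F N)
      (R0 * ∏ i ∈ Finset.range N, bumpEig n k ((ρ i) ^ 2 * mu)) := fun N =>
    hE.iterAvg hn hρ hmu N ha.le ((add_le_add_right (hle N) _).trans h1) hB
  obtain ⟨r, hr, hrl⟩ := IsEig.of_tendsto hn hmu hFB hl hEN
  refine ⟨r, hr, fun N => ?_⟩
  refine le_of_tendsto hrl.norm ((eventually_ge_atTop N).mono fun N' hN => ?_)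
  rw [norm_mul, norm_prod]
  refine mul_le_mul hR0 ?_ (Finset.prod_nonneg fun _ _ => norm_nonneg _) hC0
  exact Finset.prod_le_prod_of_subset_of_le_one (Finset.range_subset_range.2 hN)
    (fun i _ => norm_nonneg _)
    (fun i _ _ => norm_bumpEig_le_one hn k (mul_ne_zero (pow_ne_zero 2 (hρ i).ne') hmu))

end LimitFunction

section DecayingEigenvalues

variable {n : ℕ}

lemma BoxFun.mono {τ τ' M : ℝ} {F : Cn n × ℝ → ℝ} (hF : BoxFun τ M F) (h : τ ≤ τ') :
    BoxFun τ' M F :=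
  ⟨hF.cont, hF.bound, fun x hx => ⟨(hF.supp x hx).1.trans h, (hF.supp x hx).2.trans (by linarith)⟩⟩

theorem exists_boxFun_decay (hn : 1 ≤ n) {Θ : ℝ → ℝ} (hpos : ∀ t, 0 ≤ t → 0 < Θ t)
    (hdec : AntitoneOn Θ (Set.Ici 0)) (hlim : Tendsto Θ atTop (nhds 0))
    (hsum : Summable fun j : ℕ => Θ (j + 1) / (j + 1)) {ε : ℝ} (hε : 0 < ε) (hε1 : ε ≤ 1) :
    ∃ f : Cn n × ℝ → ℝ, BoxFun ε 1 f ∧ (∀ x, 0 ≤ f x) ∧ 0 < f 0 ∧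
      ∃ C : ℝ, 0 ≤ C ∧ ∀ (k : ℕ) (mu : ℝ), mu ≠ 0 → ∃ R : ℂ, IsEig n k mu f R ∧
        ‖R‖ ≤ C * Real.exp (-(Real.sqrt ((2 * k + n) * |mu|) *
          Θ (Real.sqrt ((2 * k + n) * |mu|)))) := by
  obtain ⟨Cb, hCb0, hCb⟩ := exists_bumpEig_decay (n := n) hn
  set K := Real.exp 1 * Cb with hK
  have hK0 : 0 < K := by positivity
  have htail := (tendsto_sum_nat_add fun j : ℕ => K * (Θ (j + 1) / (j + 1))).eventually_lt_const
    (show (0 : ℝ) < ε / 6 by positivity)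
  obtain ⟨J, hJ⟩ := htail.exists
  set ρ : ℕ → ℝ := fun i => K * (Θ ((i + J : ℕ) + 1) / ((i + J : ℕ) + 1)) with hρdef
  have hρ : ∀ i, 0 < ρ i := fun i =>
    mul_pos hK0 (div_pos (hpos _ (by positivity)) (by positivity))
  have hs : Summable ρ := (summable_nat_add_iff J).2 (hsum.mul_left K)
  have hJ' : ∑' i, ρ i < ε / 6 := hJ
  obtain ⟨f, hf, hf0, hf1, C, hC0, hC⟩ := exists_limit_boxFun (n := n) hn (a := ε / 2)
    (by positivity) hρ hs (by linarith) (by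
      rw [div_mul_eq_mul_div, div_lt_one (by positivity)]
      linarith)
  refine ⟨f, hf.mono (by linarith), hf0, hf1, ?_⟩
  obtain ⟨y0, hy0⟩ := (hlim.eventually_le_const (zero_lt_one)).exists_forall_of_atTop
  set y1 := max y0 0 with hy1
  refine ⟨C * (Real.exp (y1 * Θ 0) * Real.exp (J + 1)), by positivity, fun k mu hmu => ?_⟩
  obtain ⟨R, hR, hRb⟩ := hC k mu hmu
  refine ⟨R, hR, ?_⟩
  set y := Real.sqrt ((2 * k + n) * |mu|) with hy
  have hypos : 0 < y := Real.sqrt_pos.2 (by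
    have : (0 : ℝ) < n := by exact_mod_cast hn
    have := abs_pos.2 hmu
    positivity)
  have hΘ0 : 0 < Θ 0 := hpos 0 le_rfl
  rw [mul_assoc]
  rcases le_or_gt y1 y with hyy | hyy
  · have hΘ1 : Θ y ≤ 1 := hy0 y ((le_max_left _ _).trans hyy)
    have hΘy : 0 < Θ y := hpos y hypos.le
    set N := ⌊y * Θ y⌋₊ - J with hN
    have hfac : ∀ i ∈ Finset.range N, ‖bumpEig n k ((ρ i) ^ 2 * mu)‖ ≤ Real.exp (-1) := by
      intro i hi
      rw [Finset.mem_range] at hi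
      have hi2 : ((i + J : ℕ) : ℝ) + 1 ≤ y * Θ y := by
        have : i + J + 1 ≤ ⌊y * Θ y⌋₊ := by omega
        have h2 := (Nat.cast_le (α := ℝ)).2 this
        push_cast at h2 ⊢
        exact h2.trans (Nat.floor_le (by positivity))
      have h1 := hCb k ((ρ i) ^ 2 * mu) (mul_ne_zero (pow_ne_zero 2 (hρ i).ne') hmu)
      have h2 : Real.sqrt ((2 * k + n) * |(ρ i) ^ 2 * mu|) = ρ i * y := by
        rw [abs_mul, abs_of_nonneg (sq_nonneg (ρ i)), mul_left_comm,
          Real.sqrt_mul (sq_nonneg _), Real.sqrt_sq (hρ i).le]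
      rw [h2] at h1
      have h3 : Cb * Real.exp 1 ≤ ρ i * y := by
        have h4 : Θ y ≤ Θ ((i + J : ℕ) + 1) := hdec (Set.mem_Ici.2 (by positivity))
          (Set.mem_Ici.2 hypos.le) (hi2.trans (mul_le_of_le_one_right hypos.le hΘ1))
        simp only [hρdef, hK]
        have h5 : 1 ≤ Θ ((i + J : ℕ) + 1) / ((i + J : ℕ) + 1) * y := by
          rw [div_mul_eq_mul_div, one_le_div (by positivity), mul_comm]
          exact hi2.trans (mul_le_mul_of_nonneg_left h4 hypos.le)
        nlinarith [mul_pos (Real.exp_pos 1) hCb0]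
      rw [Real.exp_neg, ← one_div, le_div_iff₀ (Real.exp_pos 1)]
      have h6 :=
        (mul_le_mul_of_nonneg_left h3 (norm_nonneg (bumpEig n k ((ρ i) ^ 2 * mu)))).trans h1
      nlinarith
    refine (hRb N).trans (mul_le_mul_of_nonneg_left ?_ hC0)
    refine (Finset.prod_le_prod (fun _ _ => norm_nonneg _) hfac).trans ?_
    rw [Finset.prod_const, Finset.card_range, ← Real.exp_nat_mul, ← Real.exp_add, ← Real.exp_add,
      Real.exp_le_exp]
    have h7 : y * Θ y - 1 - J ≤ N := by
      have h8 := Nat.lt_floor_add_one (y * Θ y)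
      have h9 : (⌊y * Θ y⌋₊ : ℝ) ≤ N + J := by
        have : ⌊y * Θ y⌋₊ ≤ N + J := by omega
        exact_mod_cast this
      linarith
    have h10 : 0 ≤ y1 * Θ 0 := mul_nonneg (le_max_right _ _) hΘ0.le
    linarith
  · refine (hRb 0).trans (mul_le_mul_of_nonneg_left ?_ hC0)
    rw [Finset.prod_range_zero, ← Real.exp_add, ← Real.exp_add]
    refine Real.one_le_exp ?_
    have h1 : y * Θ y ≤ y1 * Θ 0 := mul_le_mul hyy.le
      (hdec Set.self_mem_Ici hypos.le hypos.le) (hpos y hypos.le).le (le_max_right _ _)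
    have : (0 : ℝ) ≤ J := by positivity
    linarith

end DecayingEigenvalues

section IntegrableProfile

variable {n : ℕ}

lemma antitoneOn_div_self {Θ : ℝ → ℝ} (hpos : ∀ t, 0 ≤ t → 0 ≤ Θ t)
    (hdec : AntitoneOn Θ (Set.Ici 0)) : AntitoneOn (fun t => Θ t / t) (Set.Ici 1) := by
  intro s hs t ht hst
  have hs' : (1 : ℝ) ≤ s := hs
  have h := hdec (Set.mem_Ici.2 (by linarith)) (Set.mem_Ici.2 (by linarith)) hst
  exact div_le_div₀ (hpos s (by linarith)) h (by linarith) hst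

lemma summable_of_integrableOn_div {Θ : ℝ → ℝ} (hpos : ∀ t, 0 ≤ t → 0 ≤ Θ t)
    (hdec : AntitoneOn Θ (Set.Ici 0))
    (hinteg : IntegrableOn (fun t : ℝ => Θ t / t) (Set.Ici 1) (volume : Measure ℝ)) :
    Summable fun j : ℕ => Θ (j + 1) / (j + 1) := by
  rw [← summable_nat_add_iff 1]
  refine summable_of_sum_range_le (c := ∫ t in Set.Ici (1 : ℝ), Θ t / t) (fun j => ?_) fun N => ?_
  · exact div_nonneg (hpos _ (by positivity)) (by positivity)
  · have h1 := AntitoneOn.sum_le_integral (x₀ := 1) (a := N)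
      ((antitoneOn_div_self hpos hdec).mono (fun x hx => hx.1))
    have h2 : ∫ t in (1 : ℝ)..1 + N, Θ t / t ≤ ∫ t in Set.Ici (1 : ℝ), Θ t / t := by
      rw [intervalIntegral.integral_of_le (by simp)]
      refine setIntegral_mono_set hinteg ?_ (Eventually.of_forall fun x hx => hx.1.le)
      refine (ae_restrict_mem measurableSet_Ici).mono fun t ht => ?_
      have ht' : (1 : ℝ) ≤ t := ht
      exact div_nonneg (hpos t (by linarith)) (by linarith)
    refine (le_of_eq ?_).trans (h1.trans h2)
    refine Finset.sum_congr rfl fun i _ => ?_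
    push_cast
    ring_nf

lemma summable_inv_sqrt_div :
    Summable fun j : ℕ => (Real.sqrt (1 + ((j : ℝ) + 1)))⁻¹ / (j + 1) := by
  have h := (summable_nat_add_iff 1).2
    (Real.summable_nat_rpow_inv.2 (show (1 : ℝ) < 3 / 2 by norm_num))
  refine Summable.of_nonneg_of_le (fun j => by positivity) (fun j => ?_) h
  have hj : (0 : ℝ) < (j : ℝ) + 1 := by positivity
  rw [show ((j + 1 : ℕ) : ℝ) = (j : ℝ) + 1 by push_cast; ring,
    show (3 / 2 : ℝ) = 1 / 2 + 1 by norm_num, Real.rpow_add hj, Real.rpow_one, mul_inv,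
    ← Real.sqrt_eq_rpow, div_eq_mul_inv]
  have h1 : Real.sqrt ((j : ℝ) + 1) ≤ Real.sqrt (1 + ((j : ℝ) + 1)) :=
    Real.sqrt_le_sqrt (by linarith)
  have h2 : 0 < Real.sqrt ((j : ℝ) + 1) := Real.sqrt_pos.2 hj
  exact mul_le_mul_of_nonneg_right ((inv_le_inv₀ (h2.trans_le h1) h2).2 h1) (by positivity)

lemma tendsto_inv_sqrt_one_add : Tendsto (fun t : ℝ => (Real.sqrt (1 + t))⁻¹) atTop (nhds 0) :=
  tendsto_inv_atTop_zero.comp (Real.tendsto_sqrt_atTop.comp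
    (tendsto_atTop_add_const_left _ _ tendsto_id))

lemma antitoneOn_inv_sqrt : AntitoneOn (fun t : ℝ => (Real.sqrt (1 + t))⁻¹) (Set.Ici 0) := by
  intro s hs t ht hst
  have : (0 : ℝ) ≤ s := hs
  have h : 0 < Real.sqrt (1 + s) := Real.sqrt_pos.2 (by linarith)
  simp only
  gcongr

lemma BoxFun.hasCompactSupport {τ M : ℝ} {F : Cn n × ℝ → ℝ} (hF : BoxFun τ M F) :
    HasCompactSupport fun x : Hn n => (F x : ℂ) := by
  refine HasCompactSupport.intro ((isCompact_closedBall (0 : Cn n) τ).prod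
    (isCompact_closedBall (0 : ℝ) (2 * τ))) fun x hx => ?_
  by_contra hne
  refine hx ?_
  have := hF.supp x (by simpa using hne)
  simpa [Set.mem_prod] using this

lemma choose_eq_factorial_div (hn : 1 ≤ n) (k : ℕ) : ((k + n - 1).choose k : ℝ) =
    ((k + n - 1).factorial : ℝ) / ((Nat.factorial k) * (Nat.factorial (n - 1))) := by
  rw [Nat.add_sub_assoc hn, Nat.cast_add_choose]

theorem exists_of_integrable (hn : 1 ≤ n) {Θ : ℝ → ℝ} (hpos : ∀ t, 0 ≤ t → 0 ≤ Θ t)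
    (hdec : AntitoneOn Θ (Set.Ici 0)) (hlim : Tendsto Θ atTop (nhds 0))
    (hinteg : IntegrableOn (fun t : ℝ => Θ t / t) (Set.Ici 1) (volume : Measure ℝ)) :
    ∃ f : Hn n → ℂ, Integrable f (volume : Measure (Hn n)) ∧ HasCompactSupport f ∧
        ¬ (f =ᵐ[(volume : Measure (Hn n))] 0) ∧
        ∃ C : ℝ, 0 < C ∧ ∀ lam : ℝ, lam ≠ 0 → ∀ k : ℕ,
          |lam| ^ n * ∫ z : Cn n, ‖stri n f k lam z‖ ^ 2 ≤
            C * (((k + n - 1).factorial : ℝ) /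
                ((Nat.factorial k) * (Nat.factorial (n - 1)))) *
              Real.exp (-(Real.sqrt ((2 * k + n) * |lam|) *
                Θ (Real.sqrt ((2 * k + n) * |lam|)))) := by
  have hq : ∀ t : ℝ, 0 ≤ t → 0 < (Real.sqrt (1 + t))⁻¹ := fun t ht =>
    inv_pos.2 (Real.sqrt_pos.2 (by linarith))
  obtain ⟨F, hF, -, hF0, C, hC0, hC⟩ := exists_boxFun_decay (n := n) hn
    (Θ := fun t => Θ t + (Real.sqrt (1 + t))⁻¹)
    (fun t ht => add_pos_of_nonneg_of_pos (hpos t ht) (hq t ht))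
    (hdec.add antitoneOn_inv_sqrt) (by simpa using hlim.add tendsto_inv_sqrt_one_add)
    (by
      simp only [add_div]
      exact (summable_of_integrableOn_div hpos hdec hinteg).add summable_inv_sqrt_div)
    one_pos le_rfl
  have hcs := hF.hasCompactSupport
  have hcont : Continuous fun x : Hn n => (F x : ℂ) := Complex.continuous_ofReal.comp hF.cont
  refine ⟨fun x => (F x : ℂ), hcont.integrable_of_hasCompactSupport hcs, hcs, fun h => ?_,
    C ^ 2 * (2 * π) ^ n + 1, by positivity, fun lam hlam k => ?_⟩
  · have h1 := (Continuous.ae_eq_iff_eq volume hcont continuous_const).1 h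
    have h2 := congrFun h1 0
    exact hF0.ne' (Complex.ofReal_eq_zero.1 h2)
  · obtain ⟨R, hR, hRb⟩ := hC k (-lam) (neg_ne_zero.2 hlam)
    rw [abs_neg] at hRb
    set y := Real.sqrt ((2 * k + n) * |lam|) with hy
    have hy0 : 0 ≤ y := Real.sqrt_nonneg _
    have e : ∀ z : Cn n, ‖stri n (fun x => (F x : ℂ)) k lam z‖ ^ 2 =
        ‖R‖ ^ 2 * lagFun n k lam z ^ 2 := by
      intro z
      have h1 := hR z
      rw [lagFun_neg_param] at h1
      rw [stri, h1, norm_mul, mul_pow, Complex.norm_real, Real.norm_eq_abs, sq_abs]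
    have hl : 0 < |lam| := abs_pos.2 hlam
    rw [integral_congr_ae (Eventually.of_forall e), integral_const_mul, integral_lagFun_sq hn hlam,
      div_pow, ← choose_eq_factorial_div hn]
    have h2 : ‖R‖ ^ 2 ≤ C ^ 2 * Real.exp (-(y * Θ y)) := by
      have h3 : ‖R‖ ≤ C * Real.exp (-(y * Θ y)) := hRb.trans (by
        gcongr
        have := (hq y hy0).le
        linarith)
      calc ‖R‖ ^ 2 ≤ (C * Real.exp (-(y * Θ y))) ^ 2 := by gcongr
        _ = C ^ 2 * (Real.exp (-(y * Θ y)) * Real.exp (-(y * Θ y))) := by ring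
        _ ≤ C ^ 2 * (Real.exp (-(y * Θ y)) * 1) := by
          gcongr
          rw [Real.exp_le_one_iff, neg_nonpos]
          exact mul_nonneg hy0 (hpos y hy0)
        _ = _ := by ring
    calc _ = (2 * π) ^ n * ((k + n - 1).choose k : ℝ) * ‖R‖ ^ 2 := by field_simp
      _ ≤ (2 * π) ^ n * ((k + n - 1).choose k : ℝ) * (C ^ 2 * Real.exp (-(y * Θ y))) := by gcongr
      _ = C ^ 2 * (2 * π) ^ n * ((k + n - 1).choose k : ℝ) * Real.exp (-(y * Θ y)) := by ring
      _ ≤ _ := by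
        gcongr
        linarith

end IntegrableProfile

section QuasiAnalytic

lemma bang_step {F : ℕ → ℝ → ℂ} (hF : ∀ j x, HasDerivAt (F j) (F (j + 1) x) x) {M ν : ℕ → ℝ}
    (hM0 : ∀ j, 0 < M j) (hM : ∀ j, M (j + 1) = M j * ν j) (hν : ∀ j, 0 < ν j)
    (hmono : Monotone ν) (hb : ∀ j x, ‖F j x‖ ≤ M j) {m : ℕ} {x h : ℝ} (h0 : 0 ≤ h)
    (h1 : h * (Real.exp 1 * ν m) ≤ 1)
    (hx : ∀ j : ℕ, ‖F j x‖ ≤ Real.exp ((j : ℝ) - (m + 1)) * M j) (j : ℕ) :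
    ‖F j (x + h)‖ ≤ Real.exp ((j : ℝ) - m) * M j := by
  rcases le_or_gt j m with hjm | hjm
  · have key : ∀ i, i ≤ m + 1 → ∀ s, 0 ≤ s → ‖F (m + 1 - i) (x + s)‖ ≤
        Real.exp (((m + 1 - i : ℕ) : ℝ) - (m + 1)) * M (m + 1 - i) *
          Real.exp (Real.exp 1 * ν m * s) := by
      intro i
      induction i with
      | zero =>
        intro _ s hs
        refine (hb _ _).trans ?_
        have h2 : 1 ≤ Real.exp (Real.exp 1 * ν m * s) :=
          Real.one_le_exp (mul_nonneg (mul_nonneg (Real.exp_pos 1).le (hν m).le) hs)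
        have h3 := hM0 (m + 1)
        simp only [Nat.sub_zero]
        push_cast
        rw [sub_self, Real.exp_zero, one_mul]
        exact le_mul_of_one_le_right h3.le h2
      | succ i ih =>
        intro hi s hs
        set l := m + 1 - (i + 1) with hl
        have hl1 : m + 1 - i = l + 1 := by omega
        rw [hl1] at ih
        have hlm : l ≤ m := by omega
        set A := Real.exp ((l : ℝ) - (m + 1)) * M l with hA
        have hA0 : 0 ≤ A := mul_nonneg (Real.exp_pos _).le (hM0 l).le
        refine image_norm_le_of_norm_deriv_right_le_deriv_boundary (a := 0) (b := s)
          (f := fun s => F l (x + s)) (f' := fun s => F (l + 1) (x + s))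
          (B := fun s => A * Real.exp (Real.exp 1 * ν m * s))
          (B' := fun s => A * (Real.exp (Real.exp 1 * ν m * s) * (Real.exp 1 * ν m)))
          (fun t _ => ?_) (fun t _ => ?_) ?_ (fun t => ?_) (fun t ht => ?_) ⟨hs, le_rfl⟩
        · exact ((hF l (x + t)).comp_const_add x t).continuousAt.continuousWithinAt
        · exact ((hF l (x + t)).comp_const_add x t).hasDerivWithinAt
        · simpa using hx l
        · simpa using (((hasDerivAt_id t).const_mul (Real.exp 1 * ν m)).exp).const_mul A
        · refine (ih (by omega) t ht.1).trans ?_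
          rw [hM, hA, Nat.cast_add_one, show (l : ℝ) + 1 - (m + 1) = (l - (m + 1)) + 1 by ring,
            Real.exp_add]
          have h4 := hmono hlm
          calc _ = Real.exp (l - (m + 1)) * M l * (Real.exp (Real.exp 1 * ν m * t) *
                (Real.exp 1 * ν l)) := by ring
            _ ≤ _ := by
              gcongr
    have h2 := key (m + 1 - j) (by omega) h h0
    rw [show m + 1 - (m + 1 - j) = j by omega] at h2
    refine h2.trans ?_
    calc _ ≤ Real.exp ((j : ℝ) - (m + 1)) * M j * Real.exp 1 := by
          gcongr
          · exact mul_nonneg (Real.exp_pos _).le (hM0 j).le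
          · linarith
      _ = _ := by
        rw [mul_right_comm, ← Real.exp_add]
        ring_nf
  · refine (hb _ _).trans (le_mul_of_one_le_left (hM0 j).le (Real.one_le_exp ?_))
    have : (m : ℝ) ≤ j := by exact_mod_cast hjm.le
    linarith

/-- Quasi-analyticity: a function flat at the origin whose derivatives are bounded by a product
sequence with divergent sum of reciprocals vanishes on the half line. -/
theorem bang_eq_zero {F : ℕ → ℝ → ℂ} (hF : ∀ j x, HasDerivAt (F j) (F (j + 1) x) x) {M ν : ℕ → ℝ}
    (hM0 : ∀ j, 0 < M j) (hM : ∀ j, M (j + 1) = M j * ν j) (hν : ∀ j, 0 < ν j)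
    (hmono : Monotone ν) (hdiv : ¬ Summable fun j => (ν j)⁻¹) (hb : ∀ j x, ‖F j x‖ ≤ M j)
    (h0 : ∀ j, F j 0 = 0) {x : ℝ} (hx : 0 ≤ x) : F 0 x = 0 := by
  have key : ∀ m d : ℕ, ∀ x, 0 ≤ x → x ≤ ∑ i ∈ Finset.Ico m (m + d), (Real.exp 1 * ν i)⁻¹ →
      ∀ j : ℕ, ‖F j x‖ ≤ Real.exp ((j : ℝ) - m) * M j := by
    intro m d
    induction d generalizing m with
    | zero =>
      intro x hx hx' j
      have hx0 : x = 0 := le_antisymm (by simpa using hx') hx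
      rw [hx0, h0, norm_zero]
      exact mul_nonneg (Real.exp_pos _).le (hM0 j).le
    | succ d ih =>
      intro x hx hx' j
      rw [Finset.sum_eq_sum_Ico_succ_bot (by omega), show m + (d + 1) = m + 1 + d by ring] at hx'
      set S := ∑ i ∈ Finset.Ico (m + 1) (m + 1 + d), (Real.exp 1 * ν i)⁻¹ with hS
      have hS0 : 0 ≤ S := Finset.sum_nonneg fun i _ =>
        inv_nonneg.2 (mul_nonneg (Real.exp_pos 1).le (hν i).le)
      have hpos : 0 < Real.exp 1 * ν m := mul_pos (Real.exp_pos 1) (hν m)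
      have hstep := bang_step hF hM0 hM hν hmono hb (m := m) (x := min x S) (h := x - min x S)
        (sub_nonneg.2 (min_le_left _ _)) (by
          rw [← le_div_iff₀ hpos, one_div]
          rcases le_total x S with h | h
          · rw [min_eq_left h, sub_self]
            positivity
          · rw [min_eq_right h]
            linarith)
        (fun j => by
          have := ih (m + 1) (min x S) (le_min hx hS0) (min_le_right _ _) j
          push_cast at this
          exact this) j
      rwa [add_sub_cancel] at hstep
  have hdiv2 : ∀ m : ℕ, ‖F 0 x‖ ≤ Real.exp (-(m : ℝ)) * M 0 := by
    intro m
    have h1 : ¬ Summable fun j => (Real.exp 1 * ν (j + m))⁻¹ := by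
      intro h
      refine hdiv ((summable_nat_add_iff m).1 ?_)
      refine (h.mul_left (Real.exp 1)).congr fun j => ?_
      have := (hν (j + m)).ne'
      have := (Real.exp_pos 1).ne'
      field_simp
    have h2 := (not_summable_iff_tendsto_nat_atTop_of_nonneg (fun j =>
      inv_nonneg.2 (mul_nonneg (Real.exp_pos 1).le (hν (j + m)).le))).1 h1
    obtain ⟨d, hd⟩ := (h2.eventually_ge_atTop x).exists
    have := key m d x hx (hd.trans (le_of_eq ?_)) 0
    · simpa using this
    · rw [Finset.sum_Ico_eq_sum_range, Nat.add_sub_cancel_left]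
      simp only [add_comm]
  have h3 : Tendsto (fun m : ℕ => Real.exp (-(m : ℝ)) * M 0) atTop (nhds 0) := by
    have := (Real.tendsto_exp_neg_atTop_nhds_zero.comp tendsto_natCast_atTop_atTop).mul_const (M 0)
    simpa using this
  exact norm_le_zero_iff.1 (ge_of_tendsto h3 (Eventually.of_forall hdiv2))

end QuasiAnalytic

section FlatSeries

/-- Remainder of the Taylor expansion of `exp (-v)`. -/
lemma abs_exp_neg_sub_sum_le (m : ℕ) {v : ℝ} (hv : 0 ≤ v) :
    |Real.exp (-v) - ∑ i ∈ Finset.range m, (-v) ^ i / (i.factorial : ℝ)| ≤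
      v ^ m / (m.factorial : ℝ) := by
  induction m generalizing v with
  | zero =>
    simp only [Finset.range_zero, Finset.sum_empty, sub_zero, pow_zero, Nat.factorial_zero,
      Nat.cast_one, div_one, Real.abs_exp]
    rwa [Real.exp_le_one_iff, neg_nonpos]
  | succ m ih =>
    have hd : ∀ i : ℕ, ∀ c t : ℝ,
        HasDerivAt (fun t : ℝ => (c * t) ^ (i + 1) / ((i + 1).factorial : ℝ))
        (c * ((c * t) ^ i / (i.factorial : ℝ))) t := by
      intro i c t
      have h := (((hasDerivAt_id t).const_mul c).pow (i + 1)).div_const ((i + 1).factorial : ℝ)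
      refine h.congr_deriv ?_
      have h1 : (i.factorial : ℝ) ≠ 0 := by positivity
      have h2 : ((i : ℝ) + 1) ≠ 0 := by positivity
      simp only [Nat.factorial_succ, Nat.add_sub_cancel, id]
      push_cast
      field_simp
    refine image_norm_le_of_norm_deriv_right_le_deriv_boundary (a := 0) (b := v)
      (f := fun v => Real.exp (-v) - ∑ i ∈ Finset.range (m + 1), (-v) ^ i / (i.factorial : ℝ))
      (f' := fun v => -(Real.exp (-v) - ∑ i ∈ Finset.range m, (-v) ^ i / (i.factorial : ℝ)))
      (B := fun v => v ^ (m + 1) / ((m + 1).factorial : ℝ))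
      (B' := fun v => v ^ m / (m.factorial : ℝ))
      (by fun_prop) (fun t _ => HasDerivAt.hasDerivWithinAt ?_) ?_ (fun t => ?_) (fun t ht => ?_)
      ⟨hv, le_rfl⟩
    · simp only [Finset.sum_range_succ' _ m]
      have h1 : HasDerivAt (fun v : ℝ => ∑ i ∈ Finset.range m, (-v) ^ (i + 1) /
          ((i + 1).factorial : ℝ))
          (∑ i ∈ Finset.range m, (-1) * ((-t) ^ i / (i.factorial : ℝ))) t :=
        HasDerivAt.fun_sum fun i _ => by simpa using hd i (-1) t
      have h2 := (((hasDerivAt_id t).neg).exp).sub (h1.add_const ((-(0 : ℝ)) ^ 0 / 1))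
      refine (h2.congr_of_eventuallyEq (Eventually.of_forall fun v => ?_)).congr_deriv ?_
      · simp
      · rw [← Finset.mul_sum]
        simp
        ring
    · rw [Finset.sum_range_succ']
      simp
    · simpa using hd m 1 t
    · simp only [norm_neg, Real.norm_eq_abs]
      exact ih ht.1

/-- The moments of an exponential sum that is flat at the origin vanish. -/
theorem moments_eq_zero {a : ℕ → ℂ} {x : ℕ → ℝ} (hx : ∀ k, 0 ≤ x k)
    (hs : ∀ m : ℕ, Summable fun k => ‖a k‖ * x k ^ m)
    (hflat : ∀ m : ℕ, ∃ C : ℝ, ∀ u : ℝ, 0 < u → u ≤ 1 →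
      ‖∑' k, a k * (Real.exp (-(x k * u)) : ℂ)‖ ≤ C * u ^ m) (m : ℕ) :
    ∑' k, a k * (x k : ℂ) ^ m = 0 := by
  have hs' : ∀ m : ℕ, Summable fun k => a k * (x k : ℂ) ^ m := fun m => by
    refine Summable.of_norm ((hs m).congr fun k => ?_)
    rw [norm_mul, norm_pow, Complex.norm_real, Real.norm_eq_abs, abs_of_nonneg (hx k)]
  induction m using Nat.strong_induction_on with
  | _ m ih =>
    obtain ⟨C, hC⟩ := hflat (m + 1)
    set A := ∑' k, a k * (x k : ℂ) ^ m with hA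
    set D := ∑' k, ‖a k‖ * x k ^ (m + 1) with hD
    have key : ∀ u : ℝ, 0 < u → u ≤ 1 → ‖A‖ ≤ (m.factorial : ℝ) * (C + D) * u := by
      intro u hu hu1
      have hsum : Summable fun k => a k * (Real.exp (-(x k * u)) : ℂ) := by
        refine Summable.of_norm_bounded (g := fun k => ‖a k‖) ((hs 0).congr fun k => by simp)
          fun k => ?_
        rw [norm_mul, Complex.norm_real, Real.norm_eq_abs, Real.abs_exp]
        refine mul_le_of_le_one_right (norm_nonneg _) (Real.exp_le_one_iff.2 ?_)
        have := mul_nonneg (hx k) hu.le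
        linarith
      have hsum2 : Summable fun k => a k * ((∑ i ∈ Finset.range (m + 1),
          (-(x k * u)) ^ i / (i.factorial : ℝ) : ℝ) : ℂ) := by
        have : ∀ i ∈ Finset.range (m + 1), Summable fun k =>
            (((-u) ^ i / (i.factorial : ℝ) : ℝ) : ℂ) * (a k * (x k : ℂ) ^ i) :=
          fun i _ => (hs' i).mul_left _
        refine (summable_sum this).congr fun k => ?_
        push_cast
        rw [Finset.mul_sum]
        refine Finset.sum_congr rfl fun i _ => ?_
        rw [show -((x k : ℂ) * u) = (-u) * x k by ring, mul_pow]
        ring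
      have h2 : ∑' k, a k * ((∑ i ∈ Finset.range (m + 1),
          (-(x k * u)) ^ i / (i.factorial : ℝ) : ℝ) : ℂ) =
          (((-u) ^ m / (m.factorial : ℝ) : ℝ) : ℂ) * A := by
        have e : ∀ k, a k * ((∑ i ∈ Finset.range (m + 1),
          (-(x k * u)) ^ i / (i.factorial : ℝ) : ℝ) : ℂ) = ∑ i ∈ Finset.range (m + 1),
            (((-u) ^ i / (i.factorial : ℝ) : ℝ) : ℂ) * (a k * (x k : ℂ) ^ i) := by
          intro k
          push_cast
          rw [Finset.mul_sum]
          refine Finset.sum_congr rfl fun i _ => ?_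
          rw [show -((x k : ℂ) * u) = (-u) * x k by ring, mul_pow]
          ring
        rw [tsum_congr e, Summable.tsum_finsetSum fun i _ => (hs' i).mul_left _]
        simp only [tsum_mul_left]
        rw [Finset.sum_range_succ, Finset.sum_eq_zero, zero_add]
        intro i hi
        rw [ih i (Finset.mem_range.1 hi), mul_zero]
      have h3 : ‖∑' k, a k * (Real.exp (-(x k * u)) : ℂ) -
          (((-u) ^ m / (m.factorial : ℝ) : ℝ) : ℂ) * A‖ ≤ D * u ^ (m + 1) := by
        rw [← h2, ← hsum.tsum_sub hsum2, hD, ← tsum_mul_right]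
        refine tsum_of_norm_bounded ((hs (m + 1)).mul_right _).hasSum fun k => ?_
        rw [← mul_sub, norm_mul, ← Complex.ofReal_sub, Complex.norm_real, Real.norm_eq_abs,
          mul_assoc]
        refine mul_le_mul_of_nonneg_left ?_ (norm_nonneg _)
        have hxu := mul_nonneg (hx k) hu.le
        refine (abs_exp_neg_sub_sum_le (m + 1) hxu).trans ?_
        rw [mul_pow]
        refine div_le_self (by have := hx k; positivity) ?_
        exact_mod_cast Nat.factorial_pos (m + 1)
      have h4 := hC u hu hu1
      have h5 : ‖(((-u) ^ m / (m.factorial : ℝ) : ℝ) : ℂ) * A‖ ≤ (C + D) * u ^ (m + 1) := by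
        have := norm_sub_norm_le ((((-u) ^ m / (m.factorial : ℝ) : ℝ) : ℂ) * A)
          (∑' k, a k * (Real.exp (-(x k * u)) : ℂ))
        rw [norm_sub_rev] at this
        linarith
      rw [norm_mul, Complex.norm_real, Real.norm_eq_abs, abs_div, abs_pow, abs_neg, abs_of_pos hu,
        Nat.abs_cast, div_mul_eq_mul_div, div_le_iff₀ (by positivity), pow_succ] at h5
      have h6 : 0 < u ^ m := by positivity
      refine le_of_mul_le_mul_left (h5.trans (le_of_eq ?_)) h6
      ring
    have hlim : Tendsto (fun u : ℝ => (m.factorial : ℝ) * (C + D) * u) (nhdsWithin 0 (Set.Ioi 0))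
        (nhds 0) := by
      have : Tendsto (fun u : ℝ => (m.factorial : ℝ) * (C + D) * u) (nhds 0)
          (nhds ((m.factorial : ℝ) * (C + D) * 0)) := by
        apply Continuous.tendsto
        fun_prop
      rw [mul_zero] at this
      exact this.mono_left nhdsWithin_le_nhds
    refine norm_le_zero_iff.1 (ge_of_tendsto hlim ?_)
    filter_upwards [Ioc_mem_nhdsGT (zero_lt_one' ℝ)] with u hu using key u hu.1 hu.2

end FlatSeries

section CosineSeries

lemma hasDerivAt_tsum_cos {a : ℕ → ℂ} {y : ℕ → ℝ} (hy : ∀ k, 0 ≤ y k)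
    (hs : ∀ j : ℕ, Summable fun k => ‖a k‖ * y k ^ j) (j : ℕ) (s : ℝ) :
    HasDerivAt (fun s : ℝ => ∑' k, a k * ((y k ^ j * Real.cos (y k * s + j * (π / 2)) : ℝ) : ℂ))
      (∑' k, a k * ((y k ^ (j + 1) * Real.cos (y k * s + (j + 1 : ℕ) * (π / 2)) : ℝ) : ℂ)) s := by
  have hb : ∀ (j k : ℕ) (s : ℝ), ‖a k * ((y k ^ j * Real.cos (y k * s + j * (π / 2)) : ℝ) : ℂ)‖ ≤
      ‖a k‖ * y k ^ j := by
    intro j k s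
    rw [norm_mul, Complex.norm_real, Real.norm_eq_abs, abs_mul, abs_of_nonneg (pow_nonneg (hy k) j)]
    exact mul_le_mul_of_nonneg_left
      (mul_le_of_le_one_right (pow_nonneg (hy k) j) (Real.abs_cos_le_one _)) (norm_nonneg _)
  refine hasDerivAt_tsum (hs (j + 1)) (fun k t => ?_) (fun k t => hb (j + 1) k t)
    (y₀ := 0) (Summable.of_norm_bounded (hs j) fun k => hb j k 0) s
  have h1 : HasDerivAt (fun t : ℝ => y k * t + j * (π / 2)) (y k) t := by
    simpa using ((hasDerivAt_id t).const_mul (y k)).add_const (j * (π / 2))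
  have h2 := (((h1.cos).const_mul (y k ^ j)).ofReal_comp).const_mul (a k)
  refine h2.congr_deriv ?_
  congr 2
  rw [show y k * t + ((j + 1 : ℕ) : ℝ) * (π / 2) = (y k * t + j * (π / 2)) + π / 2 by
    push_cast; ring, Real.cos_add_pi_div_two]
  ring

theorem tsum_cos_eq_zero {a : ℕ → ℂ} {y : ℕ → ℝ} (hy : ∀ k, 0 ≤ y k) {M ν : ℕ → ℝ}
    (hM0 : ∀ j, 0 < M j) (hM : ∀ j, M (j + 1) = M j * ν j) (hν : ∀ j, 0 < ν j)
    (hmono : Monotone ν) (hdiv : ¬ Summable fun j => (ν j)⁻¹)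
    (hs : ∀ j : ℕ, Summable fun k => ‖a k‖ * y k ^ j)
    (hb : ∀ j : ℕ, ∑' k, ‖a k‖ * y k ^ j ≤ M j)
    (hmom : ∀ m : ℕ, ∑' k, a k * ((y k : ℂ) ^ 2) ^ m = 0) (s : ℝ) :
    ∑' k, a k * (Real.cos (y k * s) : ℂ) = 0 := by
  have hpos : ∀ s : ℝ, 0 ≤ s → ∑' k, a k * (Real.cos (y k * s) : ℂ) = 0 := by
    intro s hs0
    have h := bang_eq_zero (F := fun (j : ℕ) (s : ℝ) =>
      ∑' k, a k * ((y k ^ j * Real.cos (y k * s + j * (π / 2)) : ℝ) : ℂ))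
      (hasDerivAt_tsum_cos hy hs) hM0 hM hν hmono hdiv (fun j x => ?_) (fun j => ?_) hs0
    · simpa using h
    · refine (tsum_of_norm_bounded (hs j).hasSum fun k => ?_).trans (hb j)
      rw [norm_mul, Complex.norm_real, Real.norm_eq_abs, abs_mul,
        abs_of_nonneg (pow_nonneg (hy k) j)]
      exact mul_le_mul_of_nonneg_left
        (mul_le_of_le_one_right (pow_nonneg (hy k) j) (Real.abs_cos_le_one _)) (norm_nonneg _)
    · rcases Nat.even_or_odd' j with ⟨m, rfl | rfl⟩
      · have h1 : ∀ k, a k * ((y k ^ (2 * m) *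
            Real.cos (y k * 0 + (2 * m : ℕ) * (π / 2)) : ℝ) : ℂ) =
            a k * ((y k : ℂ) ^ 2) ^ m * (Real.cos ((2 * m : ℕ) * (π / 2)) : ℂ) := by
          intro k
          rw [mul_zero, zero_add]
          push_cast
          ring
        simp only [h1]
        rw [tsum_mul_right, hmom, zero_mul]
      · have h1 : Real.cos (((2 * m + 1 : ℕ) : ℝ) * (π / 2)) = 0 := by
          rw [Real.cos_eq_zero_iff]
          exact ⟨m, by push_cast; ring⟩
        simp only [mul_zero, zero_add, h1, Complex.ofReal_zero, tsum_zero]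
  rcases le_total 0 s with h | h
  · exact hpos s h
  · have := hpos (-s) (neg_nonneg.2 h)
    simpa only [mul_neg, Real.cos_neg] using this

lemma integral_cos_mul_gauss (y : ℝ) {b : ℝ} (hb : 0 < b) :
    ∫ s : ℝ, (Real.cos (y * s) : ℂ) * (Real.exp (-b * s ^ 2) : ℂ) =
      ((π : ℂ) / b) ^ (1 / 2 : ℂ) * (Real.exp (-(y ^ 2 * (1 / (4 * b)))) : ℂ) := by
  have hb' : 0 < (b : ℂ).re := by simpa using hb
  have h1 := fourierIntegral_gaussian hb' (y : ℂ)
  have h2 := fourierIntegral_gaussian hb' (-(y : ℂ))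
  have hi : ∀ t : ℝ, Integrable fun x : ℝ =>
      Complex.exp (Complex.I * t * x) * Complex.exp (-(b : ℂ) * (x : ℂ) ^ 2) := by
    intro t
    refine (integrable_exp_neg_mul_sq hb).mono' (by fun_prop) (Eventually.of_forall fun x => ?_)
    rw [norm_mul, norm_exp_I_mul, one_mul, Complex.norm_exp]
    refine le_of_eq ?_
    congr 1
    rw [← Complex.ofReal_neg, ← Complex.ofReal_pow, ← Complex.ofReal_mul, Complex.ofReal_re]
  have hi2 := hi (-y)
  rw [Complex.ofReal_neg] at hi2
  have e : ∀ s : ℝ, (Real.cos (y * s) : ℂ) * (Real.exp (-b * s ^ 2) : ℂ) =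
      (1 / 2 : ℂ) * (Complex.exp (Complex.I * y * s) * Complex.exp (-(b : ℂ) * (s : ℂ) ^ 2) +
        Complex.exp (Complex.I * (-(y : ℂ)) * s) * Complex.exp (-(b : ℂ) * (s : ℂ) ^ 2)) := by
    intro s
    push_cast
    rw [Complex.cos]
    ring_nf
  simp only [e]
  rw [integral_const_mul, integral_add (hi y) hi2, h1, h2, neg_sq]
  push_cast
  ring_nf

theorem tsum_exp_eq_zero_of_cos {a : ℕ → ℂ} {y : ℕ → ℝ} (hs : Summable fun k => ‖a k‖)
    (h : ∀ s : ℝ, ∑' k, a k * (Real.cos (y k * s) : ℂ) = 0) {u : ℝ} (hu : 0 < u) :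
    ∑' k, a k * (Real.exp (-(y k ^ 2 * u)) : ℂ) = 0 := by
  set b := 1 / (4 * u) with hb
  have hb0 : 0 < b := by positivity
  have hbu : 1 / (4 * b) = u := by
    rw [hb]
    field_simp
  have hi := integrable_exp_neg_mul_sq hb0
  have hF : ∀ k, Integrable fun s : ℝ =>
      a k * ((Real.cos (y k * s) : ℂ) * (Real.exp (-b * s ^ 2) : ℂ)) := by
    intro k
    refine (hi.const_mul ‖a k‖).mono' (by fun_prop) (Eventually.of_forall fun s => ?_)
    rw [norm_mul, norm_mul, Complex.norm_real, Complex.norm_real, Real.norm_eq_abs,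
      Real.norm_eq_abs,
      Real.abs_exp]
    exact mul_le_mul_of_nonneg_left
      (mul_le_of_le_one_left (Real.exp_pos _).le (Real.abs_cos_le_one _)) (norm_nonneg _)
  have hsum := hasSum_integral_of_summable_integral_norm hF (by
    refine Summable.of_nonneg_of_le (fun k => integral_nonneg fun _ => norm_nonneg _) (fun k => ?_)
      (hs.mul_right (∫ s : ℝ, Real.exp (-b * s ^ 2)))
    rw [← integral_const_mul]
    refine integral_mono (hF k).norm (hi.const_mul _) fun s => ?_
    simp only
    rw [norm_mul, norm_mul, Complex.norm_real, Complex.norm_real, Real.norm_eq_abs,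
      Real.norm_eq_abs,
      Real.abs_exp]
    exact mul_le_mul_of_nonneg_left
      (mul_le_of_le_one_left (Real.exp_pos _).le (Real.abs_cos_le_one _)) (norm_nonneg _))
  have h0 : ∀ s : ℝ, ∑' k, a k * ((Real.cos (y k * s) : ℂ) * (Real.exp (-b * s ^ 2) : ℂ)) = 0 := by
    intro s
    simp only [← mul_assoc]
    rw [tsum_mul_right, h, zero_mul]
  simp only [h0, integral_zero, integral_const_mul, integral_cos_mul_gauss _ hb0, hbu] at hsum
  have h1 := hsum.tsum_eq
  have h2 : ∀ k, a k * (((π : ℂ) / b) ^ (1 / 2 : ℂ) * (Real.exp (-(y k ^ 2 * u)) : ℂ)) =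
      ((π : ℂ) / b) ^ (1 / 2 : ℂ) * (a k * (Real.exp (-(y k ^ 2 * u)) : ℂ)) := fun k => by ring
  simp only [h2] at h1
  rw [tsum_mul_left] at h1
  refine (mul_eq_zero.1 h1).resolve_left ?_
  exact (Complex.cpow_ne_zero_iff_of_exponent_ne_zero (by norm_num)).2
    (div_ne_zero (by exact_mod_cast Real.pi_ne_zero) (by exact_mod_cast hb0.ne'))

end CosineSeries

section Growth

lemma prod_le_exp {Θ : ℝ → ℝ} (hpos : ∀ t, 0 ≤ t → 0 ≤ Θ t) (hdec : AntitoneOn Θ (Set.Ici 0))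
    {y : ℝ} (hy : 0 ≤ y) (j : ℕ) :
    ∏ i ∈ Finset.range j, y * Θ (((i : ℝ) + 1) ^ 4) / (2 * (i + 1)) ≤
      Real.exp (Θ 0 / 2) * Real.exp (y * Θ y / 2 + (4 + Θ 0 / 2) * Real.sqrt y) := by
  set c := Θ 0 / 2 with hc
  have hc0 : 0 ≤ c := div_nonneg (hpos 0 le_rfl) two_pos.le
  set r := Real.sqrt (Real.sqrt y) with hr
  have hr0 : 0 ≤ r := Real.sqrt_nonneg _
  have hr2 : r ^ 2 = Real.sqrt y := Real.sq_sqrt (Real.sqrt_nonneg _)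
  have hr4 : r ^ 4 = y := by
    rw [show r ^ 4 = (r ^ 2) ^ 2 by ring, hr2, Real.sq_sqrt hy]
  set m := ⌊r⌋₊ with hm
  set q := max 1 (c * r ^ 4) with hq
  set X := y * Θ y / 2 with hX
  have hX0 : 0 ≤ X := div_nonneg (mul_nonneg hy (hpos y hy)) two_pos.le
  have hq1 : 1 ≤ q := le_max_left _ _
  have hp0 : ∀ i : ℕ, 0 ≤ y * Θ (((i : ℝ) + 1) ^ 4) / (2 * (i + 1)) := fun i =>
    div_nonneg (mul_nonneg hy (hpos _ (by positivity))) (by positivity)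
  have hpq : ∀ i : ℕ, y * Θ (((i : ℝ) + 1) ^ 4) / (2 * (i + 1)) ≤ q := by
    intro i
    refine le_trans ?_ (le_max_right _ _)
    rw [div_le_iff₀ (by positivity), hr4]
    have h1 : Θ (((i : ℝ) + 1) ^ 4) ≤ Θ 0 :=
      hdec (Set.mem_Ici.2 le_rfl) (Set.mem_Ici.2 (by positivity)) (by positivity)
    have h2 : y * Θ (((i : ℝ) + 1) ^ 4) ≤ y * Θ 0 := mul_le_mul_of_nonneg_left h1 hy
    have h3 : 0 ≤ y * Θ 0 * i := by
      have := hpos 0 le_rfl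
      positivity
    calc _ ≤ y * Θ 0 := h2
      _ ≤ y * Θ 0 + y * Θ 0 * i := by linarith
      _ = c * y * (2 * (i + 1)) := by rw [hc]; ring
  have hpX : ∀ i : ℕ, m ≤ i → y * Θ (((i : ℝ) + 1) ^ 4) / (2 * (i + 1)) ≤ X / (i + 1) := by
    intro i hi
    have h1 : r < (i : ℝ) + 1 := by
      have := Nat.lt_floor_add_one r
      have h2 : (m : ℝ) ≤ i := by exact_mod_cast hi
      linarith
    have h2 : y ≤ ((i : ℝ) + 1) ^ 4 := hr4 ▸ pow_le_pow_left₀ hr0 h1.le 4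
    have h3 := hdec (Set.mem_Ici.2 hy) (Set.mem_Ici.2 (by positivity)) h2
    calc _ ≤ y * Θ y / (2 * (i + 1)) := by gcongr
      _ = X / (i + 1) := by rw [hX, div_div]
  have hA : ∀ j, ∏ i ∈ Finset.range j, y * Θ (((i : ℝ) + 1) ^ 4) / (2 * (i + 1)) ≤ q ^ j := by
    intro j
    refine (Finset.prod_le_prod (fun i _ => hp0 i) fun i _ => hpq i).trans ?_
    simp
  have hB : ∀ d : ℕ, ∏ i ∈ Finset.range (m + d), y * Θ (((i : ℝ) + 1) ^ 4) / (2 * (i + 1)) ≤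
      q ^ m * (X ^ d / d.factorial) := by
    intro d
    induction d with
    | zero => simpa using hA m
    | succ d ih =>
      rw [← add_assoc, Finset.prod_range_succ]
      have h1 : X / (((m + d : ℕ) : ℝ) + 1) ≤ X / ((d : ℝ) + 1) := by
        gcongr
        simp
      calc _ ≤ q ^ m * (X ^ d / d.factorial) * (X / ((d : ℝ) + 1)) :=
            mul_le_mul ih ((hpX _ (Nat.le_add_right m d)).trans h1) (hp0 _) (by positivity)
        _ = _ := by
          rw [Nat.factorial_succ]
          push_cast
          field_simp
          ring
  have hqe : q ^ m ≤ Real.exp (c + (4 + c) * Real.sqrt y) := by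
    have h1 : q ≤ Real.exp (c + 4 * r) := by
      refine max_le (Real.one_le_exp (by positivity)) ?_
      rw [Real.exp_add, show (4 : ℝ) * r = ((4 : ℕ) : ℝ) * r by norm_num, Real.exp_nat_mul]
      have h2 : c ≤ Real.exp c := by linarith [Real.add_one_le_exp c]
      have h3 : r ≤ Real.exp r := by linarith [Real.add_one_le_exp r]
      gcongr
    have hmr : (m : ℝ) ≤ r := Nat.floor_le hr0
    calc q ^ m ≤ Real.exp (c + 4 * r) ^ m := by gcongr
      _ = Real.exp (m * (c + 4 * r)) := (Real.exp_nat_mul _ _).symm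
      _ ≤ Real.exp (c + (4 + c) * Real.sqrt y) := by
        refine Real.exp_le_exp.2 ?_
        rw [← hr2]
        calc (m : ℝ) * (c + 4 * r) ≤ r * (c + 4 * r) := by gcongr
          _ ≤ _ := by nlinarith [mul_nonneg hc0 (sq_nonneg (r - 1 / 2))]
  have hX1 : 1 ≤ Real.exp X := Real.one_le_exp hX0
  have hfin : ∏ i ∈ Finset.range j, y * Θ (((i : ℝ) + 1) ^ 4) / (2 * (i + 1)) ≤
      q ^ m * Real.exp X := by
    rcases le_total j m with h | h
    · calc _ ≤ q ^ j := hA j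
        _ ≤ q ^ m := pow_le_pow_right₀ hq1 h
        _ ≤ _ := le_mul_of_one_le_right (by positivity) hX1
    · obtain ⟨d, rfl⟩ := Nat.exists_eq_add_of_le h
      refine (hB d).trans ?_
      gcongr
      exact Real.pow_div_factorial_le_exp X hX0 d
  calc _ ≤ q ^ m * Real.exp X := hfin
    _ ≤ Real.exp (c + (4 + c) * Real.sqrt y) * Real.exp X := by gcongr
    _ = _ := by
      rw [← Real.exp_add, ← Real.exp_add]
      congr 1
      ring

lemma pow_le_prod {Θ : ℝ → ℝ} (hpos : ∀ t, 0 ≤ t → 0 < Θ t) (hdec : AntitoneOn Θ (Set.Ici 0))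
    {y : ℝ} (hy : 0 ≤ y) (j : ℕ) :
    y ^ j ≤ Real.exp (Θ 0 / 2) * Real.exp (y * Θ y / 2 + (4 + Θ 0 / 2) * Real.sqrt y) *
      ∏ i ∈ Finset.range j, 2 * ((i : ℝ) + 1) / Θ (((i : ℝ) + 1) ^ 4) := by
  have hp : ∀ i : ℕ, 0 < 2 * ((i : ℝ) + 1) / Θ (((i : ℝ) + 1) ^ 4) := fun i =>
    div_pos (by positivity) (hpos _ (by positivity))
  have h := prod_le_exp (fun t ht => (hpos t ht).le) hdec hy j
  calc y ^ j = (∏ i ∈ Finset.range j, y * Θ (((i : ℝ) + 1) ^ 4) / (2 * (i + 1))) *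
        ∏ i ∈ Finset.range j, 2 * ((i : ℝ) + 1) / Θ (((i : ℝ) + 1) ^ 4) := by
        rw [← Finset.prod_mul_distrib]
        have : ∀ i : ℕ, y * Θ (((i : ℝ) + 1) ^ 4) / (2 * (i + 1)) *
            (2 * ((i : ℝ) + 1) / Θ (((i : ℝ) + 1) ^ 4)) = y := fun i => by
          have := (hpos (((i : ℝ) + 1) ^ 4) (by positivity)).ne'
          field_simp
        simp [this]
    _ ≤ _ := by
      refine mul_le_mul_of_nonneg_right h (Finset.prod_nonneg fun i _ => (hp i).le)

lemma integrableOn_div_of_summable {Θ : ℝ → ℝ} (hpos : ∀ t, 0 ≤ t → 0 ≤ Θ t)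
    (hdec : AntitoneOn Θ (Set.Ici 0))
    (hs : Summable fun i : ℕ => Θ (((i : ℝ) + 1) ^ 4) / (i + 1)) :
    IntegrableOn (fun t : ℝ => Θ t / t) (Set.Ici 1) (volume : Measure ℝ) := by
  have hanti := antitoneOn_div_self hpos hdec
  rw [integrableOn_Ici_iff_integrableOn_Ioi]
  have hii : ∀ a b : ℝ, 1 ≤ a → a ≤ b → IntervalIntegrable (fun t => Θ t / t) volume a b := by
    intro a b ha hab
    refine AntitoneOn.intervalIntegrable (hanti.mono ?_)
    rw [Set.uIcc_of_le hab]
    exact fun x hx => ha.trans hx.1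
  have hmonob : ∀ i : ℕ, ((i : ℝ) + 1) ^ 4 ≤ ((i : ℝ) + 1 + 1) ^ 4 := fun i => by gcongr; linarith
  have h1b : ∀ i : ℕ, (1 : ℝ) ≤ ((i : ℝ) + 1) ^ 4 := fun i => one_le_pow₀ (by simp)
  refine integrableOn_Ioi_of_intervalIntegral_norm_bounded (l := atTop)
    (b := fun i : ℕ => ((i : ℝ) + 1) ^ 4) (∑' i : ℕ, 15 * (Θ (((i : ℝ) + 1) ^ 4) / (i + 1))) 1
    (fun i => ?_) ?_ (Eventually.of_forall fun i => ?_)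
  · have := (hii 1 _ le_rfl (h1b i)).1
    exact this
  · exact (tendsto_pow_atTop (by norm_num)).comp
      (tendsto_atTop_add_const_right _ _ tendsto_natCast_atTop_atTop)
  · have hnorm : ∫ x in (1 : ℝ)..((i : ℝ) + 1) ^ 4, ‖Θ x / x‖ =
        ∫ x in (1 : ℝ)..((i : ℝ) + 1) ^ 4, Θ x / x := by
      refine intervalIntegral.integral_congr fun x hx => ?_
      rw [Set.uIcc_of_le (h1b i)] at hx
      have hx1 := hx.1
      exact Real.norm_of_nonneg (div_nonneg (hpos x (by linarith)) (by linarith))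
    rw [hnorm]
    have hblock : ∀ i : ℕ, ∫ x in ((i : ℝ) + 1) ^ 4..((i : ℝ) + 1 + 1) ^ 4, Θ x / x ≤
        15 * (Θ (((i : ℝ) + 1) ^ 4) / (i + 1)) := by
      intro i
      have h0 : 0 ≤ Θ (((i : ℝ) + 1) ^ 4) := hpos _ (by positivity)
      calc ∫ x in ((i : ℝ) + 1) ^ 4..((i : ℝ) + 1 + 1) ^ 4, Θ x / x
          ≤ ∫ x in ((i : ℝ) + 1) ^ 4..((i : ℝ) + 1 + 1) ^ 4,
            Θ (((i : ℝ) + 1) ^ 4) / ((i : ℝ) + 1) ^ 4 := by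
            refine intervalIntegral.integral_mono_on (hmonob i) (hii _ _ (h1b i) (hmonob i))
              (by simp) fun x hx => ?_
            exact hanti (h1b i) ((h1b i).trans hx.1) hx.1
        _ = (((i : ℝ) + 1 + 1) ^ 4 - ((i : ℝ) + 1) ^ 4) *
            (Θ (((i : ℝ) + 1) ^ 4) / ((i : ℝ) + 1) ^ 4) := by
            rw [intervalIntegral.integral_const, smul_eq_mul]
        _ ≤ (15 * ((i : ℝ) + 1) ^ 3) * (Θ (((i : ℝ) + 1) ^ 4) / ((i : ℝ) + 1) ^ 4) := by
            refine mul_le_mul_of_nonneg_right ?_ (by positivity)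
            have hi : (0 : ℝ) ≤ i := Nat.cast_nonneg i
            nlinarith [pow_nonneg hi 2, pow_nonneg hi 3]
        _ = _ := by field_simp
    have hsum : ∫ x in (1 : ℝ)..((i : ℝ) + 1) ^ 4, Θ x / x ≤
        ∑ l ∈ Finset.range i, 15 * (Θ (((l : ℝ) + 1) ^ 4) / (l + 1)) := by
      have h := intervalIntegral.sum_integral_adjacent_intervals (n := i)
        (a := fun l : ℕ => ((l : ℝ) + 1) ^ 4) (f := fun x => Θ x / x) (μ := volume)
        (fun l _ => by
          have := hii _ _ (h1b l) (hmonob l)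
          push_cast
          exact this)
      simp only [Nat.cast_zero, zero_add, one_pow] at h
      rw [← h]
      refine Finset.sum_le_sum fun l _ => ?_
      push_cast
      exact hblock l
    refine hsum.trans ((hs.mul_left 15).sum_le_tsum _ fun l _ => ?_)
    exact mul_nonneg (by norm_num) (div_nonneg (hpos _ (by positivity)) (by positivity))

lemma pos_of_not_integrableOn_div {Θ : ℝ → ℝ} (hpos : ∀ t, 0 ≤ t → 0 ≤ Θ t)
    (hdec : AntitoneOn Θ (Set.Ici 0))
    (hinteg : ¬ IntegrableOn (fun t : ℝ => Θ t / t) (Set.Ici 1) (volume : Measure ℝ)) (t : ℝ)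
    (ht : 0 ≤ t) : 0 < Θ t := by
  by_contra hneg
  refine hinteg (integrableOn_div_of_summable hpos hdec ?_)
  obtain ⟨N, hN⟩ := exists_nat_ge t
  refine summable_of_ne_finset_zero (s := Finset.range N) fun i hi => ?_
  have hNi : (N : ℝ) ≤ i := by exact_mod_cast (by simpa using hi : N ≤ i)
  have h1 : t ≤ ((i : ℝ) + 1) ^ 4 := by
    have h2 : (1 : ℝ) ≤ i + 1 := by simp
    calc t ≤ (i : ℝ) + 1 := by linarith
      _ ≤ _ := le_self_pow₀ h2 (by norm_num)
  have h2 := hdec (Set.mem_Ici.2 ht) (Set.mem_Ici.2 (ht.trans h1)) h1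
  have h3 : Θ (((i : ℝ) + 1) ^ 4) = 0 :=
    le_antisymm (h2.trans (not_lt.1 hneg)) (hpos _ (by positivity))
  rw [h3, zero_div]

end Growth

section FlatPowerSeries

theorem coeff_eq_zero_of_flat {Θ : ℝ → ℝ} (hpos : ∀ t, 0 ≤ t → 0 ≤ Θ t)
    (hdec : AntitoneOn Θ (Set.Ici 0))
    (hinteg : ¬ IntegrableOn (fun t : ℝ => Θ t / t) (Set.Ici 1) (volume : Measure ℝ)) (n : ℕ) {b : ℝ}
    (hb : 0 < b) {a : ℕ → ℂ} {w : ℕ → ℝ} (hw : Summable w)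
    (ha : ∀ k : ℕ, ‖a k‖ ≤ w k * Real.exp (-(Real.sqrt ((2 * k + n) * b) *
      Θ (Real.sqrt ((2 * k + n) * b)) / 2 +
      (4 + Θ 0 / 2) * Real.sqrt (Real.sqrt ((2 * k + n) * b)))))
    (hflat : ∀ m : ℕ, ∃ C : ℝ, ∀ s : ℝ, 0 < s → s < 1 →
      ‖∑' k, a k * (s : ℂ) ^ k‖ ≤ C * (1 - s) ^ m) : a = 0 := by
  have hΘ := pos_of_not_integrableOn_div hpos hdec hinteg
  set y : ℕ → ℝ := fun k => Real.sqrt ((2 * k + n) * b) with hy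
  have hy0 : ∀ k, 0 ≤ y k := fun k => Real.sqrt_nonneg _
  have hy2 : ∀ k : ℕ, y k ^ 2 = (2 * k + n) * b := fun k => Real.sq_sqrt (by positivity)
  set ν : ℕ → ℝ := fun i => 2 * ((i : ℝ) + 1) / Θ (((i : ℝ) + 1) ^ 4) with hν
  have hν0 : ∀ i, 0 < ν i := fun i => div_pos (by positivity) (hΘ _ (by positivity))
  set P : ℕ → ℝ := fun j => ∏ i ∈ Finset.range j, ν i with hP
  have hP0 : ∀ j, 0 < P j := fun j => Finset.prod_pos fun i _ => hν0 i
  have hw0 : ∀ k, 0 ≤ w k := fun k =>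
    nonneg_of_mul_nonneg_left ((norm_nonneg _).trans (ha k)) (Real.exp_pos _)
  have hak : ∀ j k, ‖a k‖ * y k ^ j ≤ w k * (Real.exp (Θ 0 / 2) * P j) := by
    intro j k
    have h1 := pow_le_prod hΘ hdec (hy0 k) j
    set E := y k * Θ (y k) / 2 + (4 + Θ 0 / 2) * Real.sqrt (y k)
    calc ‖a k‖ * y k ^ j ≤ (w k * Real.exp (-E)) * (Real.exp (Θ 0 / 2) * Real.exp E * P j) :=
          mul_le_mul (ha k) h1 (pow_nonneg (hy0 k) j) (mul_nonneg (hw0 k) (Real.exp_pos _).le)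
      _ = w k * (Real.exp (Θ 0 / 2) * P j) * (Real.exp (-E) * Real.exp E) := by ring
      _ = _ := by rw [← Real.exp_add, neg_add_cancel, Real.exp_zero, mul_one]
  have hs : ∀ j : ℕ, Summable fun k => ‖a k‖ * y k ^ j := fun j =>
    Summable.of_nonneg_of_le (fun k => mul_nonneg (norm_nonneg _) (pow_nonneg (hy0 k) j)) (hak j)
      (hw.mul_right _)
  have hmono : Monotone ν := by
    intro i l hil
    have h1 : (i : ℝ) ≤ l := by exact_mod_cast hil
    have h2 : Θ (((l : ℝ) + 1) ^ 4) ≤ Θ (((i : ℝ) + 1) ^ 4) :=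
      hdec (Set.mem_Ici.2 (by positivity)) (Set.mem_Ici.2 (by positivity)) (by gcongr)
    have h3 := hΘ (((l : ℝ) + 1) ^ 4) (by positivity)
    simp only [hν]
    gcongr
  have hdiv : ¬ Summable fun j => (ν j)⁻¹ := by
    intro h
    refine hinteg (integrableOn_div_of_summable hpos hdec ((h.mul_left 2).congr fun i => ?_))
    have := (hΘ (((i : ℝ) + 1) ^ 4) (by positivity)).ne'
    simp only [hν]
    field_simp
  have hfactor : ∀ (k : ℕ) (u : ℝ), a k * (Real.exp (-(y k ^ 2 * u)) : ℂ) =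
      (Real.exp (-(n * b * u)) : ℂ) * (a k * (Real.exp (-(2 * b * u)) : ℂ) ^ k) := by
    intro k u
    rw [hy2, ← Complex.ofReal_pow, ← Real.exp_nat_mul,
      show -((2 * (k : ℝ) + n) * b * u) = -(n * b * u) + k * -(2 * b * u) by ring,
      Real.exp_add, Complex.ofReal_mul]
    ring
  have hmom : ∀ m : ℕ, ∑' k, a k * ((y k : ℂ) ^ 2) ^ m = 0 := by
    intro m
    have h := moments_eq_zero (a := a) (x := fun k => y k ^ 2) (fun k => sq_nonneg _)
      (fun m => by simpa only [← pow_mul] using hs (2 * m)) (fun m => ?_) m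
    · simpa using h
    · obtain ⟨C, hC⟩ := hflat m
      refine ⟨|C| * (2 * b) ^ m, fun u hu _ => ?_⟩
      set s := Real.exp (-(2 * b * u)) with hs'
      have hs0 : 0 < s := Real.exp_pos _
      have hs1 : s < 1 := by
        rw [hs', Real.exp_lt_one_iff]
        have : 0 < b * u := mul_pos hb hu
        linarith
      simp only [hfactor]
      rw [tsum_mul_left, norm_mul, Complex.norm_real, Real.norm_eq_abs, Real.abs_exp]
      have h1 : Real.exp (-(n * b * u)) ≤ 1 := by
        rw [Real.exp_le_one_iff, neg_nonpos]
        positivity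
      have h2 : 1 - s ≤ 2 * b * u := by
        have := Real.add_one_le_exp (-(2 * b * u))
        linarith
      have h3 : 0 ≤ 1 - s := by linarith
      calc _ ≤ 1 * (C * (1 - s) ^ m) :=
            mul_le_mul h1 (hC s hs0 hs1) (norm_nonneg _) zero_le_one
        _ ≤ |C| * (2 * b * u) ^ m := by
          rw [one_mul]
          exact mul_le_mul (le_abs_self C) (pow_le_pow_left₀ h3 h2 m)
            (pow_nonneg h3 m) (abs_nonneg C)
        _ = _ := by rw [mul_pow, mul_assoc]
  have hw1 : 0 ≤ ∑' k, w k := tsum_nonneg hw0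
  have hcos := tsum_cos_eq_zero (a := a) hy0
    (M := fun j => (∑' k, w k + 1) * Real.exp (Θ 0 / 2) * P j) (fun j => by
      have := hP0 j
      positivity) (fun j => by
      simp only [hP, Finset.prod_range_succ]
      ring) hν0 hmono hdiv hs (fun j => ?_) hmom
  · have hs' : Summable fun k => ‖a k‖ := by simpa using hs 0
    have hexp := fun u hu => tsum_exp_eq_zero_of_cos hs' hcos (u := u) hu
    refine eq_of_hasSum_pow_eq (r := 1) one_pos (f := fun _ => 0) (fun s hs0 hs1 => ?_)
      (fun s _ _ => by simp)
    have hsum : Summable fun k => a k * (s : ℂ) ^ k := by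
      refine Summable.of_norm_bounded hs' fun k => ?_
      rw [norm_mul, norm_pow, Complex.norm_real, Real.norm_eq_abs, abs_of_pos hs0]
      exact mul_le_of_le_one_right (norm_nonneg _) (pow_le_one₀ hs0.le hs1.le)
    have hu : 0 < -Real.log s / (2 * b) :=
      div_pos (neg_pos.2 (Real.log_neg hs0 hs1)) (by positivity)
    have h0 := hexp _ hu
    set u := -Real.log s / (2 * b) with hu'
    have hsu : s = Real.exp (-(2 * b * u)) := by
      rw [hu', mul_div_cancel₀ _ (by positivity), neg_neg, Real.exp_log hs0]
    simp only [hfactor, ← hsu] at h0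
    rw [tsum_mul_left, mul_eq_zero] at h0
    have h1 := h0.resolve_left (by exact_mod_cast (Real.exp_pos _).ne')
    exact h1 ▸ hsum.hasSum
  · calc _ ≤ ∑' k, w k * (Real.exp (Θ 0 / 2) * P j) :=
        (hs j).tsum_le_tsum (hak j) (hw.mul_right _)
      _ = (∑' k, w k) * (Real.exp (Θ 0 / 2) * P j) := tsum_mul_right
      _ ≤ (∑' k, w k + 1) * (Real.exp (Θ 0 / 2) * P j) := by
        have := hP0 j
        gcongr
        linarith
      _ = _ := by ring

end FlatPowerSeries

section TwistedSeries

variable {n : ℕ}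

lemma summable_choose_mul_pow (hn : 1 ≤ n) {s : ℝ} (hs : |s| < 1) :
    Summable fun k : ℕ => ((k + n - 1).choose k : ℝ) * |s| ^ k := by
  refine (hasSum_lagR hn 0 0 (s := |s|) (by rwa [abs_abs])).summable.congr fun k => ?_
  rw [lagR_zero]

lemma hasSum_integral_mul_pow {X : Type*} [MeasurableSpace X] {m : Measure X} (hn : 1 ≤ n)
    {h : X → ℂ} (hh : Integrable h m) {u : ℕ → X → ℂ} (hu : ∀ k, AEStronglyMeasurable (u k) m)
    {D : ℝ} (hD : ∀ k x, ‖u k x‖ ≤ D * ((k + n - 1).choose k : ℝ)) {s : ℝ} (hs : |s| < 1)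
    {U : X → ℂ} (hU : ∀ x, HasSum (fun k => u k x * (s : ℂ) ^ k) (U x)) :
    HasSum (fun k => (∫ x, h x * u k x ∂m) * (s : ℂ) ^ k) (∫ x, h x * U x ∂m) := by
  have hc := summable_choose_mul_pow hn hs
  have key : HasSum (fun k => ∫ x, h x * u k x * (s : ℂ) ^ k ∂m) (∫ x, h x * U x ∂m) := by
    refine hasSum_integral_of_dominated_convergence
      (fun k x => ‖h x‖ * (D * (((k + n - 1).choose k : ℝ) * |s| ^ k)))
      (fun k => (hh.aestronglyMeasurable.mul (hu k)).mul aestronglyMeasurable_const)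
      (fun k => Eventually.of_forall fun x => ?_)
      (Eventually.of_forall fun x => (hc.mul_left D).mul_left _) ?_
      (Eventually.of_forall fun x => ?_)
    · rw [norm_mul, norm_mul, norm_pow, Complex.norm_real, Real.norm_eq_abs, mul_assoc]
      refine mul_le_mul_of_nonneg_left ?_ (norm_nonneg _)
      rw [← mul_assoc]
      exact mul_le_mul_of_nonneg_right (hD k x) (by positivity)
    · simp only [tsum_mul_left]
      exact hh.norm.mul_const _
    · simpa only [mul_assoc] using (hU x).mul_left (h x)
  simpa only [integral_mul_const] using key

lemma integrable_sub_mul_twE {g : Cn n → ℂ} (hg : Integrable g) (mu : ℝ) (z : Cn n) :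
    Integrable fun w => g (z - w) * twE mu z w :=
  (hg.comp_sub_left z).mul_bdd (c := 1) (Continuous.aestronglyMeasurable (by fun_prop))
    (Eventually.of_forall fun w => (norm_twE _ _ _).le)

lemma hasSum_twConv (hn : 1 ≤ n) {g : Cn n → ℂ} (hg : Integrable g) (mu : ℝ) {u : ℕ → Cn n → ℂ}
    (hu : ∀ k, Continuous (u k)) {D : ℝ} (hD : ∀ k x, ‖u k x‖ ≤ D * ((k + n - 1).choose k : ℝ))
    {s : ℝ} (hs : |s| < 1) {U : Cn n → ℂ}
    (hU : ∀ x, HasSum (fun k => u k x * (s : ℂ) ^ k) (U x)) (z : Cn n) :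
    HasSum (fun k => twConv n mu g (u k) z * (s : ℂ) ^ k) (twConv n mu g U z) := by
  have h := hasSum_integral_mul_pow hn (integrable_sub_mul_twE hg mu z)
    (fun k => (hu k).aestronglyMeasurable) hD hs hU
  simp only [twConv_eq]
  simpa only [mul_right_comm] using h

lemma continuous_twConv {g : Cn n → ℂ} (hg : Integrable g) (mu : ℝ) {u : Cn n → ℂ}
    (hu : Continuous u) {D : ℝ} (hD : ∀ x, ‖u x‖ ≤ D) : Continuous (twConv n mu g u) := by
  have e : twConv n mu g u = fun z => ∫ w, u (z - w) * g w * twE (-mu) z w := by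
    ext z
    rw [twConv_comm, twConv_eq]
  rw [e]
  refine continuous_of_dominated (bound := fun w => D * ‖g w‖) (fun z => ?_)
    (fun z => Eventually.of_forall fun w => ?_) (hg.norm.const_mul D)
    (Eventually.of_forall fun w => by fun_prop)
  · exact ((Continuous.aestronglyMeasurable (by fun_prop)).mul hg.aestronglyMeasurable).mul
      (Continuous.aestronglyMeasurable (by fun_prop))
  · rw [norm_mul, norm_mul, norm_twE, mul_one]
    exact mul_le_mul_of_nonneg_right (hD _) (norm_nonneg _)

lemma norm_twConv_le {g : Cn n → ℂ} (hg : Integrable g) (mu : ℝ) {u : Cn n → ℂ} {D : ℝ} (z : Cn n)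
    (hD : ∀ w, g (z - w) ≠ 0 → ‖u w‖ ≤ D) : ‖twConv n mu g u z‖ ≤ D * ∫ w, ‖g w‖ := by
  rw [twConv_eq, ← integral_sub_left_eq_self _ volume z, ← integral_const_mul]
  refine norm_integral_le_of_norm_le (hg.norm.const_mul D) (Eventually.of_forall fun w => ?_)
  rw [norm_mul, norm_mul, norm_twE, mul_one, sub_sub_cancel]
  by_cases h : g w = 0
  · simp [h]
  · rw [mul_comm]
    exact mul_le_mul_of_nonneg_right (hD _ (by rwa [sub_sub_cancel])) (norm_nonneg _)

/-- The Gaussian generating function of the Laguerre functions. -/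
def lagGen (n : ℕ) (mu s : ℝ) (z : Cn n) : ℝ :=
  (1 - s)⁻¹ ^ n * Real.exp (-(|mu| / 4 * ((1 + s) / (1 - s)) * ‖z‖ ^ 2))

lemma hasSum_lagFun_lagGen (hn : 1 ≤ n) (mu : ℝ) (z : Cn n) {s : ℝ} (hs : |s| < 1) :
    HasSum (fun k => (lagFun n k mu z : ℂ) * (s : ℂ) ^ k) (lagGen n mu s z : ℂ) := by
  have := Complex.hasSum_ofReal.2 (hasSum_lagFun hn mu z hs)
  simpa [lagGen] using this

lemma norm_lagFun_le (hn : 1 ≤ n) {mu : ℝ} (hmu : mu ≠ 0) (k : ℕ) (z : Cn n) :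
    ‖(lagFun n k mu z : ℂ)‖ ≤ 1 * ((k + n - 1).choose k : ℝ) := by
  rw [Complex.norm_real, Real.norm_eq_abs, one_mul]
  exact abs_lagFun_le hn hmu k z

/-- The generating function is flat at `s = 1` away from the origin. -/
lemma exists_lagGen_le_pow {mu : ℝ} (hmu : mu ≠ 0) {r : ℝ} (hr : 0 < r) (m : ℕ) :
    ∃ C : ℝ, 0 ≤ C ∧ ∀ s : ℝ, 0 < s → s < 1 → ∀ z : Cn n, r ≤ ‖z‖ →
      lagGen n mu s z ≤ C * (1 - s) ^ m := by
  have hb : 0 < |mu| := abs_pos.2 hmu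
  set c := |mu| / 4 * r ^ 2 with hc
  have hc0 : 0 < c := by positivity
  refine ⟨(n + m).factorial * (c⁻¹) ^ (n + m), by positivity, fun s h0 h1 z hz => ?_⟩
  have h1s : 0 < 1 - s := by linarith
  set v := c * (1 - s)⁻¹ with hv
  have hv0 : 0 < v := by positivity
  have hexp : Real.exp (-(|mu| / 4 * ((1 + s) / (1 - s)) * ‖z‖ ^ 2)) ≤
      (n + m).factorial / v ^ (n + m) := by
    have h2 : v ≤ |mu| / 4 * ((1 + s) / (1 - s)) * ‖z‖ ^ 2 := by
      calc v = |mu| / 4 * (1 / (1 - s)) * r ^ 2 := by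
            rw [hv, hc]
            ring
        _ ≤ _ := by
          gcongr
          linarith
    have h3 := Real.pow_div_factorial_le_exp v hv0.le (n + m)
    calc _ ≤ Real.exp (-v) := Real.exp_le_exp.2 (neg_le_neg h2)
      _ = (Real.exp v)⁻¹ := Real.exp_neg v
      _ ≤ (v ^ (n + m) / (n + m).factorial)⁻¹ := by gcongr
      _ = _ := inv_div _ _
  calc lagGen n mu s z ≤ (1 - s)⁻¹ ^ n * ((n + m).factorial / v ^ (n + m)) := by
        unfold lagGen
        gcongr
    _ = _ := by
      have h4 : v ^ (n + m) = c ^ (n + m) * ((1 - s) ^ n * (1 - s) ^ m)⁻¹ := by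
        rw [hv, mul_pow, inv_pow, pow_add (1 - s)]
      have h5 := h1s.ne'
      rw [h4, inv_pow, inv_pow]
      clear_value c
      field_simp

lemma lagGen_nonneg (mu : ℝ) {s : ℝ} (hs : s < 1) (z : Cn n) : 0 ≤ lagGen n mu s z :=
  mul_nonneg (pow_nonneg (inv_nonneg.2 (by linarith)) n) (Real.exp_pos _).le

lemma norm_twConv_lagFun_le_gauss (hn : 1 ≤ n) {g : Cn n → ℂ} (hg : Integrable g) {r : ℝ}
    (hr : ∀ w, g w ≠ 0 → ‖w‖ ≤ r) {mu : ℝ} (k : ℕ) (z : Cn n) :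
    ‖twConv n mu g (fun w => (lagFun n k mu w : ℂ)) z‖ ≤
      (4 ^ k * 2 ^ n * Real.exp (|mu| / 12 * r ^ 2) * ∫ w, ‖g w‖) *
        Real.exp (-(|mu| / 24 * ‖z‖ ^ 2)) := by
  refine (norm_twConv_le hg mu (D := 4 ^ k * 2 ^ n * Real.exp (|mu| / 12 * r ^ 2) *
    Real.exp (-(|mu| / 24 * ‖z‖ ^ 2))) z fun w hw => ?_).trans (le_of_eq (by ring))
  rw [Complex.norm_real, Real.norm_eq_abs, lagFun_eq_lagR, mul_assoc (4 ^ k * 2 ^ n : ℝ)]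
  refine (abs_lagR_le_gauss hn k (abs_nonneg mu) (by positivity)).trans ?_
  rw [← Real.exp_add]
  gcongr
  have h1 := hr _ hw
  have h2 : ‖z‖ ≤ r + ‖w‖ := by
    calc ‖z‖ = ‖(z - w) + w‖ := by rw [sub_add_cancel]
      _ ≤ _ := (norm_add_le _ _).trans (by linarith)
  have h3 : ‖z‖ ^ 2 ≤ 2 * r ^ 2 + 2 * ‖w‖ ^ 2 := by
    have := norm_nonneg z
    nlinarith [sq_nonneg (r - ‖w‖)]
  nlinarith [abs_nonneg mu]

lemma integrable_sq_twConv_lagFun (hn : 1 ≤ n) {g : Cn n → ℂ} (hg : Integrable g) {r : ℝ}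
    (hr : ∀ w, g w ≠ 0 → ‖w‖ ≤ r) {mu : ℝ} (hmu : mu ≠ 0) (k : ℕ) :
    Integrable fun z => ‖twConv n mu g (fun w => (lagFun n k mu w : ℂ)) z‖ ^ 2 := by
  have hc := continuous_twConv hg mu (u := fun w => (lagFun n k mu w : ℂ)) (by fun_prop)
    (norm_lagFun_le hn hmu k)
  have hb : 0 < |mu| := abs_pos.2 hmu
  set A := 4 ^ k * 2 ^ n * Real.exp (|mu| / 12 * r ^ 2) * ∫ w, ‖g w‖ with hA
  refine ((integrable_gauss (n := n) (p := |mu| / 12) (by positivity)).const_mul (A ^ 2)).mono'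
    (Continuous.aestronglyMeasurable (by fun_prop)) (Eventually.of_forall fun z => ?_)
  rw [Real.norm_of_nonneg (by positivity)]
  calc _ ≤ (A * Real.exp (-(|mu| / 24 * ‖z‖ ^ 2))) ^ 2 := by
        gcongr
        exact norm_twConv_lagFun_le_gauss hn hg hr k z
    _ = _ := by
      rw [mul_pow, ← Real.exp_nat_mul]
      congr 2
      push_cast
      ring

end TwistedSeries

section Mollifier

variable {n : ℕ}

lemma BoxFun.norm_le_of_fLam_ne_zero {τ M : ℝ} {F : Cn n × ℝ → ℝ} (hF : BoxFun τ M F) {mu : ℝ}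
    {v : Cn n} (h : fLam n (fun x => (F x : ℂ)) mu v ≠ 0) : ‖v‖ ≤ τ := by
  by_contra hcon
  refine h (integral_eq_zero_of_ae (Eventually.of_forall fun t => ?_))
  have : F (v, t) = 0 := by
    by_contra h1
    exact hcon (hF.supp _ h1).1
  simp [this]

lemma BoxFun.hasCompactSupport_fLam {τ M : ℝ} {F : Cn n × ℝ → ℝ} (hF : BoxFun τ M F) (mu : ℝ) :
    HasCompactSupport (fLam n (fun x => (F x : ℂ)) mu) := by
  refine HasCompactSupport.intro (isCompact_closedBall (0 : Cn n) τ) fun v hv => ?_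
  by_contra h
  exact hv (by simpa using hF.norm_le_of_fLam_ne_zero h)

lemma BoxFun.integrable_fLam {τ M : ℝ} {F : Cn n × ℝ → ℝ} (hF : BoxFun τ M F) (mu : ℝ) :
    Integrable (fLam n (fun x => (F x : ℂ)) mu) :=
  (hF.continuous_fLam mu).integrable_of_hasCompactSupport (hF.hasCompactSupport_fLam mu)

lemma BoxFun.integrable_slice {τ M : ℝ} {F : Cn n × ℝ → ℝ} (hF : BoxFun τ M F) (v : Cn n) :
    Integrable fun t : ℝ => F (v, t) := by
  have hc := hF.cont
  refine Continuous.integrable_of_hasCompactSupport (by fun_prop)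
    (HasCompactSupport.intro (isCompact_closedBall (0 : ℝ) (2 * τ)) fun t ht => ?_)
  by_contra h
  exact ht (by simpa using (hF.supp _ h).2)

lemma BoxFun.re_fLam {τ M : ℝ} {F : Cn n × ℝ → ℝ} (hF : BoxFun τ M F) (mu : ℝ) (v : Cn n) :
    (fLam n (fun x => (F x : ℂ)) mu v).re = ∫ t : ℝ, Real.cos (mu * t) * F (v, t) := by
  have hi : Integrable fun t : ℝ => Complex.exp (Complex.I * mu * t) * (F (v, t) : ℂ) :=
    (hF.integrable_slice v).ofReal.bdd_mul (c := 1) (Continuous.aestronglyMeasurable (by fun_prop))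
      (Eventually.of_forall fun t => (norm_exp_I_mul mu t).le)
  have h := integral_re hi
  refine h.symm.trans (integral_congr_ae (Eventually.of_forall fun t => ?_))
  have e : Complex.I * mu * t = ((mu * t : ℝ) : ℂ) * Complex.I := by
    push_cast
    ring
  simp only [e, RCLike.re_to_complex, Complex.re_mul_ofReal, Complex.exp_ofReal_mul_I_re]

lemma BoxFun.eig_ne_zero {τ M : ℝ} {F : Cn n × ℝ → ℝ} (hF : BoxFun τ M F) (hF0 : ∀ x, 0 ≤ F x)
    (h0 : 0 < F 0) {k : ℕ} {mu : ℝ} (hcos : |mu| * (2 * τ) ≤ 1)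
    (hφ : ∀ v : Cn n, ‖v‖ ≤ τ → 0 < lagFun n k mu v) {R : ℂ} (hR : IsEig n k mu F R) : R ≠ 0 := by
  have hτ : 0 ≤ τ := by simpa using (hF.supp 0 h0.ne').1
  have hcosF : ∀ v t, 0 ≤ Real.cos (mu * t) * F (v, t) := by
    intro v t
    by_cases h : F (v, t) = 0
    · simp [h]
    · refine mul_nonneg (Real.cos_pos_of_le_one ?_).le (hF0 _)
      have := (hF.supp _ h).2
      rw [abs_mul]
      exact (mul_le_mul_of_nonneg_left this (abs_nonneg mu)).trans hcos
  have hre : ∀ v, 0 ≤ (fLam n (fun x => (F x : ℂ)) mu v).re := fun v => by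
    rw [hF.re_fLam]
    exact integral_nonneg (hcosF v)
  have hc := hF.cont
  have hre0 : 0 < (fLam n (fun x => (F x : ℂ)) mu 0).re := by
    rw [hF.re_fLam]
    refine Continuous.integral_pos_of_hasCompactSupport_nonneg_nonzero (x := 0) (by fun_prop)
      (HasCompactSupport.intro (isCompact_closedBall (0 : ℝ) (2 * τ)) fun t ht => ?_) (hcosF 0) ?_
    · have : F (0, t) = 0 := by
        by_contra h
        exact ht (by simpa using (hF.supp _ h).2)
      simp [this]
    · have h1 : F (0, 0) ≠ 0 := h0.ne'
      simpa using h1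
  have hlc := hF.continuous_fLam mu
  have hi : Integrable fun v : Cn n => fLam n (fun x => (F x : ℂ)) mu (-v) *
      (lagFun n k mu v : ℂ) := by
    refine Continuous.integrable_of_hasCompactSupport (by fun_prop)
      (HasCompactSupport.intro (isCompact_closedBall (0 : Cn n) τ) fun v hv => ?_)
    have : fLam n (fun x => (F x : ℂ)) mu (-v) = 0 := by
      by_contra h
      exact hv (by simpa using hF.norm_le_of_fLam_ne_zero h)
    simp [this]
  intro hR0
  have h := hR 0
  rw [hR0, zero_mul, twConv_eq] at h
  have e : ∀ v : Cn n, fLam n (fun x => (F x : ℂ)) mu (0 - v) * (lagFun n k mu v : ℂ) * twE mu 0 v =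
      fLam n (fun x => (F x : ℂ)) mu (-v) * (lagFun n k mu v : ℂ) := by
    intro v
    simp [twE, imZW]
  simp only [e] at h
  have h2 := (integral_re hi).trans (congrArg Complex.re h)
  refine (ne_of_gt ?_) h2
  refine Continuous.integral_pos_of_hasCompactSupport_nonneg_nonzero (x := 0) ?_
    (HasCompactSupport.intro (isCompact_closedBall (0 : Cn n) τ) fun v hv => ?_) (fun v => ?_) ?_
  · exact Complex.continuous_re.comp (by fun_prop)
  · have : fLam n (fun x => (F x : ℂ)) mu (-v) = 0 := by
      by_contra h
      exact hv (by simpa using hF.norm_le_of_fLam_ne_zero h)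
    simp [this]
  · by_cases hv : fLam n (fun x => (F x : ℂ)) mu (-v) = 0
    · simp [hv]
    · have h3 := hφ v (by simpa using hF.norm_le_of_fLam_ne_zero hv)
      simpa using mul_nonneg (hre (-v)) h3.le
  · have h3 := hφ 0 (by simpa using hτ)
    simpa using ⟨hre0.ne', h3.ne'⟩

lemma exists_mollifier (hn : 1 ≤ n) {K : ℝ} (hK : 0 < K) {mu : ℝ} (hmu : mu ≠ 0) (k₀ : ℕ) :
    ∃ F : Cn n × ℝ → ℝ, BoxFun (1 / 2) 1 F ∧ ∃ C, 0 ≤ C ∧ ∃ R : ℕ → ℂ, R k₀ ≠ 0 ∧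
      ∀ k, IsEig n k mu F (R k) ∧
        ‖R k‖ ≤ C * Real.exp (-(K * Real.sqrt (Real.sqrt ((2 * k + n) * |mu|)))) := by
  have hm : 0 < |mu| := abs_pos.2 hmu
  have hφ0 : 0 < lagFun n k₀ mu 0 := by
    rw [lagFun_eq_lagR]
    simpa using lagR_zero_pos hn k₀ |mu|
  have hev : ∀ᶠ v in nhds (0 : Cn n), 0 < lagFun n k₀ mu v :=
    (continuous_lagFun k₀ mu).continuousAt.eventually (lt_mem_nhds hφ0)
  obtain ⟨δ, hδ, hδφ⟩ := Metric.eventually_nhds_iff.1 hev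
  set ε := min (min (1 / 2) (1 / (2 * |mu|))) (δ / 2) with hε
  have hε0 : 0 < ε := by positivity
  have hε1 : ε ≤ 1 / 2 := (min_le_left _ _).trans (min_le_left _ _)
  have hε2 : ε ≤ 1 / (2 * |mu|) := (min_le_left _ _).trans (min_le_right _ _)
  have hε3 : ε < δ := (min_le_right _ _).trans_lt (by linarith)
  obtain ⟨F, hF, hF0, hF1, C, hC0, hC⟩ := exists_boxFun_decay (n := n) hn
    (Θ := fun t => K * (Real.sqrt (1 + t))⁻¹)
    (fun t ht => mul_pos hK (inv_pos.2 (Real.sqrt_pos.2 (by linarith))))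
    (fun s hs t ht hst => mul_le_mul_of_nonneg_left (antitoneOn_inv_sqrt hs ht hst) hK.le)
    (by simpa using tendsto_inv_sqrt_one_add.const_mul K)
    (by simpa only [mul_div_assoc] using summable_inv_sqrt_div.mul_left K) hε0 (by linarith)
  choose R hR hRb using fun k => hC k mu hmu
  refine ⟨F, hF.mono hε1, C * Real.exp K, by positivity, R, ?_, fun k => ⟨hR k, ?_⟩⟩
  · refine hF.eig_ne_zero hF0 hF1 ?_ (fun v hv => hδφ ?_) (hR k₀)
    · rw [le_div_iff₀ (by positivity)] at hε2
      linarith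
    · rw [dist_zero_right]
      exact hv.trans_lt hε3
  · refine (hRb k).trans ?_
    set y := Real.sqrt ((2 * k + n) * |mu|) with hy
    have hy0 : 0 ≤ y := Real.sqrt_nonneg _
    have h1 : 0 < Real.sqrt (1 + y) := Real.sqrt_pos.2 (by linarith)
    have h2 : Real.sqrt (1 + y) ^ 2 = 1 + y := Real.sq_sqrt (by linarith)
    have h3 : Real.sqrt y ≤ Real.sqrt (1 + y) := Real.sqrt_le_sqrt (by linarith)
    have h4 : Real.sqrt y - 1 ≤ y * (Real.sqrt (1 + y))⁻¹ := by
      rw [← div_eq_mul_inv, le_div_iff₀ h1]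
      have h5 : 1 ≤ Real.sqrt (1 + y) := by
        rw [Real.one_le_sqrt]
        linarith
      nlinarith
    rw [mul_assoc, ← Real.exp_add]
    gcongr
    have := mul_le_mul_of_nonneg_left h4 hK.le
    linarith

lemma summable_choose_mul_exp (hn : 1 ≤ n) {b : ℝ} (hb : 0 < b) :
    Summable fun k : ℕ => ((k + n - 1).choose k : ℝ) *
      Real.exp (-Real.sqrt (Real.sqrt ((2 * k + n) * b))) := by
  set N := 4 * (n + 2) with hN
  have h2 : Summable fun k : ℕ => ((k : ℝ) + 1 : ℝ)⁻¹ ^ 2 := by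
    have := (summable_nat_add_iff 1).2 (Real.summable_nat_pow_inv.2 one_lt_two)
    simpa using this
  refine Summable.of_nonneg_of_le (fun k => by positivity) (fun k => ?_)
    (h2.mul_left (N.factorial / b ^ (n + 2)))
  set q : ℝ := 2 * k + n with hq
  have hn' : (1 : ℝ) ≤ n := by exact_mod_cast hn
  have hk0 : (0 : ℝ) ≤ k := Nat.cast_nonneg k
  have hq1 : (k : ℝ) + 1 ≤ q := by rw [hq]; linarith
  have hq0 : 0 < q := by linarith
  set x := Real.sqrt (Real.sqrt (q * b)) with hx
  have hx0 : 0 < x := Real.sqrt_pos.2 (Real.sqrt_pos.2 (by positivity))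
  have hx4 : x ^ 4 = q * b := by
    rw [show x ^ 4 = (x ^ 2) ^ 2 by ring, hx, Real.sq_sqrt (Real.sqrt_nonneg _),
      Real.sq_sqrt (by positivity)]
  have hexp : Real.exp (-x) ≤ N.factorial / (q * b) ^ (n + 2) := by
    have h3 := Real.pow_div_factorial_le_exp x hx0.le N
    calc _ = (Real.exp x)⁻¹ := Real.exp_neg x
      _ ≤ (x ^ N / N.factorial)⁻¹ := by gcongr
      _ = _ := by rw [inv_div, hN, pow_mul, hx4]
  have hch : ((k + n - 1).choose k : ℝ) ≤ q ^ n := by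
    have h4 : (k + n - 1).choose k = (k + n - 1).choose (n - 1) := by
      rw [← Nat.choose_symm_of_eq_add]
      omega
    have h5 : ((k + n - 1).choose k : ℝ) ≤ ((k + n - 1 : ℕ) : ℝ) ^ (n - 1) := by
      rw [h4]
      exact_mod_cast Nat.choose_le_pow _ _
    have h6 : ((k + n - 1 : ℕ) : ℝ) ≤ q := by
      have : ((k + n - 1 : ℕ) : ℝ) ≤ ((2 * k + n : ℕ) : ℝ) := by exact_mod_cast (by omega)
      simpa [hq] using this
    calc _ ≤ _ := h5
      _ ≤ q ^ (n - 1) := by gcongr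
      _ ≤ q ^ n := pow_le_pow_right₀ (by linarith) (by omega)
  calc _ ≤ q ^ n * (N.factorial / (q * b) ^ (n + 2)) := by gcongr
    _ = N.factorial / b ^ (n + 2) * q⁻¹ ^ 2 := by
      rw [mul_pow, pow_add q]
      field_simp
    _ ≤ _ := by gcongr

end Mollifier

section Vanishing

variable {n : ℕ}

lemma twConv_const_mul (mu : ℝ) (g u : Cn n → ℂ) (c : ℂ) (z : Cn n) :
    twConv n mu g (fun w => c * u w) z = c * twConv n mu g u z := by
  rw [twConv_eq, twConv_eq, ← integral_const_mul]
  congr 1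
  ext w
  ring

lemma hasSum_mollified (hn : 1 ≤ n) {g : Cn n → ℂ} (hg : Integrable g) {mu : ℝ} (hmu : mu ≠ 0)
    {τ M : ℝ} {F : Cn n × ℝ → ℝ} (hF : BoxFun τ M F) {R : ℕ → ℂ} (hR : ∀ k, IsEig n k mu F (R k))
    {C : ℝ} (hC : ∀ k, ‖R k‖ ≤ C) {s : ℝ} (hs : |s| < 1) (z : Cn n) :
    HasSum (fun k => R k * twConv n mu g (fun w => (lagFun n k mu w : ℂ)) z * (s : ℂ) ^ k)
      (twConv n mu g (twConv n mu (fLam n (fun x => (F x : ℂ)) mu)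
        fun w => (lagGen n mu s w : ℂ)) z) := by
  have h1 : ∀ x : Cn n, HasSum (fun k => R k * (lagFun n k mu x : ℂ) * (s : ℂ) ^ k)
      (twConv n mu (fLam n (fun x => (F x : ℂ)) mu) (fun w => (lagGen n mu s w : ℂ)) x) := by
    intro x
    have h := hasSum_twConv hn (hF.integrable_fLam mu) mu
      (u := fun k w => (lagFun n k mu w : ℂ)) (fun k => by fun_prop)
      (norm_lagFun_le hn hmu) hs (fun w => hasSum_lagFun_lagGen hn mu w hs) x
    simpa only [fun k => hR k x] using h
  have h := hasSum_twConv hn hg mu (u := fun k w => R k * (lagFun n k mu w : ℂ))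
    (fun k => by fun_prop) (D := C) (fun k x => ?_) hs h1 z
  · simpa only [twConv_const_mul] using h
  · rw [norm_mul]
    have h2 := norm_lagFun_le hn hmu k x
    rw [one_mul] at h2
    exact mul_le_mul (hC k) h2 (norm_nonneg _) ((norm_nonneg _).trans (hC k))

theorem twConv_lagFun_eq_zero (hn : 1 ≤ n) {Θ : ℝ → ℝ} (hpos : ∀ t, 0 ≤ t → 0 ≤ Θ t)
    (hdec : AntitoneOn Θ (Set.Ici 0))
    (hinteg : ¬ IntegrableOn (fun t : ℝ => Θ t / t) (Set.Ici 1) (volume : Measure ℝ))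
    {g : Cn n → ℂ} (hg : Integrable g) {r : ℝ} (hr : ∀ w, g w ≠ 0 → ‖w‖ ≤ r) {mu : ℝ} (hmu : mu ≠ 0)
    {C : ℝ} (hC0 : 0 ≤ C)
    (hC : ∀ k : ℕ, ∫ z, ‖twConv n mu g (fun w => (lagFun n k mu w : ℂ)) z‖ ^ 2 ≤
      C * ((k + n - 1).choose k : ℝ) * Real.exp (-(Real.sqrt ((2 * k + n) * |mu|) *
        Θ (Real.sqrt ((2 * k + n) * |mu|))))) (k₀ : ℕ) {z₀ : Cn n} (hz1 : r + 1 < ‖z₀‖)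
    (hz2 : ‖z₀‖ < r + 2) : twConv n mu g (fun w => (lagFun n k₀ mu w : ℂ)) z₀ = 0 := by
  have hm : 0 < |mu| := abs_pos.2 hmu
  set c : ℕ → Cn n → ℂ := fun k => twConv n mu g (fun w => (lagFun n k mu w : ℂ)) with hcdef
  have hcc : ∀ k, Continuous (c k) := fun k =>
    continuous_twConv hg mu (by fun_prop) (norm_lagFun_le hn hmu k)
  set G := ∫ w, ‖g w‖ with hG
  have hG0 : 0 ≤ G := integral_nonneg fun _ => norm_nonneg _
  have hcb : ∀ k z, ‖c k z‖ ≤ G * ((k + n - 1).choose k : ℝ) := fun k z =>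
    (norm_twConv_le hg mu z fun w _ => norm_lagFun_le hn hmu k w).trans (le_of_eq (by ring))
  set B : Set (Cn n) := {z | r + 1 < ‖z‖ ∧ ‖z‖ < r + 2} with hB
  have hBo : IsOpen B := (isOpen_lt continuous_const continuous_norm).inter
    (isOpen_lt continuous_norm continuous_const)
  have hBfin : volume B < ⊤ := by
    refine lt_of_le_of_lt (measure_mono fun z hz => ?_)
      (measure_ball_lt_top (x := (0 : Cn n)) (r := r + 2))
    simpa using hz.2
  set h : Cn n → ℂ := B.indicator fun z => (starRingEnd ℂ) (c k₀ z) with hh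
  have hhb : ∀ z, ‖h z‖ ≤ G * ((k₀ + n - 1).choose k₀ : ℝ) := by
    intro z
    by_cases hz : z ∈ B
    · simpa [hh, hz] using hcb k₀ z
    · simp only [hh, hz, not_false_eq_true, Set.indicator_of_notMem, norm_zero]
      positivity
  have hhi : Integrable h := by
    refine (integrable_indicator_iff hBo.measurableSet).2 (Measure.integrableOn_of_bounded
      (M := G * ((k₀ + n - 1).choose k₀ : ℝ)) hBfin.ne ?_ ?_)
    · exact Continuous.aestronglyMeasurable (continuous_conj.comp (hcc k₀))
    · exact Eventually.of_forall fun z => by simpa using hcb k₀ z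
  have hh2i : Integrable fun z => ‖h z‖ ^ 2 := by
    have := hhi.norm.mul_bdd (c := G * ((k₀ + n - 1).choose k₀ : ℝ)) hhi.norm.aestronglyMeasurable
      (Eventually.of_forall fun z => by simpa using hhb z)
    simpa only [← sq] using this
  have hcsq : ∀ k, Integrable fun z => ‖c k z‖ ^ 2 := fun k =>
    integrable_sq_twConv_lagFun hn hg hr hmu k
  set H := ∫ z, ‖h z‖ ^ 2 with hH
  have hH0 : 0 ≤ H := integral_nonneg fun _ => by positivity
  set b : ℕ → ℂ := fun k => ∫ z, h z * c k z with hbdef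
  set y : ℕ → ℝ := fun k => Real.sqrt ((2 * k + n) * |mu|) with hy
  have hb : ∀ k, ‖b k‖ ≤ (H + C) / 2 * (((k + n - 1).choose k : ℝ) *
      Real.exp (-(y k * Θ (y k) / 2))) := by
    intro k
    have hch1 : (1 : ℝ) ≤ ((k + n - 1).choose k : ℝ) := by
      exact_mod_cast Nat.choose_pos (by omega)
    set δ := ((k + n - 1).choose k : ℝ) * Real.exp (-(y k * Θ (y k) / 2)) with hδ
    have hδ0 : 0 < δ := by positivity
    have h1 : ∫ z, ‖c k z‖ ^ 2 ≤ C * δ ^ 2 := by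
      refine (hC k).trans ?_
      have e : Real.exp (-(y k * Θ (y k))) = Real.exp (-(y k * Θ (y k) / 2)) ^ 2 := by
        rw [← Real.exp_nat_mul]
        congr 1
        push_cast
        ring
      change C * ((k + n - 1).choose k : ℝ) * Real.exp (-(y k * Θ (y k))) ≤ _
      rw [e, hδ, mul_pow, mul_assoc]
      gcongr
      exact le_self_pow₀ hch1 two_ne_zero
    calc ‖b k‖ ≤ ∫ z, (δ * ‖h z‖ ^ 2 + δ⁻¹ * ‖c k z‖ ^ 2) / 2 := by
          refine norm_integral_le_of_norm_le
            (((hh2i.const_mul δ).add ((hcsq k).const_mul δ⁻¹)).div_const 2)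
            (Eventually.of_forall fun z => ?_)
          rw [norm_mul, le_div_iff₀ two_pos]
          have h2 : 0 ≤ δ⁻¹ * (δ * ‖h z‖ - ‖c k z‖) ^ 2 := by positivity
          have h3 : δ⁻¹ * (δ * ‖h z‖ - ‖c k z‖) ^ 2 =
              δ * ‖h z‖ ^ 2 + δ⁻¹ * ‖c k z‖ ^ 2 - ‖h z‖ * ‖c k z‖ * 2 := by
            field_simp
            ring
          linarith
      _ = (δ * H + δ⁻¹ * ∫ z, ‖c k z‖ ^ 2) / 2 := by
          rw [integral_div, integral_add (hh2i.const_mul δ) ((hcsq k).const_mul δ⁻¹),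
            integral_const_mul, integral_const_mul]
      _ ≤ (δ * H + δ⁻¹ * (C * δ ^ 2)) / 2 := by gcongr
      _ = _ := by
          field_simp
  have hΘ0 := hpos 0 le_rfl
  obtain ⟨F, hF, C₁, hC₁, R, hR0, hR⟩ := exists_mollifier (n := n) hn (K := 5 + Θ 0 / 2)
    (by positivity) hmu k₀
  have hRC : ∀ k, ‖R k‖ ≤ C₁ := fun k => (hR k).2.trans (mul_le_of_le_one_right hC₁ (by
    rw [Real.exp_le_one_iff, neg_nonpos]
    positivity))
  have hzero : (fun k => R k * b k) = 0 := by
    refine coeff_eq_zero_of_flat hpos hdec hinteg n hm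
      (w := fun k => C₁ * ((H + C) / 2) * (((k + n - 1).choose k : ℝ) *
        Real.exp (-Real.sqrt (Real.sqrt ((2 * k + n) * |mu|)))))
      ((summable_choose_mul_exp hn hm).mul_left _) (fun k => ?_) fun m => ?_
    · rw [norm_mul]
      refine (mul_le_mul (hR k).2 (hb k) (norm_nonneg _) (by positivity)).trans (le_of_eq ?_)
      simp only [hy]
      set x := Real.sqrt ((2 * k + n) * |mu|)
      have e1 : Real.exp (-((5 + Θ 0 / 2) * Real.sqrt x)) * Real.exp (-(x * Θ x / 2)) =
          Real.exp (-Real.sqrt x) * Real.exp (-(x * Θ x / 2 + (4 + Θ 0 / 2) * Real.sqrt x)) := by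
        rw [← Real.exp_add, ← Real.exp_add]
        congr 1
        ring
      linear_combination C₁ * ((H + C) / 2) * ((k + n - 1).choose k : ℝ) * e1
    · obtain ⟨D, hD0, hD⟩ := exists_lagGen_le_pow (n := n) hmu (r := 1 / 2) (by norm_num) m
      set f₁ := fLam n (fun x => (F x : ℂ)) mu with hf₁
      refine ⟨(∫ z, ‖h z‖) * (D * (∫ w, ‖f₁ w‖) * G), fun s hs0 hs1 => ?_⟩
      have hs : |s| < 1 := by rwa [abs_of_pos hs0]
      have hsum := hasSum_integral_mul_pow hn hhi (u := fun k z => R k * c k z)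
        (fun k => Continuous.aestronglyMeasurable (by have := hcc k; fun_prop)) (D := C₁ * G)
        (fun k z => by
          rw [norm_mul, mul_assoc]
          exact mul_le_mul (hRC k) (hcb k z) (norm_nonneg _) hC₁) hs
        (fun z => hasSum_mollified hn hg hmu hF (fun k => (hR k).1) hRC hs z)
      have e : ∀ k, R k * b k = ∫ z, h z * (R k * c k z) := by
        intro k
        rw [hbdef, ← integral_const_mul]
        congr 1
        ext z
        ring
      simp only [e]
      rw [hsum.tsum_eq, mul_assoc, ← integral_mul_const]
      refine norm_integral_le_of_norm_le (hhi.norm.mul_const _) (Eventually.of_forall fun z => ?_)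
      rw [norm_mul]
      by_cases hz : z ∈ B
      · refine mul_le_mul_of_nonneg_left ?_ (norm_nonneg _)
        refine (norm_twConv_le hg mu (D := D * (1 - s) ^ m * ∫ w, ‖f₁ w‖) z
          fun w hw => ?_).trans (le_of_eq (by rw [← hG]; ring))
        refine norm_twConv_le (hF.integrable_fLam mu) mu w fun v hv => ?_
        have h1 := hr _ hw
        have h2 := hF.norm_le_of_fLam_ne_zero hv
        have h3 : ‖z‖ ≤ ‖z - w‖ + ‖w - v‖ + ‖v‖ := by
          calc ‖z‖ = ‖(z - w) + (w - v) + v‖ := by congr 1; abel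
            _ ≤ _ := norm_add₃_le
        have h4 := hz.1
        rw [Complex.norm_real, Real.norm_of_nonneg (lagGen_nonneg mu hs1 v)]
        exact hD s hs0 hs1 v (by linarith)
      · have : h z = 0 := by simp [hh, hz]
        simp [this]
  have hb0 : b k₀ = 0 := (mul_eq_zero.1 (congrFun hzero k₀)).resolve_left hR0
  have hinteg0 : ∫ z in B, ‖c k₀ z‖ ^ 2 = 0 := by
    have e : ∀ z, h z * c k₀ z = ((B.indicator (fun z => ‖c k₀ z‖ ^ 2) z : ℝ) : ℂ) := by
      intro z
      by_cases hz : z ∈ B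
      · simp [hh, hz, Complex.conj_mul']
      · simp [hh, hz]
    simp only [hbdef, e] at hb0
    rw [integral_complex_ofReal, integral_indicator hBo.measurableSet] at hb0
    exact_mod_cast hb0
  have hae := (setIntegral_eq_zero_iff_of_nonneg_ae (Eventually.of_forall fun z => sq_nonneg _)
    (hcsq k₀).integrableOn).1 hinteg0
  have heq := Measure.eqOn_open_of_ae_eq hae hBo
    (by have := hcc k₀; fun_prop) continuousOn_const (x := z₀) ⟨hz1, hz2⟩
  simpa using heq

end Vanishing

section SymplecticFourier

variable {n : ℕ}

/-- Exponential integrals against a compactly supported integrable function are entire. -/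
lemma differentiable_integral_mul_cexp {X : Type*} [MeasurableSpace X] {m : Measure X} {g : X → ℂ}
    (hg : Integrable g m) {φ : X → ℝ} (hφ : AEStronglyMeasurable φ m) {M : ℝ}
    (hM : ∀ w, g w ≠ 0 → |φ w| ≤ M) :
    Differentiable ℂ fun ζ : ℂ => ∫ w, g w * Complex.exp (ζ * ((φ w : ℝ) * Complex.I)) ∂m := by
  intro ζ₀
  have hφ' : AEStronglyMeasurable (fun w => ((φ w : ℝ) : ℂ) * Complex.I) m :=
    (Complex.continuous_ofReal.comp_aestronglyMeasurable hφ).mul_const _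
  have hmeas : ∀ ζ : ℂ,
      AEStronglyMeasurable (fun w => Complex.exp (ζ * ((φ w : ℝ) * Complex.I))) m := fun ζ =>
    Complex.continuous_exp.comp_aestronglyMeasurable (hφ'.const_mul ζ)
  have hexp : ∀ ζ ∈ Metric.ball ζ₀ 1, ∀ w, g w ≠ 0 →
      ‖Complex.exp (ζ * ((φ w : ℝ) * Complex.I))‖ ≤ Real.exp ((‖ζ₀‖ + 1) * M) := by
    intro ζ hζ w hw
    rw [Complex.norm_exp]
    refine Real.exp_le_exp.2 ((Complex.re_le_norm _).trans ?_)
    rw [norm_mul, norm_mul, Complex.norm_I, mul_one, Complex.norm_real, Real.norm_eq_abs]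
    have h1 : ‖ζ‖ ≤ ‖ζ₀‖ + 1 := by
      have h2 : ‖ζ - ζ₀‖ < 1 := by simpa [dist_eq_norm] using hζ
      have h3 := norm_add_le (ζ - ζ₀) ζ₀
      rw [sub_add_cancel] at h3
      linarith
    exact mul_le_mul h1 (hM w hw) (abs_nonneg _) (by positivity)
  have hb : ∀ ζ ∈ Metric.ball ζ₀ 1, ∀ w,
      ‖g w * Complex.exp (ζ * ((φ w : ℝ) * Complex.I))‖ ≤ ‖g w‖ * Real.exp ((‖ζ₀‖ + 1) * M) := by
    intro ζ hζ w
    rw [norm_mul]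
    by_cases hw : g w = 0
    · simp [hw]
    · exact mul_le_mul_of_nonneg_left (hexp ζ hζ w hw) (norm_nonneg _)
  refine (hasDerivAt_integral_of_dominated_loc_of_deriv_le (s := Metric.ball ζ₀ 1)
    (F' := fun ζ w => g w * (Complex.exp (ζ * ((φ w : ℝ) * Complex.I)) * ((φ w : ℝ) * Complex.I)))
    (bound := fun w => ‖g w‖ * (Real.exp ((‖ζ₀‖ + 1) * M) * M))
    (Metric.ball_mem_nhds _ one_pos)
    (Eventually.of_forall fun ζ => hg.aestronglyMeasurable.mul (hmeas ζ))
    ((hg.norm.mul_const _).mono' (hg.aestronglyMeasurable.mul (hmeas ζ₀))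
      (Eventually.of_forall (hb ζ₀ (Metric.mem_ball_self one_pos))))
    (hg.aestronglyMeasurable.mul ((hmeas ζ₀).mul hφ'))
    (Eventually.of_forall fun w ζ hζ => ?_) (hg.norm.mul_const _)
    (Eventually.of_forall fun w ζ _ => ?_)).2.differentiableAt
  · rw [norm_mul]
    by_cases hw : g w = 0
    · simp [hw]
    · rw [norm_mul, norm_mul, Complex.norm_I, mul_one, Complex.norm_real, Real.norm_eq_abs]
      refine mul_le_mul_of_nonneg_left ?_ (norm_nonneg _)
      exact mul_le_mul (hexp ζ hζ w hw) (hM w hw) (abs_nonneg _) (Real.exp_pos _).le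
  · have h := ((hasDerivAt_id ζ).mul_const (((φ w : ℝ) : ℂ) * Complex.I)).cexp.const_mul (g w)
    simpa using h

lemma integral_mul_twE_eq_zero (hn : 1 ≤ n) {g : Cn n → ℂ} (hg : Integrable g) {mu : ℝ}
    (hmu : mu ≠ 0) {z : Cn n}
    (h0 : ∀ k, twConv n mu g (fun w => (lagFun n k mu w : ℂ)) z = 0) :
    ∫ w, g w * twE (-mu) z w = 0 := by
  have hgen : ∀ s : ℝ, |s| < 1 → twConv n mu g (fun w => (lagGen n mu s w : ℂ)) z = 0 := by
    intro s hs
    have h := hasSum_twConv hn hg mu (u := fun k w => (lagFun n k mu w : ℂ))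
      (fun k => by fun_prop) (norm_lagFun_le hn hmu) hs
      (fun w => hasSum_lagFun_lagGen hn mu w hs) z
    simp only [h0, zero_mul] at h
    exact h.unique hasSum_zero
  set p : ℝ → ℝ := fun s => |mu| / 4 * ((1 + s) / (1 - s)) with hp
  have hgauss : ∀ s : ℝ, |s| < 1 →
      ∫ w, g (z - w) * twE mu z w * (Real.exp (-(p s * ‖w‖ ^ 2)) : ℂ) = 0 := by
    intro s hs
    have h1 : 1 - s ≠ 0 := by
      have := (abs_lt.1 hs).2
      linarith
    have h := hgen s hs
    rw [twConv_eq] at h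
    have e : ∀ w : Cn n, g (z - w) * (lagGen n mu s w : ℂ) * twE mu z w =
        (((1 - s)⁻¹ ^ n : ℝ) : ℂ) *
          (g (z - w) * twE mu z w * (Real.exp (-(p s * ‖w‖ ^ 2)) : ℂ)) := by
      intro w
      rw [lagGen, Complex.ofReal_mul]
      ring
    simp only [e] at h
    rw [integral_const_mul] at h
    refine (mul_eq_zero.1 h).resolve_left ?_
    exact Complex.ofReal_ne_zero.2 (pow_ne_zero _ (inv_ne_zero h1))
  have hpt : Tendsto p (nhdsWithin (-1) (Set.Ioi (-1))) (nhds 0) := by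
    have hc : ContinuousAt p (-1) := by
      refine continuousAt_const.mul (ContinuousAt.div (by fun_prop) (by fun_prop) (by norm_num))
    have h := hc.tendsto.mono_left (nhdsWithin_le_nhds (s := Set.Ioi (-1)))
    simpa [hp] using h
  have hs : ∀ᶠ s : ℝ in nhdsWithin (-1) (Set.Ioi (-1)), |s| < 1 := by
    filter_upwards [Ioo_mem_nhdsGT (show (-1 : ℝ) < 1 by norm_num)] with s hs
    exact abs_lt.2 hs
  have hI := integrable_sub_mul_twE hg mu z
  have hlim : Tendsto
      (fun s => ∫ w, g (z - w) * twE mu z w * (Real.exp (-(p s * ‖w‖ ^ 2)) : ℂ))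
      (nhdsWithin (-1) (Set.Ioi (-1))) (nhds (∫ w, g (z - w) * twE mu z w)) := by
    refine tendsto_integral_filter_of_dominated_convergence (fun w => ‖g (z - w) * twE mu z w‖)
      (Eventually.of_forall fun s => hI.aestronglyMeasurable.mul
        (Continuous.aestronglyMeasurable (by fun_prop))) ?_ hI.norm
      (Eventually.of_forall fun w => ?_)
    · filter_upwards [hs] with s hs
      refine Eventually.of_forall fun w => ?_
      rw [norm_mul]
      refine mul_le_of_le_one_right (norm_nonneg _) ?_
      rw [Complex.norm_real, Real.norm_of_nonneg (Real.exp_pos _).le, Real.exp_le_one_iff,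
        neg_nonpos]
      have h1 := abs_lt.1 hs
      have h2 : 0 < 1 - s := by linarith
      have h3 : 0 ≤ 1 + s := by linarith
      positivity
    · have h1 : Tendsto (fun s => Real.exp (-(p s * ‖w‖ ^ 2)))
          (nhdsWithin (-1) (Set.Ioi (-1))) (nhds 1) := by
        have := (hpt.mul_const (‖w‖ ^ 2)).neg.rexp
        simpa using this
      have h2 := ((Complex.continuous_ofReal.tendsto _).comp h1).const_mul (g (z - w) * twE mu z w)
      simpa using h2
  have h1 : ∫ w, g (z - w) * twE mu z w = 0 :=
    tendsto_nhds_unique (hlim.congr' (hs.mono hgauss)) tendsto_const_nhds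
  have h2 := twConv_comm mu g (fun _ => (1 : ℂ)) z
  simp only [twConv_eq, mul_one, one_mul] at h2
  rw [← h2, h1]

/-- If the twisted convolutions of a compactly supported function with all Laguerre functions
vanish on an annulus, then its Fourier transform vanishes. -/
lemma integral_mul_cexp_inner_eq_zero (hn : 1 ≤ n) {g : Cn n → ℂ} (hg : Integrable g) {r : ℝ}
    (hr0 : 0 ≤ r) (hr : ∀ w, g w ≠ 0 → ‖w‖ ≤ r) {mu : ℝ} (hmu : mu ≠ 0)
    (h0 : ∀ k, ∀ z : Cn n, r + 1 < ‖z‖ → ‖z‖ < r + 2 →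
      twConv n mu g (fun w => (lagFun n k mu w : ℂ)) z = 0) (ξ : Cn n) :
    ∫ w, g w * Complex.exp ((inner ℝ ξ w : ℝ) * Complex.I) = 0 := by
  obtain ⟨v, τ, hv, hξ⟩ : ∃ (v : Cn n) (τ : ℝ), ‖v‖ = r + 3 / 2 ∧ ξ = τ • ((-Complex.I) • v) := by
    have hex : ∃ (u : Cn n) (τ : ℝ), ‖u‖ = 1 ∧ Complex.I • ξ = τ • u := by
      by_cases h : ξ = 0
      · refine ⟨EuclideanSpace.single ⟨0, hn⟩ 1, 0, by simp, by simp [h]⟩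
      · refine ⟨(‖ξ‖⁻¹ : ℝ) • (Complex.I • ξ), ‖ξ‖, ?_, ?_⟩
        · rw [norm_smul, norm_smul, Complex.norm_I, one_mul, norm_inv, norm_norm]
          exact inv_mul_cancel₀ (norm_ne_zero_iff.2 h)
        · rw [smul_smul, mul_inv_cancel₀ (norm_ne_zero_iff.2 h), one_smul]
    obtain ⟨u, τ, hu, hξ⟩ := hex
    have hr1 : 0 < r + 3 / 2 := by linarith
    refine ⟨(r + 3 / 2) • u, τ / (r + 3 / 2), ?_, ?_⟩
    · rw [norm_smul, hu, mul_one, Real.norm_of_nonneg hr1.le]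
    · rw [smul_comm (-Complex.I), smul_smul, div_mul_cancel₀ _ hr1.ne', smul_comm, ← hξ, smul_smul]
      simp
  set ψ : ℂ → ℂ := fun ζ => ∫ w, g w * Complex.exp (ζ * ((imZW v w : ℝ) * Complex.I)) with hψ
  have hd : Differentiable ℂ ψ := differentiable_integral_mul_cexp hg
    (Continuous.aestronglyMeasurable (by fun_prop)) (M := ‖v‖ * r) fun w hw =>
      (abs_imZW_le v w).trans (mul_le_mul_of_nonneg_left (hr w hw) (norm_nonneg _))
  have hzero : ∀ t : ℝ, r + 1 < ‖t • v‖ → ‖t • v‖ < r + 2 → ψ ((-(mu / 2 * t) : ℝ) : ℂ) = 0 := by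
    intro t h1 h2
    have h := integral_mul_twE_eq_zero hn hg hmu fun k => h0 k (t • v) h1 h2
    rw [hψ, ← h]
    refine integral_congr_ae (Eventually.of_forall fun w => ?_)
    simp only [twE_eq, imZW_smul_left]
    congr 2
    push_cast
    ring
  have hopen : ∀ᶠ t : ℝ in nhds 1, r + 1 < ‖t • v‖ ∧ ‖t • v‖ < r + 2 := by
    have hc : Continuous fun t : ℝ => ‖t • v‖ := by fun_prop
    have h1 : (fun t : ℝ => ‖t • v‖) 1 = r + 3 / 2 := by simp only [one_smul, hv]
    refine (hc.continuousAt.eventually_const_lt ?_).and (hc.continuousAt.eventually_lt_const ?_)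
    · rw [h1]
      linarith
    · rw [h1]
      linarith
  have hfreq : ∃ᶠ ζ in nhdsWithin ((-(mu / 2 * 1) : ℝ) : ℂ) {((-(mu / 2 * 1) : ℝ) : ℂ)}ᶜ,
      ψ ζ = 0 := by
    have ht : Tendsto (fun t : ℝ => ((-(mu / 2 * t) : ℝ) : ℂ)) (nhdsWithin 1 {1}ᶜ)
        (nhdsWithin ((-(mu / 2 * 1) : ℝ) : ℂ) {((-(mu / 2 * 1) : ℝ) : ℂ)}ᶜ) := by
      refine tendsto_nhdsWithin_iff.2 ⟨?_, ?_⟩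
      · have hc : Continuous fun t : ℝ => ((-(mu / 2 * t) : ℝ) : ℂ) := by fun_prop
        exact hc.continuousAt.tendsto.mono_left nhdsWithin_le_nhds
      · filter_upwards [self_mem_nhdsWithin] with t ht h
        refine ht (?_ : t = 1)
        have h2 := Complex.ofReal_injective h
        exact mul_left_cancel₀ (div_ne_zero hmu two_ne_zero) (neg_injective h2)
    refine ht.frequently (Eventually.frequently ?_)
    filter_upwards [nhdsWithin_le_nhds hopen] with t ht
    exact hzero t ht.1 ht.2
  have hall : ψ = 0 := AnalyticOnNhd.eq_of_frequently_eq
    (hd.differentiableOn.analyticOnNhd isOpen_univ) analyticOnNhd_const hfreq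
  have h := congrFun hall (τ : ℂ)
  rw [Pi.zero_apply] at h
  rw [← h]
  refine integral_congr_ae (Eventually.of_forall fun w => ?_)
  simp only [imZW_eq_inner, hξ, real_inner_smul_left]
  congr 2
  push_cast
  ring

end SymplecticFourier

section FourierInjective

open scoped ContDiff FourierTransform

/-- An integrable function with vanishing Fourier transform vanishes almost everywhere. -/
lemma ae_eq_zero_of_integral_cexp_inner_eq_zero {V : Type*} [NormedAddCommGroup V]
    [InnerProductSpace ℝ V] [FiniteDimensional ℝ V] [MeasurableSpace V] [BorelSpace V]
    {f : V → ℂ} (hf : Integrable f)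
    (h : ∀ ξ : V, ∫ w, f w * Complex.exp ((inner ℝ ξ w : ℝ) * Complex.I) = 0) : f =ᵐ[volume] 0 := by
  refine ae_eq_zero_of_integral_contDiff_smul_eq_zero hf.locallyIntegrable fun g hg hgc => ?_
  have hgc' : HasCompactSupport fun x => (g x : ℂ) := hgc.comp_left Complex.ofReal_zero
  set G : SchwartzMap V ℂ := hgc'.toSchwartzMap (Complex.ofRealCLM.contDiff.comp hg) with hG
  have hflip := VectorFourier.integral_fourierIntegral_smul_eq_flip (L := innerₗ V)
    Real.continuous_fourierChar continuous_inner
    ((𝓕⁻ G : SchwartzMap V ℂ).integrable (μ := volume)) hf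
  have hzero : ∀ x,
      VectorFourier.fourierIntegral Real.fourierChar volume (innerₗ V).flip f x = 0 := by
    intro x
    rw [← h ((-(2 * π)) • x), VectorFourier.fourierIntegral]
    refine integral_congr_ae (Eventually.of_forall fun w => ?_)
    simp only [Circle.smul_def, smul_eq_mul, Real.fourierChar_apply, LinearMap.flip_apply,
      innerₗ_apply_apply, real_inner_smul_left]
    rw [mul_comm]
    congr 3
    push_cast
    ring
  have hGG : ∀ x, VectorFourier.fourierIntegral Real.fourierChar volume (innerₗ V)
      (𝓕⁻ G : SchwartzMap V ℂ) x = G x := by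
    intro x
    have h1 : 𝓕 (𝓕⁻ G) = G := FourierTransform.fourier_fourierInv_eq G
    conv_rhs => rw [← h1, SchwartzMap.fourier_coe]
    rfl
  simp only [hzero, hGG, smul_zero, integral_zero] at hflip
  rw [← hflip]
  rfl

end FourierInjective

section Uniqueness

variable {n : ℕ}

lemma integrable_fLam_of_integrable {f : Hn n → ℂ} (hf : Integrable f) (mu : ℝ) :
    Integrable (fLam n f mu) := by
  have h : Integrable (fun x : Hn n => Complex.exp (Complex.I * mu * x.2) * f x)
      (volume.prod volume) := by
    refine Integrable.bdd_mul (c := 1) hf (Continuous.aestronglyMeasurable (by fun_prop))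
      (Eventually.of_forall fun x => (norm_exp_I_mul mu x.2).le)
  exact h.integral_prod_left

lemma norm_le_of_fLam_ne_zero {f : Hn n → ℂ} {r : ℝ} (hr : ∀ x : Hn n, f x ≠ 0 → ‖x.1‖ ≤ r)
    (mu : ℝ) (w : Cn n) (hw : fLam n f mu w ≠ 0) : ‖w‖ ≤ r := by
  obtain ⟨t, ht⟩ : ∃ t : ℝ, f (w, t) ≠ 0 := by
    by_contra! h
    exact hw (by simp only [fLam, h, mul_zero, integral_zero])
  exact hr (w, t) ht

/-- An integrable function on `ℍⁿ` is determined by its partial Fourier transforms in the central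
variable at nonzero frequencies. -/
lemma ae_eq_zero_of_fLam_ae_eq_zero {f : Hn n → ℂ} (hf : Integrable f)
    (h : ∀ mu : ℝ, mu ≠ 0 → fLam n f mu =ᵐ[volume] 0) : f =ᵐ[volume] 0 := by
  have hf' : Integrable f ((volume : Measure (Cn n)).prod (volume : Measure ℝ)) := hf
  have h1 : ∀ᵐ z : Cn n, ∀ q : ℚ, q ≠ 0 → fLam n f q z = 0 :=
    ae_all_iff.2 fun q => by
      by_cases hq : q = 0
      · exact Eventually.of_forall fun z h => absurd hq h
      · filter_upwards [h q (Rat.cast_ne_zero.2 hq)] with z hz _ using hz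
  have h2 : ∀ᵐ z : Cn n, (fun t : ℝ => f (z, t)) =ᵐ[volume] 0 := by
    filter_upwards [h1, hf'.prod_right_ae] with z hz hi
    have hc : Continuous fun mu : ℝ => fLam n f mu z := by
      unfold fLam
      refine continuous_of_dominated (bound := fun t => ‖f (z, t)‖) (fun mu => ?_)
        (fun mu => Eventually.of_forall fun t => ?_) hi.norm
        (Eventually.of_forall fun t => by fun_prop)
      · exact (Continuous.aestronglyMeasurable (by fun_prop)).mul hi.aestronglyMeasurable
      · rw [norm_mul, norm_exp_I_mul, one_mul]
    have hall : (fun mu : ℝ => fLam n f mu z) = fun _ => 0 := by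
      refine Continuous.ext_on ((Rat.denseRange_cast (𝕜 := ℝ)).sdiff_singleton 0) hc
        continuous_const ?_
      rintro _ ⟨⟨q, rfl⟩, hq⟩
      exact hz q fun h => hq (by simp [h])
    refine ae_eq_zero_of_integral_cexp_inner_eq_zero hi fun ξ => ?_
    rw [← congrFun hall ξ, fLam]
    refine integral_congr_ae (Eventually.of_forall fun t => ?_)
    simp only [mul_comm (f (z, t))]
    congr 2
    simp
    ring
  have h3 : ∫ x : Hn n, ‖f x‖ = 0 := by
    rw [Measure.volume_eq_prod, integral_prod _ hf'.norm]
    refine integral_eq_zero_of_ae ?_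
    filter_upwards [h2] with z hz
    refine integral_eq_zero_of_ae ?_
    filter_upwards [hz] with t ht
    simp [ht]
  have h4 := (integral_eq_zero_iff_of_nonneg (fun _ => norm_nonneg _) hf.norm).1 h3
  filter_upwards [h4] with x hx using norm_eq_zero.1 hx

theorem integrable_of_exists (hn : 1 ≤ n) {Θ : ℝ → ℝ} (hpos : ∀ t, 0 ≤ t → 0 ≤ Θ t)
    (hdec : AntitoneOn Θ (Set.Ici 0)) {f : Hn n → ℂ} (hf : Integrable f) (hfc : HasCompactSupport f)
    (hf0 : ¬ f =ᵐ[volume] 0) {C : ℝ} (hC0 : 0 < C)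
    (hC : ∀ lam : ℝ, lam ≠ 0 → ∀ k : ℕ, |lam| ^ n * ∫ z : Cn n, ‖stri n f k lam z‖ ^ 2 ≤
      C * (((k + n - 1).factorial : ℝ) / ((Nat.factorial k) * (Nat.factorial (n - 1)))) *
        Real.exp (-(Real.sqrt ((2 * k + n) * |lam|) * Θ (Real.sqrt ((2 * k + n) * |lam|))))) :
    IntegrableOn (fun t : ℝ => Θ t / t) (Set.Ici 1) (volume : Measure ℝ) := by
  by_contra hinteg
  refine hf0 (ae_eq_zero_of_fLam_ae_eq_zero hf fun mu hmu => ?_)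
  obtain ⟨r, hr0, hr⟩ : ∃ r : ℝ, 0 ≤ r ∧ ∀ x, f x ≠ 0 → ‖x.1‖ ≤ r := by
    obtain ⟨r, hr⟩ := hfc.isCompact.isBounded.exists_norm_le
    exact ⟨max r 0, le_max_right _ _, fun x hx => (norm_fst_le x).trans
      ((hr x (subset_closure hx)).trans (le_max_left _ _))⟩
  have hm : 0 < |mu| ^ n := pow_pos (abs_pos.2 hmu) n
  have hg := integrable_fLam_of_integrable hf mu
  have hgr := norm_le_of_fLam_ne_zero hr mu
  have hbound : ∀ k : ℕ,
      ∫ z, ‖twConv n mu (fLam n f mu) (fun w => (lagFun n k mu w : ℂ)) z‖ ^ 2 ≤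
        C / |mu| ^ n * ((k + n - 1).choose k : ℝ) * Real.exp (-(Real.sqrt ((2 * k + n) * |mu|) *
          Θ (Real.sqrt ((2 * k + n) * |mu|)))) := by
    intro k
    have h := hC (-mu) (neg_ne_zero.2 hmu) k
    simp only [stri, neg_neg, abs_neg, lagFun_neg_param, ← choose_eq_factorial_div hn] at h
    rw [mul_comm, ← le_div_iff₀ hm] at h
    exact h.trans (le_of_eq (by ring))
  exact ae_eq_zero_of_integral_cexp_inner_eq_zero hg
    (integral_mul_cexp_inner_eq_zero hn hg hr0 hgr hmu fun k z h1 h2 =>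
      twConv_lagFun_eq_zero hn hpos hdec hinteg hg hgr hmu (by positivity) hbound k h1 h2)

end Uniqueness

/-- **Ingham's uncertainty principle for the Strichartz Fourier transform**: for Θ ≥ 0
decreasing to 0, there is a nontrivial compactly supported f ∈ L¹(ℍⁿ) with
|λ|^n ∫|f̂(a,z)|²dz ≤ C ((k+n−1)!/(k!(n−1)!)) e^{−√((2k+n)|λ|)Θ(√((2k+n)|λ|))}
iff ∫_1^∞ Θ(t)/t dt < ∞. -/
theorem strichartz_ingham (n : ℕ) (hn : 1 ≤ n) (Θ : ℝ → ℝ)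
    (hpos : ∀ t : ℝ, 0 ≤ t → 0 ≤ Θ t) (hdec : AntitoneOn Θ (Set.Ici 0))
    (hlim : Tendsto Θ atTop (nhds 0)) :
    IntegrableOn (fun t : ℝ => Θ t / t) (Set.Ici 1) (volume : Measure ℝ) ↔
      ∃ f : Hn n → ℂ, Integrable f (volume : Measure (Hn n)) ∧ HasCompactSupport f ∧
        ¬ (f =ᵐ[(volume : Measure (Hn n))] 0) ∧
        ∃ C : ℝ, 0 < C ∧ ∀ lam : ℝ, lam ≠ 0 → ∀ k : ℕ,
          |lam| ^ n * ∫ z : Cn n, ‖stri n f k lam z‖ ^ 2 ≤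
            C * (((k + n - 1).factorial : ℝ) /
                ((Nat.factorial k) * (Nat.factorial (n - 1)))) *
              Real.exp (-(Real.sqrt ((2 * k + n) * |lam|) *
                Θ (Real.sqrt ((2 * k + n) * |lam|)))) := by
  refine ⟨exists_of_integrable hn hpos hdec hlim, ?_⟩
  rintro ⟨f, hf, hfc, hf0, C, hC0, hC⟩
  exact integrable_of_exists hn hpos hdec hf hfc hf0 hC0 hC
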